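/- arXiv:2406.06815 — 4 statements merged into one kernel-verified Lean document; each statement's English description precedes it below -/
import Mathlib

section
/- Fix ε > 0 and a cutoff function χ ∈ C_c^∞((0,1);[0,1]). There exists M₀ ∈ ℕ such that for every M ≥ M₀ and δ ∈ (0,1/2] with M^δ ∈ ℕ and alphabet A = {0,…,M^δ−1}, there is a function r : ℕ → ℝ with r(N) → 0 as N → ∞ such that: for every N ∈ ℕ divisible by M, writing N = α·M^k with α ∈ ℚ, 1 ≤ α < M, and for every irreducible fraction b/q with 0 < q ≤ M^δ and |α/M − b/q| < 1/(q·M^δ), every eigenvalue λ of the open quantum baker's map B_N satisfies |λ| ≤ M^{−(1/2 − δ + γ/2) + ε} + r(N), where γ = log q / log M. -/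
open scoped Classical

noncomputable section

/-- `e^{-2πi x}` -/
def ec (x : ℝ) : ℂ := Complex.exp (-(2 * Real.pi * x) * Complex.I)

/-- The discrete Fourier transform matrix `F_N`, with entries `N^{-1/2} e^{-2πi jl/N}`. -/
def dftMatrix (N : ℕ) : Matrix (Fin N) (Fin N) ℂ :=
  Matrix.of fun j l : Fin N => ((Real.sqrt N)⁻¹ : ℝ) * ec ((j : ℕ) * (l : ℕ) / (N : ℝ))

/-- Multiplication by the indicator function of `S`, as a matrix on `ℂ^N`. -/
def indicatorMatrix (N : ℕ) (S : Finset ℕ) : Matrix (Fin N) (Fin N) ℂ :=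
  Matrix.diagonal fun j => if (j : ℕ) ∈ S then 1 else 0

/-- The discrete Cantor set `C_k = {a₀ + a₁ M + ⋯ + a_{k-1} M^{k-1} : a_j ∈ A}`. -/
def cantorC (M k : ℕ) (A : Finset ℕ) : Finset ℕ :=
  (Fintype.piFinset fun _ : Fin k => A).image fun a => ∑ j : Fin k, a j * M ^ (j : ℕ)

/-- The operator norm of a matrix acting on `ℂ^N` with the ℓ² norm. -/
def opNorm {N : ℕ} (A : Matrix (Fin N) (Fin N) ℂ) : ℝ :=
  ‖Matrix.toEuclideanCLM (𝕜 := ℂ) A‖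

/-- The dilated discrete Cantor set `C_k(N) = { ⌈α j⌉ : j ∈ C_k }`. -/
def cantorCdil (M k : ℕ) (A : Finset ℕ) (α : ℚ) : Finset ℕ :=
  (cantorC M k A).image fun j => (⌈α * (j : ℚ)⌉).toNat

/-- The middle block-diagonal matrix of the open quantum baker's map: `M` diagonal copies of
`χ_{N/M} F_{N/M} χ_{N/M}`. -/
def bakerBlocks (N M : ℕ) (χ : ℝ → ℝ) : Matrix (Fin N) (Fin N) ℂ :=
  Matrix.of fun j l : Fin N =>
    if (j : ℕ) / (N / M) = (l : ℕ) / (N / M) then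
      ((χ ((((j : ℕ) % (N / M) : ℕ) : ℝ) / ((N / M : ℕ) : ℝ)) : ℝ) : ℂ) *
        (((Real.sqrt ((N / M : ℕ) : ℝ))⁻¹ : ℝ) *
          ec (((((j : ℕ) % (N / M)) * ((l : ℕ) % (N / M)) : ℕ) : ℝ) / ((N / M : ℕ) : ℝ))) *
        ((χ ((((l : ℕ) % (N / M) : ℕ) : ℝ) / ((N / M : ℕ) : ℝ)) : ℝ) : ℂ)
    else 0

/-- The open quantum baker's map `B_N = F_N^* · D · I_{A,M}`. -/
def bakerMatrix (N M : ℕ) (A : Finset ℕ) (χ : ℝ → ℝ) : Matrix (Fin N) (Fin N) ℂ :=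
  (dftMatrix N).conjTranspose * bakerBlocks N M χ *
    Matrix.diagonal fun j : Fin N => if (j : ℕ) / (N / M) ∈ A then 1 else 0

section
lemma ec_add (x y : ℝ) : ec (x + y) = ec x * ec y := by
  unfold ec; rw [← Complex.exp_add]; congr 1; push_cast; ring

lemma ec_zero : ec 0 = 1 := by simp [ec]

lemma ec_norm (x : ℝ) : ‖ec x‖ = 1 := by
  unfold ec
  have : (-(2 * Real.pi * x) * Complex.I : ℂ) = ((-(2 * Real.pi * x) : ℝ) : ℂ) * Complex.I := by
    push_cast; ring
  rw [this, Complex.norm_exp_ofReal_mul_I]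

lemma ec_neg (x : ℝ) : ec (-x) = (starRingEnd ℂ) (ec x) := by
  unfold ec
  rw [← Complex.exp_conj]; congr 1
  simp [Complex.conj_ofNat]

lemma ec_nat_mul (x : ℝ) (n : ℕ) : ec (x * n) = ec x ^ n := by
  unfold ec; rw [← Complex.exp_nat_mul]; congr 1; push_cast; ring

lemma ec_int (n : ℤ) : ec n = 1 := by
  unfold ec
  rw [Complex.exp_eq_one_iff]
  exact ⟨-n, by push_cast; ring⟩

/-- distance to the nearest integer -/
def nd (x : ℝ) : ℝ := ‖(x : UnitAddCircle)‖

lemma nd_nonneg (x : ℝ) : 0 ≤ nd x := norm_nonneg _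

lemma nd_eq (x : ℝ) : nd x = |x - round x| := UnitAddCircle.norm_eq

lemma nd_add_le (x y : ℝ) : nd (x + y) ≤ nd x + nd y := by
  unfold nd; rw [AddCircle.coe_add]; exact norm_add_le (x : UnitAddCircle) y

lemma nd_neg (x : ℝ) : nd (-x) = nd x := by
  unfold nd; rw [AddCircle.coe_neg]; exact norm_neg (x : UnitAddCircle)

lemma nd_le_abs (x : ℝ) : nd x ≤ |x| := by
  rw [nd_eq]; simpa using round_le x 0

lemma nd_add_int (x : ℝ) (n : ℤ) : nd (x + n) = nd x := by
  rw [nd_eq, nd_eq, round_add_intCast]; push_cast; congr 1; ring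

/-- lower bound for `nd` on `[-1,1]` -/
lemma le_nd_of_abs {x c : ℝ} (h1 : c ≤ |x|) (h2 : |x| ≤ 1 - c) : c ≤ nd x := by
  rw [nd_eq]
  by_cases h : round x = 0
  · simpa [h] using h1
  · have : (1 : ℝ) ≤ |(round x : ℝ)| := by
      have := Int.one_le_abs h
      exact_mod_cast this
    have h3 := abs_sub_abs_le_abs_sub (round x : ℝ) x
    rw [abs_sub_comm] at h3
    linarith

lemma norm_ec_sub_one (x : ℝ) : 4 * nd x ≤ ‖ec x - 1‖ := by
  have h : ec x = ec (x - round x) := by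
    have := ec_add (x - round x) (round x)
    rw [ec_int, mul_one] at this
    rw [← this]; congr 1; ring
  rw [h, nd_eq]
  set y := x - round x with hy
  have hy2 : |y| ≤ 1 / 2 := abs_sub_round x
  have e : ec y = Complex.exp (Complex.I * ((-(2 * Real.pi * y) : ℝ) : ℂ)) := by
    unfold ec; congr 1; push_cast; ring
  rw [e, Complex.norm_exp_I_mul_ofReal_sub_one]
  have h3 := Real.mul_abs_le_abs_sin (x := -(2 * Real.pi * y) / 2) (by
    rw [show -(2 * Real.pi * y) / 2 = -(Real.pi * y) by ring, abs_neg, abs_mul, abs_of_pos Real.pi_pos]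
    nlinarith [Real.pi_pos])
  rw [norm_mul, Real.norm_eq_abs, Real.norm_eq_abs, abs_two]
  have h4 : |-(2 * Real.pi * y) / 2| = Real.pi * |y| := by
    rw [show -(2 * Real.pi * y) / 2 = -(Real.pi * y) by ring, abs_neg, abs_mul, abs_of_pos Real.pi_pos]
  rw [h4] at h3
  have : 2 / Real.pi * (Real.pi * |y|) = 2 * |y| := by field_simp
  linarith

/-- comparison kernel -/
def Gd (D : ℕ) (x : ℝ) : ℝ := D / (1 + D * nd x)

lemma Gd_nonneg (D : ℕ) (x : ℝ) : 0 ≤ Gd D x := by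
  unfold Gd; have := nd_nonneg x; positivity

lemma Gd_le (D : ℕ) (x : ℝ) : Gd D x ≤ D := by
  unfold Gd; have := nd_nonneg x
  apply div_le_self (by positivity); nlinarith [show (0:ℝ) ≤ D by positivity]

lemma Gd_le_of_nd (D : ℕ) (x c : ℝ) (hc : 0 < c) (h : c ≤ nd x) : Gd D x ≤ 1 / c := by
  unfold Gd; have := nd_nonneg x
  have hD : (0:ℝ) ≤ D := by positivity
  rw [div_le_div_iff₀ (by positivity) hc]
  nlinarith

lemma Gd_stable (D : ℕ) (x y : ℝ) (h : D * |y| ≤ 1) : Gd D (x + y) ≤ 2 * Gd D x := by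
  unfold Gd
  have h1 := nd_nonneg x
  have h2 := nd_nonneg (x + y)
  have h3 : nd x ≤ nd (x + y) + |y| := by
    have := nd_add_le (x + y) (-y)
    rw [add_neg_cancel_right] at this
    have h4 := nd_le_abs (-y)
    rw [abs_neg] at h4
    linarith
  have hD : (0:ℝ) ≤ D := by positivity
  rw [← mul_div_assoc, div_le_div_iff₀ (by positivity) (by positivity)]
  have : 1 + D * nd x ≤ 2 * (1 + D * nd (x + y)) := by nlinarith
  nlinarith

lemma dirichlet_geom (D : ℕ) (x : ℝ) :
    (∑ a ∈ Finset.range D, ec (x * a)) * (ec x - 1) = ec (x * D) - 1 := by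
  simp_rw [ec_nat_mul]
  exact geom_sum_mul (ec x) D

lemma dirichlet_le (D : ℕ) (x : ℝ) :
    ‖∑ a ∈ Finset.range D, ec (x * a)‖ ≤ 2 * Gd D x := by
  set S := ∑ a ∈ Finset.range D, ec (x * a) with hS
  have h1 : ‖S‖ ≤ D := by
    refine (norm_sum_le _ _).trans ?_
    simp [ec_norm]
  have h2 : ‖S‖ * (4 * nd x) ≤ 2 := by
    have := congrArg norm (dirichlet_geom D x)
    rw [norm_mul] at this
    calc ‖S‖ * (4 * nd x) ≤ ‖S‖ * ‖ec x - 1‖ := by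
          gcongr; exact norm_ec_sub_one x
      _ = ‖ec (x * D) - 1‖ := this
      _ ≤ ‖ec (x * D)‖ + ‖(1:ℂ)‖ := norm_sub_le _ _
      _ = 2 := by rw [ec_norm]; norm_num
  unfold Gd
  have := nd_nonneg x
  rw [← mul_div_assoc, le_div_iff₀ (by positivity)]
  have hD : (0:ℝ) ≤ D := by positivity
  nlinarith

lemma ec_orth (N : ℕ) (d : ℤ) (h0 : d ≠ 0) (h : |d| < N) :
    ∑ a ∈ Finset.range N, ec ((d : ℝ) / N * a) = 0 := by
  have hN : (0:ℝ) < N := by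
    have := abs_nonneg d
    have : (0:ℤ) < N := by omega
    exact_mod_cast this
  have hg := dirichlet_geom N ((d:ℝ) / N)
  rw [div_mul_cancel₀ _ hN.ne', ec_int, sub_self] at hg
  rcases mul_eq_zero.1 hg with h1 | h1
  · exact h1
  exfalso
  have h2 := norm_ec_sub_one ((d:ℝ) / N)
  rw [h1, norm_zero] at h2
  have h3 : (1:ℝ) / N ≤ nd ((d:ℝ) / N) := by
    have e : |(d:ℝ) / N| = (|d| : ℤ) / N := by rw [abs_div, abs_of_pos hN]; push_cast; rfl
    apply le_nd_of_abs
    · rw [e]; gcongr; exact_mod_cast Int.one_le_abs h0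
    · rw [e, div_le_iff₀ hN, sub_mul, div_mul_cancel₀ _ hN.ne']
      have : |d| + 1 ≤ N := by omega
      have : ((|d| : ℤ) : ℝ) + 1 ≤ N := by exact_mod_cast this
      linarith
  have : 0 < (1:ℝ) / N := by positivity
  linarith
end

section
lemma sum_perm_le (q : ℕ) (hq : 0 < q) (p r0 : ℤ) (hp : Int.gcd p q = 1) (f : ℤ → ℝ)
    (hf : ∀ n, 0 ≤ f n) (hper : ∀ n, f (n % q) = f n) :
    ∑ r ∈ Finset.range q, f (p * r + r0) ≤ ∑ r ∈ Finset.range q, f r := by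
  have hq' : (0:ℤ) < q := by exact_mod_cast hq
  have hinj : Set.InjOn (fun r : ℕ => ((p * r + r0) % q).toNat) (Finset.range q : Set ℕ) := by
    intro a ha b hb hab
    simp only [Finset.coe_range, Set.mem_Iio] at ha hb
    simp only at hab
    have h1 := Int.emod_nonneg (p * a + r0) hq'.ne'
    have h2 := Int.emod_nonneg (p * b + r0) hq'.ne'
    have h3 : (p * a + r0) % q = (p * b + r0) % q := by omega
    have h4 : (q:ℤ) ∣ p * ((a:ℤ) - b) := by
      have := Int.emod_emod_of_dvd (p * a + r0) (dvd_refl (q:ℤ))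
      have h5 := Int.ModEq.dvd (show (p * b + r0) ≡ (p * a + r0) [ZMOD q] from h3.symm)
      have e : p * a + r0 - (p * b + r0) = p * ((a:ℤ) - b) := by ring
      rwa [e] at h5
    have h6 : (q:ℤ) ∣ (a:ℤ) - b := by
      refine Int.dvd_of_dvd_mul_right_of_gcd_one h4 ?_
      rw [Int.gcd_comm]; exact hp
    have h7 : |(a:ℤ) - b| < q := by rw [abs_lt]; constructor <;> omega
    have h8 := Int.eq_zero_of_abs_lt_dvd h6 h7
    omega
  have e : ∑ r ∈ Finset.range q, f (p * r + r0)
      = ∑ s ∈ (Finset.range q).image (fun r : ℕ => ((p * r + r0) % q).toNat), f s := by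
    rw [Finset.sum_image hinj]
    refine Finset.sum_congr rfl fun r _ => ?_
    rw [Int.toNat_of_nonneg (Int.emod_nonneg _ hq'.ne'), hper]
  rw [e]
  refine Finset.sum_le_sum_of_subset_of_nonneg ?_ fun i _ _ => hf _
  intro s hs
  obtain ⟨r, _, rfl⟩ := Finset.mem_image.1 hs
  have h1 := Int.emod_nonneg (p * r + r0) hq'.ne'
  have h2 := Int.emod_lt_of_pos (p * r + r0) hq'
  simp only [Finset.mem_range]; omega

def gaux (D q r : ℕ) : ℝ := if r = 0 then D else (q:ℝ) / r

lemma gaux_nonneg (D q r : ℕ) : 0 ≤ gaux D q r := by unfold gaux; split_ifs <;> positivity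

lemma sum_gaux (D q : ℕ) (hq : 0 < q) (hqD : q ≤ D) :
    ∑ r ∈ Finset.range q, gaux D q r ≤ 2 * D * (1 + Real.log D) := by
  obtain ⟨p, rfl⟩ : ∃ p, q = p + 1 := ⟨q - 1, by omega⟩
  rw [Finset.sum_range_succ']
  have hD1 : (1:ℝ) ≤ D := by exact_mod_cast (by omega : 1 ≤ D)
  have hl := Real.log_nonneg hD1
  have e : ∑ k ∈ Finset.range p, gaux D (p+1) (k+1) = ((p+1 : ℕ):ℝ) * (harmonic p : ℝ) := by
    unfold harmonic gaux
    push_cast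
    rw [Finset.mul_sum]
    refine Finset.sum_congr rfl fun i _ => ?_
    simp [div_eq_mul_inv]
  have h1 : (harmonic p : ℝ) ≤ 1 + Real.log D := by
    refine (harmonic_le_one_add_log p).trans ?_
    rcases Nat.eq_zero_or_pos p with rfl | hp
    · simpa using hl
    · gcongr; omega
  have h0 : (0:ℝ) ≤ harmonic p := by unfold harmonic; push_cast; positivity
  have h2 : ((p+1:ℕ):ℝ) ≤ D := by exact_mod_cast hqD
  rw [e]
  have : gaux D (p+1) 0 = D := by simp [gaux]
  rw [this]
  nlinarith [mul_le_mul h2 h1 h0 (by positivity)]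

lemma block_sum (D q : ℕ) (p : ℤ) (z : ℝ) (hq : 0 < q) (hqD : q ≤ D) (hp : Int.gcd p q = 1) :
    ∑ r ∈ Finset.range q, Gd D ((p:ℝ) / q * r + z) ≤ 4 * D * (1 + Real.log D) := by
  have hqr : (0:ℝ) < q := by exact_mod_cast hq
  set t := Int.fract (q * z) with ht
  set r0 := ⌊(q:ℝ) * z⌋ with hr0
  have hz : z = (r0 + t) / q := by
    rw [ht, hr0, Int.floor_add_fract]; field_simp
  have ht0 : 0 ≤ t := Int.fract_nonneg _
  have ht1 : t < 1 := Int.fract_lt_one _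
  let f : ℤ → ℝ := fun n => Gd D ((n + t) / q)
  have hper : ∀ n : ℤ, f (n % q) = f n := by
    intro n
    simp only [f, Gd]
    have : ((n:ℝ) + t) / q = (((n % q : ℤ):ℝ) + t) / q + ((n / q : ℤ):ℝ) := by
      have h : (n:ℝ) = ((n % q : ℤ):ℝ) + q * ((n / q : ℤ):ℝ) := by
        exact_mod_cast (Int.emod_add_mul_ediv n q).symm
      rw [h]; field_simp; push_cast; ring_nf
    rw [this, nd_add_int]
  have h1 := sum_perm_le q hq p r0 hp f (fun n => Gd_nonneg _ _) hper
  have e : ∀ r : ℕ, Gd D ((p:ℝ) / q * r + z) = f (p * r + r0) := by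
    intro r; simp only [f]; congr 1; rw [hz]; push_cast; ring
  simp_rw [e]
  refine h1.trans ?_
  have h2 : ∀ r ∈ Finset.range q, f r ≤ gaux D q r + gaux D q (q - 1 - r) := by
    intro r hr
    rw [Finset.mem_range] at hr
    have n1 := gaux_nonneg D q r
    have n2 := gaux_nonneg D q (q - 1 - r)
    by_cases hc : r = 0
    · have : gaux D q r = D := by simp [gaux, hc]
      have := Gd_le D (((r:ℤ) + t) / q)
      simp only [f]; linarith
    by_cases hc' : q - 1 - r = 0
    · have : gaux D q (q - 1 - r) = D := by simp [gaux, hc']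
      have := Gd_le D (((r:ℤ) + t) / q)
      simp only [f]; linarith
    have hg1 : gaux D q r = q / r := by simp [gaux, hc]
    have hg2 : gaux D q (q - 1 - r) = q / ((q - 1 - r : ℕ):ℝ) := by
      unfold gaux; rw [if_neg hc']
    have key : ∀ s : ℕ, 0 < s → s ≤ r → s ≤ q - 1 - r → f r ≤ q / s := by
      intro s hs h1 h2
      have hs' : (0:ℝ) < s := by exact_mod_cast hs
      have := Gd_le_of_nd D (((r:ℤ) + t) / q) (s / q) (by positivity) ?_
      · rw [one_div_div] at this; exact this
      have a1 : (s:ℝ) ≤ r := by exact_mod_cast h1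
      have a2 : (s:ℝ) + 1 + r ≤ q := by
        have : s + 1 + r ≤ q := by omega
        exact_mod_cast this
      have hnn : (0:ℝ) ≤ (((r:ℤ):ℝ) + t) / q := by push_cast; positivity
      apply le_nd_of_abs
      · rw [abs_of_nonneg hnn]; gcongr; push_cast; linarith
      · rw [abs_of_nonneg hnn, le_sub_iff_add_le, ← add_div, div_le_one hqr]; push_cast; linarith
    rcases le_total r (q - 1 - r) with h | h
    · have := key r (by omega) le_rfl h; linarith
    · have := key (q - 1 - r) (by omega) h le_rfl; linarith
  refine (Finset.sum_le_sum h2).trans ?_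
  rw [Finset.sum_add_distrib, Finset.sum_range_reflect (fun r => gaux D q r) q]
  have := sum_gaux D q hq hqD
  linarith

lemma sum_blocks (q B : ℕ) (f : ℕ → ℝ) (W : ℝ)
    (h : ∀ s, ∑ r ∈ Finset.range q, f (s + r) ≤ W) :
    ∑ b ∈ Finset.range (q * B), f b ≤ B * W := by
  induction B with
  | zero => simp
  | succ B ih =>
    rw [Nat.mul_succ, Finset.sum_range_add]
    have := h (q * B)
    push_cast
    linarith

lemma V_bound (D q : ℕ) (p : ℤ) (β z : ℝ) (hq : 0 < q) (hqD : q ≤ D) (hp : Int.gcd p q = 1)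
    (hβ : |β - p / q| < 1 / (q * D)) :
    ∑ b ∈ Finset.range D, Gd D (β * b + z) ≤ 16 * ((D:ℝ) ^ 2 / q * (1 + Real.log D)) := by
  have hqr : (0:ℝ) < q := by exact_mod_cast hq
  have hDr : (0:ℝ) < D := by exact_mod_cast (by omega : 0 < D)
  have hl : 0 ≤ Real.log D := Real.log_nonneg (by exact_mod_cast (by omega : 1 ≤ D))
  have hB : D ≤ q * (D / q + 1) := by
    have := Nat.div_add_mod D q
    have := Nat.mod_lt D hq
    rw [Nat.mul_succ]; omega
  have h1 : ∑ b ∈ Finset.range D, Gd D (β * b + z)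
      ≤ ∑ b ∈ Finset.range (q * (D / q + 1)), Gd D (β * b + z) := by
    refine Finset.sum_le_sum_of_subset_of_nonneg ?_ fun i _ _ => Gd_nonneg _ _
    exact Finset.range_subset_range.2 hB
  have h2 := sum_blocks q (D / q + 1) (fun b => Gd D (β * b + z)) (8 * D * (1 + Real.log D)) ?_
  · refine h1.trans (h2.trans ?_)
    have : ((D / q + 1 : ℕ):ℝ) ≤ 2 * (D / q) := by
      have a : ((D / q : ℕ):ℝ) ≤ (D:ℝ) / q := Nat.cast_div_le
      have b : 1 ≤ (D:ℝ) / q := by rw [le_div_iff₀ hqr]; simpa using (by exact_mod_cast hqD : (q:ℝ) ≤ D)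
      push_cast; linarith
    calc _ ≤ (2 * ((D:ℝ) / q)) * (8 * D * (1 + Real.log D)) := by gcongr
      _ = _ := by ring
  intro s
  have h3 := block_sum D q p (β * s + z) hq hqD hp
  have h4 : ∀ r ∈ Finset.range q, Gd D (β * ((s + r : ℕ):ℝ) + z)
      ≤ 2 * Gd D ((p:ℝ) / q * r + (β * s + z)) := by
    intro r hr
    have hr' : (r:ℝ) ≤ q := by exact_mod_cast (Finset.mem_range.1 hr).le
    have := Gd_stable D ((p:ℝ) / q * r + (β * s + z)) ((β - p / q) * r) ?_
    · refine le_trans (le_of_eq ?_) this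
      congr 1; push_cast; ring
    rw [abs_mul, Nat.abs_cast]
    calc (D:ℝ) * (|β - p / q| * r) ≤ D * (1 / (q * D) * q) := by gcongr
      _ = 1 := by field_simp
  refine (Finset.sum_le_sum h4).trans ?_
  rw [← Finset.mul_sum]; linarith
end

section
/-- Cantor set of numbers with `n` digits in `{0,…,D-1}` in base `M`. -/
def CC (M D : ℕ) : ℕ → Finset ℕ
  | 0 => {0}
  | n + 1 => (CC M D n ×ˢ Finset.range D).image (fun p => p.2 + M * p.1)

lemma sum_CC_succ {E : Type*} [AddCommMonoid E] (M D n : ℕ) (hD : D ≤ M) (f : ℕ → E) :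
    ∑ c ∈ CC M D (n + 1), f c = ∑ c ∈ CC M D n, ∑ b ∈ Finset.range D, f (b + M * c) := by
  rw [CC, Finset.sum_image, Finset.sum_product]
  rintro ⟨c, b⟩ h ⟨c', b'⟩ h' e
  simp only [Finset.coe_product, Set.mem_prod, Finset.mem_coe, Finset.mem_range] at h h'
  simp only at e
  have h1 : b = b' := by
    have := congrArg (· % M) e
    simp only [Nat.add_mul_mod_self_left] at this
    rwa [Nat.mod_eq_of_lt (by omega), Nat.mod_eq_of_lt (by omega)] at this
  subst h1
  have : M * c = M * c' := by omega
  have : c = c' := Nat.eq_of_mul_eq_mul_left (by omega) this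
  rw [this]

lemma mem_CC_succ {M D n c : ℕ} :
    c ∈ CC M D (n + 1) ↔ ∃ c1 ∈ CC M D n, ∃ b < D, c = b + M * c1 := by
  rw [CC]
  simp only [Finset.mem_image, Finset.mem_product, Finset.mem_range, Prod.exists]
  constructor
  · rintro ⟨a, b, ⟨h1, h2⟩, rfl⟩; exact ⟨a, h1, b, h2, rfl⟩
  · rintro ⟨a, h1, b, h2, rfl⟩; exact ⟨a, b, ⟨h1, h2⟩, rfl⟩

lemma CC_top {M D n a c : ℕ} (ha : a < D) (hc : c ∈ CC M D n) : a * M ^ n + c ∈ CC M D (n + 1) := by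
  induction n generalizing c with
  | zero =>
    simp only [CC, Finset.mem_singleton] at hc
    exact mem_CC_succ.2 ⟨0, by simp [CC], a, ha, by simp [hc]⟩
  | succ n ih =>
    obtain ⟨c1, h1, b, hb, rfl⟩ := mem_CC_succ.1 hc
    exact mem_CC_succ.2 ⟨_, ih h1, b, hb, by ring⟩

lemma CC_lt {M D n c : ℕ} (hD : D ≤ M) (hc : c ∈ CC M D n) : c < M ^ n := by
  induction n generalizing c with
  | zero => simp only [CC, Finset.mem_singleton] at hc; simp [hc]
  | succ n ih =>
    obtain ⟨c1, h1, b, hb, rfl⟩ := mem_CC_succ.1 hc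
    have := ih h1
    have h2 : M * (c1 + 1) ≤ M * M ^ n := Nat.mul_le_mul_left _ this
    rw [pow_succ, mul_comm (M ^ n)]
    rw [Nat.mul_succ] at h2
    omega

lemma CC_mod {M D n c : ℕ} (hD0 : 0 < D) (hD : D ≤ M) (hc : c ∈ CC M D n) (s : ℕ) :
    c % M ^ (s + 1) < D * M ^ s := by
  have hM : 0 < M := by omega
  induction n generalizing c s with
  | zero => simp only [CC, Finset.mem_singleton] at hc; subst hc; rw [Nat.zero_mod]; positivity
  | succ n ih =>
    obtain ⟨c1, h1, b, hb, rfl⟩ := mem_CC_succ.1 hc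
    cases s with
    | zero =>
      simp only [zero_add, pow_one, pow_zero, mul_one, Nat.add_mul_mod_self_left]
      rwa [Nat.mod_eq_of_lt (by omega)]
    | succ s =>
      have h2 := ih h1 s
      have e : (b + M * c1) % M ^ (s + 1 + 1) = b + M * (c1 % M ^ (s + 1)) := by
        rw [pow_succ M (s+1), mul_comm _ M, Nat.mod_mul, Nat.add_mul_mod_self_left,
          Nat.mod_eq_of_lt (by omega : b < M), Nat.add_mul_div_left _ _ hM,
          Nat.div_eq_of_lt (by omega : b < M), zero_add]
      rw [e]
      have h3 : M * (c1 % M ^ (s + 1) + 1) ≤ M * (D * M ^ s) := Nat.mul_le_mul_left _ h2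
      have : D * M ^ (s + 1) = M * (D * M ^ s) := by ring
      rw [this]; rw [Nat.mul_succ] at h3; omega

lemma sum_ec_CC (M D n : ℕ) (hD : D ≤ M) (θ : ℝ) :
    ∑ j ∈ CC M D n, ec (θ * j) = ∏ i ∈ Finset.range n, ∑ a ∈ Finset.range D, ec (θ * M ^ i * a) := by
  induction n generalizing θ with
  | zero => simp [CC, ec_zero]
  | succ n ih =>
    rw [sum_CC_succ _ _ _ hD, Finset.prod_range_succ', pow_zero, mul_one]
    have : ∀ i, θ * (M:ℝ) ^ (i + 1) = (θ * M) * M ^ i := by intro i; ring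
    simp_rw [this]
    rw [← ih, Finset.sum_mul]
    refine Finset.sum_congr rfl fun c _ => ?_
    rw [Finset.mul_sum]
    refine Finset.sum_congr rfl fun b _ => ?_
    rw [← ec_add]; congr 1; push_cast; ring

lemma CC_card (M D n : ℕ) (hD : D ≤ M) : (CC M D n).card = D ^ n := by
  induction n with
  | zero => simp [CC]
  | succ n ih =>
    have := sum_CC_succ M D n hD (fun _ => 1)
    simp only [Finset.sum_const, smul_eq_mul, mul_one, Finset.card_range] at this
    rw [this, ih, pow_succ]

lemma sum_prod_Gd (M D m g : ℕ) (hM : 0 < M) (hD : D ≤ M) (β V : ℝ) (hV0 : 0 ≤ V)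
    (hV : ∀ z, ∑ b ∈ Finset.range D, Gd D (β * b + z) ≤ V) (z : ℝ) :
    ∑ c ∈ CC M D (m + g), ∏ s ∈ Finset.range m, Gd D (β * ((c / M ^ s : ℕ):ℝ) + z / M ^ s)
      ≤ V ^ m * D ^ g := by
  have hMr : (0:ℝ) < M := by exact_mod_cast hM
  induction m generalizing z with
  | zero => simp [CC_card M D g hD]
  | succ m ih =>
    rw [show m + 1 + g = (m + g) + 1 by ring, sum_CC_succ _ _ _ hD]
    have h1 : ∀ c ∈ CC M D (m + g), ∑ b ∈ Finset.range D, ∏ s ∈ Finset.range (m + 1),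
        Gd D (β * (((b + M * c) / M ^ s : ℕ):ℝ) + z / M ^ s)
        ≤ V * ∏ s ∈ Finset.range m, Gd D (β * ((c / M ^ s : ℕ):ℝ) + (z / M) / M ^ s) := by
      intro c _
      have h2 : ∀ b ∈ Finset.range D, ∏ s ∈ Finset.range (m + 1),
        Gd D (β * (((b + M * c) / M ^ s : ℕ):ℝ) + z / M ^ s) =
         Gd D (β * b + (β * (M * c) + z)) *
          ∏ s ∈ Finset.range m, Gd D (β * ((c / M ^ s : ℕ):ℝ) + (z / M) / M ^ s) := by
        intro b hb
        have hb' : b < M := by have := Finset.mem_range.1 hb; omega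
        rw [Finset.prod_range_succ', mul_comm]
        congr 1
        · simp only [pow_zero, Nat.div_one, div_one]; congr 1; push_cast; ring
        · refine Finset.prod_congr rfl fun s _ => ?_
          have : (b + M * c) / M ^ (s + 1) = c / M ^ s := by
            rw [pow_succ', ← Nat.div_div_eq_div_mul, Nat.add_mul_div_left _ _ hM,
              Nat.div_eq_of_lt hb', zero_add]
          rw [this, pow_succ, mul_comm ((M:ℝ)^s), div_div]
      rw [Finset.sum_congr rfl h2, ← Finset.sum_mul]
      gcongr
      · exact Finset.prod_nonneg fun _ _ => Gd_nonneg _ _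
      · exact hV _
    refine (Finset.sum_le_sum h1).trans ?_
    rw [← Finset.mul_sum, pow_succ', mul_assoc]
    gcongr
    exact ih (z / M)

lemma cantor_schur (M D m g : ℕ) (hD0 : 0 < D) (hD : D * D ≤ M) (β V : ℝ) (hβ0 : 0 ≤ β) (hβ1 : β ≤ 1)
    (hV0 : 0 ≤ V)
    (hV : ∀ z, ∑ b ∈ Finset.range D, Gd D (β * b + z) ≤ V) (y : ℝ) :
    ∑ c ∈ CC M D (m + g), ‖∑ j ∈ CC M D (m + g), ec (β * M / M ^ m * (c - y) * j)‖
      ≤ (4 * V) ^ m * D ^ (2 * g) := by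
  have hDM : D ≤ M := le_trans (Nat.le_mul_of_pos_left _ hD0) hD
  have hM : 0 < M := by omega
  have hMr : (0:ℝ) < M := by exact_mod_cast hM
  have h1 : ∀ c ∈ CC M D (m + g), ‖∑ j ∈ CC M D (m + g), ec (β * M / M ^ m * (c - y) * j)‖
      ≤ 4 ^ m * D ^ g * ∏ s ∈ Finset.range m, Gd D (β * ((c / M ^ s : ℕ):ℝ) + (- β * y) / M ^ s) := by
    intro c hc
    rw [sum_ec_CC _ _ _ hDM, norm_prod, Finset.prod_range_add]
    have hb : ∏ x ∈ Finset.range g, ‖∑ a ∈ Finset.range D,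
        ec (β * M / M ^ m * (c - y) * M ^ (m + x) * a)‖ ≤ D ^ g := by
      refine (Finset.prod_le_prod (fun _ _ => norm_nonneg _) (g := fun _ => (D:ℝ)) ?_).trans (by simp)
      intro i _
      refine (norm_sum_le _ _).trans ?_
      simp [ec_norm]
    have ha : ∏ x ∈ Finset.range m, ‖∑ a ∈ Finset.range D,
        ec (β * M / M ^ m * (c - y) * M ^ x * a)‖ ≤
        4 ^ m * ∏ s ∈ Finset.range m, Gd D (β * ((c / M ^ s : ℕ):ℝ) + (- β * y) / M ^ s) := by
      rw [← Finset.prod_range_reflect (fun x => ‖∑ a ∈ Finset.range D,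
        ec (β * M / M ^ m * (c - y) * M ^ x * a)‖) m]
      have : (4:ℝ) ^ m = ∏ s ∈ Finset.range m, (4:ℝ) := by simp
      rw [this, ← Finset.prod_mul_distrib]
      refine Finset.prod_le_prod (fun _ _ => norm_nonneg _) ?_
      intro s hs
      have hs' := Finset.mem_range.1 hs
      have e : β * M / M ^ m * (c - y) * M ^ (m - 1 - s)
          = (β * ((c / M ^ s : ℕ):ℝ) + (- β * y) / M ^ s) + β * ((c % M ^ s : ℕ):ℝ) / M ^ s := by
        have h2 : (c:ℝ) = M ^ s * ((c / M ^ s : ℕ):ℝ) + ((c % M ^ s : ℕ):ℝ) := by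
          exact_mod_cast (Nat.div_add_mod c (M ^ s)).symm
        have h3 : (M:ℝ) ^ m = M * M ^ s * M ^ (m - 1 - s) := by
          rw [← pow_succ', ← pow_add]; congr 1; omega
        have h4 : β * M / M ^ m * (c - y) * M ^ (m - 1 - s) = β * (c - y) / M ^ s := by
          rw [h3]; field_simp
        rw [h4]
        nth_rewrite 1 [h2]
        field_simp; ring
      refine (dirichlet_le D _).trans ?_
      rw [e]
      have := Gd_stable D (β * ((c / M ^ s : ℕ):ℝ) + (- β * y) / M ^ s) (β * ((c % M ^ s : ℕ):ℝ) / M ^ s) ?_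
      · linarith
      rw [abs_of_nonneg (by positivity)]
      cases s with
      | zero => simp [Nat.mod_one]
      | succ s =>
        have h5 := CC_mod hD0 hDM hc s
        have h6 : ((c % M ^ (s+1) : ℕ):ℝ) ≤ D * M ^ s := by exact_mod_cast h5.le
        have h7 : (D:ℝ) * D ≤ M := by exact_mod_cast hD
        calc (D:ℝ) * (β * ((c % M ^ (s+1) : ℕ):ℝ) / M ^ (s+1))
            ≤ D * (1 * (D * M ^ s) / M ^ (s+1)) := by gcongr
          _ = (D * D) / M := by rw [pow_succ]; field_simp
          _ ≤ 1 := by rw [div_le_one hMr]; exact h7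
    calc _ ≤ _ := mul_le_mul ha hb (Finset.prod_nonneg fun _ _ => norm_nonneg _)
                  (mul_nonneg (by positivity) (Finset.prod_nonneg fun _ _ => Gd_nonneg _ _))
      _ = _ := by ring
  refine (Finset.sum_le_sum h1).trans ?_
  rw [← Finset.mul_sum]
  calc _ ≤ 4 ^ m * (D:ℝ) ^ g * (V ^ m * D ^ g) := by
        gcongr; exact sum_prod_Gd M D m g hM hDM β V hV0 hV _
    _ = _ := by rw [mul_pow]; ring
end

section
/-- bilinear form bound -/
def BB {ι κ : Type*} (s : Finset ι) (t : Finset κ) (K : ι → κ → ℂ) (C : ℝ) : Prop :=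
  ∀ (u : ι → ℂ) (v : κ → ℂ), ‖∑ i ∈ s, ∑ j ∈ t, u i * K i j * v j‖
    ≤ C * (√(∑ i ∈ s, ‖u i‖ ^ 2) * √(∑ j ∈ t, ‖v j‖ ^ 2))

lemma BB_mul {ι κ : Type*} {s : Finset ι} {t : Finset κ} {K : ι → κ → ℂ} {C : ℝ} (hC : 0 ≤ C)
    (h : BB s t K C) (f : ι → ℂ) (g : κ → ℂ) (hf : ∀ i ∈ s, ‖f i‖ ≤ 1) (hg : ∀ j ∈ t, ‖g j‖ ≤ 1) :
    BB s t (fun i j => f i * K i j * g j) C := by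
  intro u v
  have h1 := h (fun i => u i * f i) (fun j => v j * g j)
  have e : ∑ i ∈ s, ∑ j ∈ t, u i * (f i * K i j * g j) * v j
      = ∑ i ∈ s, ∑ j ∈ t, (u i * f i) * K i j * (v j * g j) := by
    refine Finset.sum_congr rfl fun i _ => Finset.sum_congr rfl fun j _ => by ring
  rw [e]
  refine h1.trans ?_
  have a : ∀ (x y : ℂ), ‖y‖ ≤ 1 → ‖x * y‖ ≤ ‖x‖ := by
    intro x y hy
    rw [norm_mul]
    exact mul_le_of_le_one_right (norm_nonneg _) hy
  gcongr with i hi j hj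
  · exact a _ _ (hf i hi)
  · exact a _ _ (hg j hj)

lemma BB_exp {ι κ : Type*} {s : Finset ι} {t : Finset κ} {K : ι → κ → ℂ} {C : ℝ} (hC : 0 ≤ C)
    (h : BB s t K C) (f : ι → ℂ) (g : κ → ℂ) (hf : ∀ i ∈ s, ‖f i‖ ≤ 1) (hg : ∀ j ∈ t, ‖g j‖ ≤ 1)
    (z : ℂ) :
    BB s t (fun i j => K i j * Complex.exp (z * (f i * g j))) (C * Real.exp ‖z‖) := by
  intro u v
  set W := √(∑ i ∈ s, ‖u i‖ ^ 2) * √(∑ j ∈ t, ‖v j‖ ^ 2) with hW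
  have hW0 : 0 ≤ W := by positivity
  let a : ℕ → ℂ := fun p => z ^ p / (p.factorial : ℂ) *
    ∑ i ∈ s, ∑ j ∈ t, u i * (f i ^ p * K i j * g j ^ p) * v j
  have hs : HasSum a (∑ i ∈ s, ∑ j ∈ t, u i * (K i j * Complex.exp (z * (f i * g j))) * v j) := by
    have e : a = fun p => ∑ i ∈ s, ∑ j ∈ t,
        (u i * K i j * v j) * ((z * (f i * g j)) ^ p / (p.factorial : ℂ)) := by
      funext p
      simp only [a, Finset.mul_sum]
      refine Finset.sum_congr rfl fun i _ => Finset.sum_congr rfl fun j _ => ?_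
      rw [mul_pow, mul_pow]; ring
    rw [e]
    refine hasSum_sum fun i _ => hasSum_sum fun j _ => ?_
    have h1 : HasSum (fun p : ℕ => (z * (f i * g j)) ^ p / (p.factorial : ℂ))
        (Complex.exp (z * (f i * g j))) := by
      rw [Complex.exp_eq_exp_ℂ]
      exact NormedSpace.expSeries_div_hasSum_exp _
    have := h1.mul_left (u i * K i j * v j)
    have e2 : u i * (K i j * Complex.exp (z * (f i * g j))) * v j
        = u i * K i j * v j * Complex.exp (z * (f i * g j)) := by ring
    rw [e2]; exact this
  have hr : HasSum (fun p : ℕ => ‖z‖ ^ p / (p.factorial : ℝ) * (C * W)) (Real.exp ‖z‖ * (C * W)) := by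
    apply HasSum.mul_right
    rw [Real.exp_eq_exp_ℝ]
    exact NormedSpace.expSeries_div_hasSum_exp _
  have hle : ∀ p, ‖a p‖ ≤ ‖z‖ ^ p / (p.factorial : ℝ) * (C * W) := by
    intro p
    simp only [a]
    rw [norm_mul, norm_div, norm_pow, Complex.norm_natCast]
    gcongr
    refine BB_mul hC h (fun i => f i ^ p) (fun j => g j ^ p) ?_ ?_ u v
    · intro i hi; rw [norm_pow]; exact pow_le_one₀ (norm_nonneg _) (hf i hi)
    · intro i hi; rw [norm_pow]; exact pow_le_one₀ (norm_nonneg _) (hg i hi)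
  have := hs.norm_le_of_bounded hr hle
  calc _ ≤ _ := this
    _ = _ := by ring

lemma BB_schur {ι κ : Type*} {s : Finset ι} {t : Finset κ} {K : ι → κ → ℂ} {A : ℝ} (hA : 0 ≤ A)
    (h : ∀ j' ∈ t, ∑ j ∈ t, ‖∑ i ∈ s, K i j * (starRingEnd ℂ) (K i j')‖ ≤ A) : BB s t K (√A) := by
  intro u v
  let w : ι → ℂ := fun i => ∑ j ∈ t, K i j * v j
  have e : ∑ i ∈ s, ∑ j ∈ t, u i * K i j * v j = ∑ i ∈ s, u i * w i := by
    refine Finset.sum_congr rfl fun i _ => ?_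
    simp only [w, Finset.mul_sum]
    exact Finset.sum_congr rfl fun j _ => by ring
  rw [e]
  have h1 : ‖∑ i ∈ s, u i * w i‖ ≤ √(∑ i ∈ s, ‖u i‖ ^ 2) * √(∑ i ∈ s, ‖w i‖ ^ 2) := by
    refine (norm_sum_le _ _).trans ?_
    simp_rw [norm_mul]
    exact Real.sum_mul_le_sqrt_mul_sqrt s _ _
  let G : κ → κ → ℂ := fun j j' => ∑ i ∈ s, K i j * (starRingEnd ℂ) (K i j')
  have hG : ∀ j j', ‖G j j'‖ = ‖G j' j‖ := by
    intro j j'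
    have : G j j' = (starRingEnd ℂ) (G j' j) := by
      simp only [G, map_sum, map_mul, Complex.conj_conj]
      exact Finset.sum_congr rfl fun i _ => by ring
    rw [this, Complex.norm_conj]
  have h2 : ∑ i ∈ s, ‖w i‖ ^ 2 ≤ A * ∑ j ∈ t, ‖v j‖ ^ 2 := by
    have e2 : ((∑ i ∈ s, ‖w i‖ ^ 2 : ℝ) : ℂ) = ∑ j ∈ t, ∑ j' ∈ t, v j * (starRingEnd ℂ) (v j') * G j j' := by
      push_cast
      have : ∀ i ∈ s, ((‖w i‖:ℂ)) ^ 2 = ∑ j ∈ t, ∑ j' ∈ t, v j * (starRingEnd ℂ) (v j') *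
          (K i j * (starRingEnd ℂ) (K i j')) := by
        intro i _
        rw [← Complex.mul_conj']
        simp only [w, map_sum, map_mul]
        rw [Finset.sum_mul_sum]
        exact Finset.sum_congr rfl fun j _ => Finset.sum_congr rfl fun j' _ => by ring
      rw [Finset.sum_congr rfl this, Finset.sum_comm]
      refine Finset.sum_congr rfl fun j _ => ?_
      rw [Finset.sum_comm]
      refine Finset.sum_congr rfl fun j' _ => ?_
      rw [← Finset.mul_sum]
    have e3 : ∑ i ∈ s, ‖w i‖ ^ 2 = ‖((∑ i ∈ s, ‖w i‖ ^ 2 : ℝ) : ℂ)‖ := by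
      rw [Complex.norm_real, Real.norm_of_nonneg (by positivity)]
    rw [e3, e2]
    have h3 : ‖∑ j ∈ t, ∑ j' ∈ t, v j * (starRingEnd ℂ) (v j') * G j j'‖ ≤
        ∑ j ∈ t, ∑ j' ∈ t, (1/2 * (‖v j‖ ^ 2 * ‖G j' j‖) + 1/2 * (‖v j'‖ ^ 2 * ‖G j j'‖)) := by
      refine (norm_sum_le _ _).trans (Finset.sum_le_sum fun j _ => ?_)
      refine (norm_sum_le _ _).trans (Finset.sum_le_sum fun j' _ => ?_)
      rw [norm_mul, norm_mul, Complex.norm_conj, hG j' j]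
      nlinarith [mul_nonneg (sq_nonneg (‖v j‖ - ‖v j'‖)) (norm_nonneg (G j j'))]
    refine h3.trans ?_
    have h4 : ∑ j ∈ t, ∑ j' ∈ t, ‖v j‖ ^ 2 * ‖G j' j‖ ≤ A * ∑ j ∈ t, ‖v j‖ ^ 2 := by
      rw [Finset.mul_sum]
      refine Finset.sum_le_sum fun j hj => ?_
      rw [← Finset.mul_sum, mul_comm]
      gcongr
      exact h j hj
    have h5 : ∑ j ∈ t, ∑ j' ∈ t, ‖v j'‖ ^ 2 * ‖G j j'‖ = ∑ j ∈ t, ∑ j' ∈ t, ‖v j‖ ^ 2 * ‖G j' j‖ :=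
      Finset.sum_comm
    simp_rw [Finset.sum_add_distrib, ← Finset.mul_sum]
    simp_rw [Finset.mul_sum] at h4 h5 ⊢
    simp_rw [← Finset.mul_sum] at h4 h5 ⊢
    simp_rw [Finset.mul_sum] at h5
    simp only [← Finset.mul_sum] at h5
    linarith
  refine h1.trans ?_
  calc _ ≤ √(∑ i ∈ s, ‖u i‖ ^ 2) * √(A * ∑ j ∈ t, ‖v j‖ ^ 2) := by gcongr
    _ = _ := by rw [Real.sqrt_mul hA]; ring

/-- the clean kernel on the Cantor set -/
lemma cantor_BB (M D m g : ℕ) (hD0 : 0 < D) (hD : D * D ≤ M) (β V : ℝ) (hβ0 : 0 ≤ β) (hβ1 : β ≤ 1)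
    (hV0 : 0 ≤ V)
    (hV : ∀ z, ∑ b ∈ Finset.range D, Gd D (β * b + z) ≤ V) :
    BB (CC M D (m + g)) (CC M D (m + g)) (fun i j : ℕ => ec (β * M / M ^ m * (i * j)))
      (√((4 * V) ^ m * D ^ (2 * g))) := by
  apply BB_schur (by positivity)
  intro j' _
  refine le_trans (le_of_eq ?_) (cantor_schur M D m g hD0 hD β V hβ0 hβ1 hV0 hV j')
  refine Finset.sum_congr rfl fun j _ => ?_
  congr 1
  refine Finset.sum_congr rfl fun i _ => ?_
  rw [← ec_neg, ← ec_add]; congr 1; ring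
end

section
lemma pushfwd {ι κ : Type*} (s : Finset ι) (S : Finset κ) (φ : ι → κ) (hinj : Set.InjOn φ s)
    (hmaps : ∀ i ∈ s, φ i ∈ S) (u : ι → ℂ) :
    ∃ u' : κ → ℂ, (∀ i ∈ s, u' (φ i) = u i) ∧ ∀ c, c ∉ s.image φ → u' c = 0 := by
  refine ⟨fun c => if h : ∃ i ∈ s, φ i = c then u h.choose else 0, ?_, ?_⟩
  · intro i hi
    have h : ∃ i' ∈ s, φ i' = φ i := ⟨i, hi, rfl⟩
    simp only [dif_pos h]
    congr 1
    exact hinj h.choose_spec.1 hi h.choose_spec.2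
  · intro c hc
    simp only
    rw [dif_neg]
    simpa using hc

lemma sum_pushfwd {ι κ E : Type*} [AddCommMonoid E] (s : Finset ι) (S : Finset κ) (φ : ι → κ)
    (hinj : Set.InjOn φ s) (hmaps : ∀ i ∈ s, φ i ∈ S) (F : κ → E) (G : ι → E)
    (h1 : ∀ i ∈ s, F (φ i) = G i) (h0 : ∀ c, c ∉ s.image φ → F c = 0) :
    ∑ c ∈ S, F c = ∑ i ∈ s, G i := by
  have : s.image φ ⊆ S := by
    intro c hc
    obtain ⟨i, hi, rfl⟩ := Finset.mem_image.1 hc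
    exact hmaps i hi
  rw [← Finset.sum_subset this (fun c _ hc => h0 c hc), Finset.sum_image hinj]
  exact Finset.sum_congr rfl h1

lemma BB_comap {ι ι' κ κ' : Type*} {s : Finset ι} {t : Finset κ} {S : Finset ι'} {T : Finset κ'}
    {K : ι' → κ' → ℂ} {C : ℝ} (h : BB S T K C) (φ : ι → ι') (ψ : κ → κ')
    (hφ : Set.InjOn φ s) (hψ : Set.InjOn ψ t) (mφ : ∀ i ∈ s, φ i ∈ S) (mψ : ∀ i ∈ t, ψ i ∈ T) :
    BB s t (fun i j => K (φ i) (ψ j)) C := by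
  intro u v
  obtain ⟨u', hu1, hu0⟩ := pushfwd s S φ hφ mφ u
  obtain ⟨v', hv1, hv0⟩ := pushfwd t T ψ hψ mψ v
  have := h u' v'
  have e1 : ∑ i ∈ S, ‖u' i‖ ^ 2 = ∑ i ∈ s, ‖u i‖ ^ 2 :=
    sum_pushfwd s S φ hφ mφ _ _ (fun i hi => by rw [hu1 i hi]) (fun c hc => by simp [hu0 c hc])
  have e2 : ∑ i ∈ T, ‖v' i‖ ^ 2 = ∑ i ∈ t, ‖v i‖ ^ 2 :=
    sum_pushfwd t T ψ hψ mψ _ _ (fun i hi => by rw [hv1 i hi]) (fun c hc => by simp [hv0 c hc])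
  have e3 : ∑ i ∈ S, ∑ j ∈ T, u' i * K i j * v' j = ∑ i ∈ s, ∑ j ∈ t, u i * K (φ i) (ψ j) * v j := by
    refine sum_pushfwd s S φ hφ mφ _ _ (fun i hi => ?_) (fun c hc => by simp [hu0 c hc])
    exact sum_pushfwd t T ψ hψ mψ _ _ (fun j hj => by rw [hv1 j hj, hu1 i hi])
      (fun c hc => by simp [hv0 c hc])
  rwa [e1, e2, e3] at this

lemma BB_congr {ι κ : Type*} {s : Finset ι} {t : Finset κ} {K K' : ι → κ → ℂ} {C : ℝ}
    (h : BB s t K C) (hK : ∀ i ∈ s, ∀ j ∈ t, K' i j = K i j) : BB s t K' C := by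
  intro u v
  have := h u v
  have e : ∑ i ∈ s, ∑ j ∈ t, u i * K' i j * v j = ∑ i ∈ s, ∑ j ∈ t, u i * K i j * v j :=
    Finset.sum_congr rfl fun i hi => Finset.sum_congr rfl fun j hj => by rw [hK i hi j hj]
  rwa [e]

lemma BB_fiber {ι κ τ : Type*} [DecidableEq τ] {s : Finset ι} {t : Finset κ} {K : ι → κ → ℂ} {C : ℝ} (hC : 0 ≤ C)
    (T : Finset τ) (f : ι → τ) (g : κ → τ) (hf : ∀ i ∈ s, f i ∈ T) (hg : ∀ i ∈ t, g i ∈ T)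
    (h : ∀ a ∈ T, ∀ b ∈ T, BB (s.filter (fun i => f i = a)) (t.filter (fun j => g j = b)) K C) :
    BB s t K ((T.card:ℝ) ^ 2 * C) := by
  intro u v
  have e : ∑ i ∈ s, ∑ j ∈ t, u i * K i j * v j = ∑ a ∈ T, ∑ b ∈ T,
      ∑ i ∈ s.filter (fun i => f i = a), ∑ j ∈ t.filter (fun j => g j = b), u i * K i j * v j := by
    rw [← Finset.sum_fiberwise_of_maps_to hf (fun i => ∑ j ∈ t, u i * K i j * v j)]
    refine Finset.sum_congr rfl fun a _ => ?_
    conv_rhs => rw [Finset.sum_comm]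
    refine Finset.sum_congr rfl fun i _ => ?_
    rw [← Finset.sum_fiberwise_of_maps_to hg (fun j => u i * K i j * v j)]
  rw [e]
  set W := √(∑ i ∈ s, ‖u i‖ ^ 2) * √(∑ j ∈ t, ‖v j‖ ^ 2) with hW
  have h1 : ∀ a ∈ T, ∀ b ∈ T, ‖∑ i ∈ s.filter (fun i => f i = a),
      ∑ j ∈ t.filter (fun j => g j = b), u i * K i j * v j‖ ≤ C * W := by
    intro a ha b hb
    refine (h a ha b hb u v).trans ?_
    rw [hW]
    gcongr
    · exact Finset.filter_subset _ _
    · exact Finset.filter_subset _ _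
  calc _ ≤ ∑ a ∈ T, ∑ b ∈ T, C * W := by
        refine (norm_sum_le _ _).trans (Finset.sum_le_sum fun a ha => ?_)
        exact (norm_sum_le _ _).trans (Finset.sum_le_sum fun b hb => h1 a ha b hb)
    _ = _ := by simp only [Finset.sum_const, nsmul_eq_mul]; ring

lemma thick_BB (N M D m g : ℕ) (hN : 0 < N) (hD0 : 0 < D) (hD : D * D ≤ M) (β V x : ℝ)
    (hβ0 : 0 ≤ β) (hβ1 : β ≤ 1) (hV0 : 0 ≤ V)
    (hV : ∀ z, ∑ b ∈ Finset.range D, Gd D (β * b + z) ≤ V)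
    (hx : x * M ^ (m + g) = N) (hx1 : 1 ≤ x) (hxβ : x * x / N = β * M / M ^ m)
    {ι : Type*} (Z : Finset ι) (w : ι → ℕ) (hw : Set.InjOn w Z) (hwN : ∀ j ∈ Z, w j < N)
    (hZ : ∀ j ∈ Z, ∃ c ∈ CC M D (m + g), |(w j:ℝ) - c * x| ≤ 2 * x) :
    BB Z Z (fun j l => ec ((w j:ℝ) * (w l) / N))
      ((7 * x) ^ 2 * (√((4 * V) ^ m * D ^ (2 * g)) * Real.exp (2 * Real.pi) * Real.exp (2 * Real.pi))) := by
  have hDM : D ≤ M := le_trans (Nat.le_mul_of_pos_left _ hD0) hD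
  have hNr : (0:ℝ) < N := by exact_mod_cast hN
  have hM : 0 < M := by omega
  have hMr : (0:ℝ) < M := by exact_mod_cast hM
  choose! cf hcf hcx using hZ
  let tf : ι → ℤ := fun j => (w j:ℤ) - ⌊x * cf j⌋
  let T : Finset ℤ := Finset.Icc (-⌊3 * x⌋) ⌊3 * x⌋
  have hfl : (0:ℤ) ≤ ⌊3 * x⌋ := Int.floor_nonneg.2 (by linarith)
  have htf : ∀ j ∈ Z, tf j ∈ T := by
    intro j hj
    have h1 := hcx j hj
    rw [abs_le] at h1
    have h2 := Int.floor_le (x * cf j)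
    have h3 := Int.lt_floor_add_one (x * cf j)
    simp only [T, tf, Finset.mem_Icc]
    constructor
    · rw [neg_le, Int.le_floor]; push_cast; nlinarith
    · rw [Int.le_floor]; push_cast; nlinarith
  have hcard : (T.card : ℝ) ≤ 7 * x := by
    simp only [T, Int.card_Icc]
    have h2 := Int.floor_le (3 * x)
    have : (((⌊3 * x⌋ + 1 - -⌊3 * x⌋).toNat : ℤ) : ℝ) = ((⌊3 * x⌋ + 1 - -⌊3 * x⌋ : ℤ):ℝ) := by
      rw [Int.toNat_of_nonneg (by omega)]
    rw [Int.cast_natCast] at this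
    rw [this]; push_cast; linarith
  set B0 := √((4 * V) ^ m * D ^ (2 * g)) with hB0
  have hB00 : 0 ≤ B0 := Real.sqrt_nonneg _
  have key := BB_fiber (K := (fun j l => ec ((w j:ℝ) * (w l) / N)))
    (s := Z) (t := Z) (C := B0 * Real.exp (2 * Real.pi) * Real.exp (2 * Real.pi))
    (by positivity) T tf tf htf htf ?_
  · intro u v
    refine (key u v).trans ?_
    gcongr
  intro a _ b _
  have hinj : ∀ a : ℤ, Set.InjOn cf (Z.filter (fun i => tf i = a) : Finset ι) := by
    intro a i hi j hj hij
    simp only [Finset.coe_filter, Set.mem_ofPred_eq, tf] at hi hj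
    apply hw hi.1 hj.1
    have h1 := hi.2
    have h2 := hj.2
    rw [hij] at h1
    omega
  have hmem : ∀ a : ℤ, ∀ i ∈ Z.filter (fun i => tf i = a), cf i ∈ CC M D (m + g) :=
    fun a i hi => hcf i (Finset.mem_filter.1 hi).1
  have s0 := cantor_BB M D m g hD0 hD β V hβ0 hβ1 hV0 hV
  have s1 := BB_comap s0 cf cf (hinj a) (hinj b) (hmem a) (hmem b)
  have s2 := BB_mul (by positivity) s1 (fun j => ec (x * cf j * b / N)) (fun l => ec (a * w l / N))
    (fun _ _ => (ec_norm _).le) (fun _ _ => (ec_norm _).le)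
  have hcN : ∀ i ∈ Z, x * cf i / N ≤ 1 := by
    intro i hi
    have := CC_lt hDM (hcf i hi)
    have h : (cf i : ℝ) ≤ M ^ (m + g) := by exact_mod_cast this.le
    rw [div_le_one hNr, ← hx]; gcongr
  have s3 := BB_exp (by positivity) s2 (fun j => ((x * cf j / N : ℝ) : ℂ))
    (fun l => ((Int.fract (x * cf l) : ℝ) : ℂ)) ?_ ?_ (2 * Real.pi * Complex.I)
  rotate_left
  · intro i hi
    rw [Complex.norm_real, Real.norm_of_nonneg (by positivity)]
    exact hcN i (Finset.mem_filter.1 hi).1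
  · intro i hi
    rw [Complex.norm_real, Real.norm_of_nonneg (Int.fract_nonneg _)]
    exact (Int.fract_lt_one _).le
  have s4 := BB_exp (by positivity) s3 (fun j => ((Int.fract (x * cf j) : ℝ) : ℂ))
    (fun l => ((w l / N : ℝ) : ℂ)) ?_ ?_ (2 * Real.pi * Complex.I)
  rotate_left
  · intro i hi
    rw [Complex.norm_real, Real.norm_of_nonneg (Int.fract_nonneg _)]
    exact (Int.fract_lt_one _).le
  · intro i hi
    rw [Complex.norm_real, Real.norm_of_nonneg (by positivity), div_le_one hNr]
    exact_mod_cast (hwN i (Finset.mem_filter.1 hi).1).le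
  have hnorm : ‖(2 * Real.pi * Complex.I : ℂ)‖ = 2 * Real.pi := by
    simp [abs_of_pos Real.pi_pos]
  rw [hnorm] at s4
  refine BB_congr s4 ?_
  intro j hj l hl
  have hj' := (Finset.mem_filter.1 hj).2
  have hl' := (Finset.mem_filter.1 hl).2
  simp only [tf] at hj' hl'
  have ej : (w j : ℝ) = x * cf j + a - Int.fract (x * cf j) := by
    have : ((w j:ℤ):ℝ) = ((a + ⌊x * cf j⌋ : ℤ):ℝ) := by rw [← hj']; congr 1; ring
    push_cast at this
    rw [this, Int.fract]; ring
  have el : (w l : ℝ) = x * cf l + b - Int.fract (x * cf l) := by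
    have : ((w l:ℤ):ℝ) = ((b + ⌊x * cf l⌋ : ℤ):ℝ) := by rw [← hl']; congr 1; ring
    push_cast at this
    rw [this, Int.fract]; ring
  have ex : ∀ p q : ℝ, Complex.exp (2 * Real.pi * Complex.I * ((p:ℂ) * (q:ℂ))) = ec (-(p * q)) := by
    intro p q; unfold ec; congr 1; push_cast; ring
  rw [ex, ex, ← ec_add, ← ec_add, ← ec_add, ← ec_add, ← hxβ]
  congr 1
  have : (w j : ℝ) * w l = x * cf j * (x * cf l) + x * cf j * b - x * cf j * Int.fract (x * cf l)
      + a * w l - Int.fract (x * cf j) * w l := by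
    nth_rewrite 1 [ej]
    have : x * (cf j:ℝ) * w l = x * cf j * (x * cf l + b - Int.fract (x * cf l)) := by rw [← el]
    linarith
  rw [this]; field_simp; ring
end

section
/-- forward difference -/
def fd (h : ℝ) (f : ℝ → ℝ) : ℝ → ℝ := fun x => f (x + h) - f x

lemma fd_contDiff (h : ℝ) (f : ℝ → ℝ) (hf : ContDiff ℝ (⊤ : ℕ∞) f) : ContDiff ℝ (⊤ : ℕ∞) (fd h f) := by
  unfold fd
  exact (hf.comp (contDiff_id.add contDiff_const)).sub hf

lemma fd_iter_bound (h : ℝ) (hh : 0 ≤ h) (L : ℕ) (f : ℝ → ℝ) (hf : ContDiff ℝ (⊤ : ℕ∞) f) (C : ℝ)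
    (hC : ∀ x, |iteratedDeriv L f x| ≤ C) (x : ℝ) : |(fd h)^[L] f x| ≤ C * h ^ L := by
  induction L generalizing f C with
  | zero => simpa using hC x
  | succ L ih =>
    rw [Function.iterate_succ_apply]
    have := ih (fd h f) (fd_contDiff h f hf) (C * h) ?_
    · rw [pow_succ']; linarith
    intro x
    have e : iteratedDeriv L (fd h f) x = iteratedDeriv L f (x + h) - iteratedDeriv L f x := by
      unfold fd
      have hle : ((L : ℕ∞) : WithTop ℕ∞) ≤ ((⊤ : ℕ∞) : WithTop ℕ∞) := by exact_mod_cast le_top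
      have h1 : ContDiffAt ℝ L (fun z => f (z + h)) x :=
        ((hf.comp (contDiff_id.add contDiff_const)).of_le hle).contDiffAt
      have h2 : ContDiffAt ℝ L f x := (hf.of_le hle).contDiffAt
      rw [iteratedDeriv_fun_sub h1 h2, iteratedDeriv_comp_add_const]
    rw [e]
    have hd : Differentiable ℝ (iteratedDeriv L f) :=
      hf.differentiable_iteratedDeriv L (by exact_mod_cast ENat.coe_lt_top L)
    have := Convex.norm_image_sub_le_of_norm_deriv_le (f := iteratedDeriv L f) (s := Set.univ) (C := C)
      (x := x) (y := x + h)
      (fun y _ => hd y) (fun y _ => by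
        rw [← iteratedDeriv_succ]; exact hC y) convex_univ trivial trivial
    simpa [abs_of_nonneg hh] using this

/-- support in `[-a,a]` -/
def Sup (a : ℝ) (f : ℝ → ℝ) : Prop := ∀ x, a < |x| → f x = 0

lemma Sup_fd (a h : ℝ) (hh : 0 ≤ h) (f : ℝ → ℝ) (hf : Sup a f) : Sup (a + h) (fd h f) := by
  intro x hx
  unfold fd
  rw [hf x (by linarith), hf (x + h) (by
    have := abs_sub_abs_le_abs_sub x (-h)
    rw [abs_neg, abs_of_nonneg hh, sub_neg_eq_add] at this
    linarith), sub_zero]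

lemma Sup_fd_iter (a h : ℝ) (hh : 0 ≤ h) (L : ℕ) (f : ℝ → ℝ) (hf : Sup a f) :
    Sup (a + L * h) ((fd h)^[L] f) := by
  induction L generalizing f a with
  | zero => simpa using hf
  | succ L ih =>
    have := ih (a + h) (fd h f) (Sup_fd a h hh f hf)
    rw [Function.iterate_succ_apply]
    convert this using 1; push_cast; ring

def SS (h : ℝ) (f : ℝ → ℝ) (y : ℝ) : ℂ := ∑' m : ℤ, (f (m * h) : ℂ) * ec (y * m)

lemma SS_term_zero (a h : ℝ) (hh : 0 < h) (f : ℝ → ℝ) (hf : Sup a f) (y : ℝ) (m : ℤ)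
    (hm : m ∉ Finset.Icc (-⌊a / h⌋) ⌊a / h⌋) : (f (m * h) : ℂ) * ec (y * m) = 0 := by
  rw [hf, Complex.ofReal_zero, zero_mul]
  by_contra hc
  push Not at hc
  apply hm
  rw [abs_mul, abs_of_pos hh, ← le_div_iff₀ hh, abs_le] at hc
  rw [Finset.mem_Icc, neg_le, Int.le_floor, Int.le_floor]
  push_cast
  exact ⟨by linarith, hc.2⟩

lemma SS_summable (a h : ℝ) (hh : 0 < h) (f : ℝ → ℝ) (hf : Sup a f) (y : ℝ) :
    Summable fun m : ℤ => (f (m * h) : ℂ) * ec (y * m) :=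
  summable_of_ne_finset_zero (fun m hm => SS_term_zero a h hh f hf y m hm)

lemma SS_fd (a h : ℝ) (hh : 0 < h) (f : ℝ → ℝ) (hf : Sup a f) (y : ℝ) :
    SS h (fd h f) y = (ec (-y) - 1) * SS h f y := by
  have hs := SS_summable a h hh f hf y
  unfold SS
  have e : ∀ m : ℤ, ((fd h f (m * h) : ℝ) : ℂ) * ec (y * m) =
      ec (-y) * ((f ((m + 1 : ℤ) * h) : ℂ) * ec (y * (m + 1 : ℤ))) - (f (m * h) : ℂ) * ec (y * m) := by
    intro m
    have h1 : ec (y * (m + 1 : ℤ)) = ec (y * m) * ec y := by rw [← ec_add]; congr 1; push_cast; ring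
    have h2 : ec (-y) * ec y = 1 := by rw [← ec_add, neg_add_cancel, ec_zero]
    have h3 : ((m + 1 : ℤ) : ℝ) * h = m * h + h := by push_cast; ring
    rw [h1, h3]; unfold fd; push_cast
    linear_combination (-(f (m * h + h) : ℂ) * ec (y * m)) * h2
  simp_rw [e]
  have hs2 : Summable fun m : ℤ => (f ((m + 1 : ℤ) * h) : ℂ) * ec (y * (m + 1 : ℤ)) :=
    (Equiv.addRight (1 : ℤ)).summable_iff.2 hs
  rw [Summable.tsum_sub (hs2.mul_left _) hs, tsum_mul_left]
  have : ∑' m : ℤ, (f ((m + 1 : ℤ) * h) : ℂ) * ec (y * (m + 1 : ℤ))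
      = ∑' m : ℤ, (f (m * h) : ℂ) * ec (y * m) :=
    (Equiv.addRight (1 : ℤ)).tsum_eq (fun m : ℤ => (f (m * h) : ℂ) * ec (y * m))
  rw [this]; ring

lemma SS_fd_iter (a h : ℝ) (hh : 0 < h) (L : ℕ) (f : ℝ → ℝ) (hf : Sup a f) (y : ℝ) :
    SS h ((fd h)^[L] f) y = (ec (-y) - 1) ^ L * SS h f y := by
  induction L generalizing f a with
  | zero => simp
  | succ L ih =>
    rw [Function.iterate_succ_apply, ih (a + h) _ (Sup_fd a h hh.le f hf), SS_fd a h hh f hf]; ring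

lemma SS_bound (a h : ℝ) (ha : 0 ≤ a) (hh : 0 < h) (f : ℝ → ℝ) (hf : Sup a f) (y C : ℝ)
    (hC : ∀ x, |f x| ≤ C) : ‖SS h f y‖ ≤ (2 * (a / h) + 1) * C := by
  unfold SS
  have hC0 : 0 ≤ C := (abs_nonneg _).trans (hC 0)
  rw [tsum_eq_sum (s := Finset.Icc (-⌊a / h⌋) ⌊a / h⌋) (fun m hm => SS_term_zero a h hh f hf y m hm)]
  refine (norm_sum_le _ _).trans ?_
  refine (Finset.sum_le_sum (g := fun _ => C) ?_).trans ?_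
  · intro m _
    rw [norm_mul, ec_norm, mul_one, Complex.norm_real]; exact hC _
  rw [Finset.sum_const, nsmul_eq_mul]
  gcongr
  rw [Int.card_Icc]
  have hfl : (0:ℤ) ≤ ⌊a / h⌋ := Int.floor_nonneg.2 (by positivity)
  have h2 := Int.floor_le (a / h)
  have : (((⌊a / h⌋ + 1 - -⌊a / h⌋).toNat : ℤ) : ℝ) = ((⌊a / h⌋ + 1 - -⌊a / h⌋ : ℤ):ℝ) := by
    rw [Int.toNat_of_nonneg (by omega)]
  rw [Int.cast_natCast] at this
  rw [this]; push_cast; linarith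

lemma decay (χ : ℝ → ℝ) (hχ : ContDiff ℝ (⊤ : ℕ∞) χ)
    (hχc : HasCompactSupport χ) (hχsupp : tsupport χ ⊆ Set.Ioo 0 1) (L : ℕ) :
    ∃ C : ℝ, 0 ≤ C ∧ ∀ (n : ℕ) (y : ℝ), 0 < n →
      ‖∑ m ∈ Finset.range n, (χ ((m:ℝ) / n) : ℂ) * ec (y * m)‖ * (4 * nd y) ^ L
        ≤ C * n * (1 / n) ^ L := by
  have hcs : HasCompactSupport (iteratedDeriv L χ) := by
    have := hχc.iteratedFDeriv (𝕜 := ℝ) L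
    refine this.mono ?_
    intro x hx
    simp only [Function.mem_support] at hx ⊢
    intro h
    apply hx
    have e := norm_iteratedFDeriv_eq_norm_iteratedDeriv (𝕜 := ℝ) (f := χ) (x := x) (n := L)
    rw [h, norm_zero] at e
    exact norm_eq_zero.1 e.symm
  obtain ⟨C, hC⟩ := (hχ.continuous_iteratedDeriv L (by exact_mod_cast le_top)).bounded_above_of_compact_support hcs
  have hC0 : 0 ≤ C := (norm_nonneg _).trans (hC 0)
  have hz : ∀ x, x ∉ Set.Ioo (0:ℝ) 1 → χ x = 0 := by
    intro x hx
    by_contra h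
    exact hx (hχsupp (subset_tsupport _ h))
  refine ⟨(2 * (1 + L) + 1) * C, by positivity, ?_⟩
  intro n y hn
  have hnr : (1:ℝ) ≤ n := by exact_mod_cast hn
  have hn0 : (0:ℝ) < n := by linarith
  set h : ℝ := 1 / n with hh
  have hpos : 0 < h := by positivity
  have hsup : Sup 1 χ := by
    intro x hx
    apply hz
    rintro ⟨h1, h2⟩
    rw [abs_of_pos h1] at hx; linarith
  have e : ∑ m ∈ Finset.range n, (χ ((m:ℝ) / n) : ℂ) * ec (y * m) = SS h χ y := by
    unfold SS
    symm
    have : ∑' m : ℤ, (χ (m * h) : ℂ) * ec (y * m)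
        = ∑ m ∈ (Finset.range n).map Nat.castEmbedding, (χ ((m:ℤ) * h) : ℂ) * ec (y * (m:ℤ)) := by
      apply tsum_eq_sum
      intro m hm
      rw [hz, Complex.ofReal_zero, zero_mul]
      rintro ⟨h1, h2⟩
      apply hm
      have h3 : (0:ℝ) < m := by
        by_contra hc
        push Not at hc
        nlinarith
      have h4 : (m:ℝ) < n := by
        rw [hh, mul_one_div, div_lt_one hn0] at h2; exact h2
      have h5 : 0 < m := by exact_mod_cast h3
      have h6 : m < n := by exact_mod_cast h4
      simp only [Finset.mem_map, Finset.mem_range, Nat.castEmbedding_apply]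
      exact ⟨m.toNat, by omega, by omega⟩
    rw [this, Finset.sum_map]
    refine Finset.sum_congr rfl fun m _ => ?_
    simp only [Nat.castEmbedding_apply, Int.cast_natCast]
    rw [hh, mul_one_div]
  rw [e]
  have h1 := SS_fd_iter 1 h hpos L χ hsup y
  have h2 := SS_bound (1 + L * h) h (by positivity) hpos _ (Sup_fd_iter 1 h hpos.le L χ hsup) y (C * h ^ L)
    (fun x => fd_iter_bound h hpos.le L χ hχ C hC x)
  rw [h1, norm_mul, norm_pow] at h2
  have h3 : 4 * nd y ≤ ‖ec (-y) - 1‖ := by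
    have := norm_ec_sub_one (-y); rwa [nd_neg] at this
  have hnd := nd_nonneg y
  calc ‖SS h χ y‖ * (4 * nd y) ^ L ≤ ‖SS h χ y‖ * ‖ec (-y) - 1‖ ^ L := by gcongr
    _ = ‖ec (-y) - 1‖ ^ L * ‖SS h χ y‖ := mul_comm _ _
    _ ≤ _ := h2
    _ ≤ (2 * (1 + L) + 1) * C * n * h ^ L := by
      have : (1 + L * h) / h = n + L := by rw [hh]; field_simp
      rw [this]
      have h5 : (2 * ((n:ℝ) + L) + 1) ≤ (2 * (1 + L) + 1) * n := by
        nlinarith [show (0:ℝ) ≤ L by positivity]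
      calc (2 * ((n:ℝ) + L) + 1) * (C * h ^ L) ≤ ((2 * (1 + L) + 1) * n) * (C * h ^ L) := by gcongr
        _ = _ := by ring

lemma supp_margin (χ : ℝ → ℝ) (hχc : HasCompactSupport χ) (hχsupp : tsupport χ ⊆ Set.Ioo 0 1) :
    ∃ c : ℝ, 0 < c ∧ c ≤ 1 ∧ ∀ x, χ x ≠ 0 → c ≤ x ∧ x ≤ 1 - c := by
  obtain ⟨d, hd, hs⟩ := IsCompact.exists_cthickening_subset_open hχc isOpen_Ioo hχsupp
  refine ⟨min d 1, by positivity, min_le_right _ _, ?_⟩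
  intro x hx
  have hx' : x ∈ tsupport χ := subset_tsupport _ hx
  have h1 : x - d ∈ Set.Ioo (0:ℝ) 1 := hs (Metric.mem_cthickening_of_dist_le _ x _ _ hx' (by simp [Real.dist_eq, abs_of_pos hd]))
  have h2 : x + d ∈ Set.Ioo (0:ℝ) 1 := hs (Metric.mem_cthickening_of_dist_le _ x _ _ hx' (by simp [Real.dist_eq, abs_of_pos hd]))
  have := min_le_left d 1
  exact ⟨by linarith [h1.1], by linarith [h2.2]⟩
end

section
open scoped Matrix.Norms.L2Operator

lemma opn_le {N : ℕ} (A : Matrix (Fin N) (Fin N) ℂ) (C : ℝ) (hC : 0 ≤ C)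
    (h : ∀ x : EuclideanSpace ℂ (Fin N), ‖(WithLp.toLp 2 (A.mulVec x) : EuclideanSpace ℂ (Fin N))‖ ≤ C * ‖x‖) :
    ‖A‖ ≤ C := by
  rw [Matrix.cstar_norm_def]
  refine ContinuousLinearMap.opNorm_le_bound _ hC fun x => ?_
  exact h x

lemma norm_of_BB {N : ℕ} (A : Matrix (Fin N) (Fin N) ℂ) (C : ℝ) (hC : 0 ≤ C)
    (h : BB Finset.univ Finset.univ (fun i j => A i j) C) : ‖A‖ ≤ C := by
  apply opn_le A C hC
  intro x
  set w : EuclideanSpace ℂ (Fin N) := WithLp.toLp 2 (A.mulVec x) with hw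
  have h1 := h (fun i => (starRingEnd ℂ) (w i)) (fun j => x j)
  have e : ∑ i, ∑ j, (starRingEnd ℂ) (w i) * A i j * x j = ((‖w‖ ^ 2 : ℝ) : ℂ) := by
    rw [EuclideanSpace.norm_sq_eq]
    push_cast
    refine Finset.sum_congr rfl fun i _ => ?_
    rw [← Complex.conj_mul']
    have : w i = ∑ j, A i j * x j := rfl
    nth_rewrite 3 [this]
    rw [Finset.mul_sum]
    exact Finset.sum_congr rfl fun j _ => by ring
  rw [e, Complex.norm_real, Real.norm_of_nonneg (by positivity)] at h1
  simp only [Complex.norm_conj] at h1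
  rw [← EuclideanSpace.norm_eq, ← EuclideanSpace.norm_eq] at h1
  by_cases hz : ‖w‖ = 0
  · rw [hz]; positivity
  · have : 0 < ‖w‖ := lt_of_le_of_ne (norm_nonneg _) (Ne.symm hz)
    by_contra hcon
    push Not at hcon
    nlinarith

lemma norm_of_entries {N : ℕ} (A : Matrix (Fin N) (Fin N) ℂ) (e : ℝ) (he : 0 ≤ e)
    (h : ∀ i j, ‖A i j‖ ≤ e) : ‖A‖ ≤ N * e := by
  apply norm_of_BB A _ (by positivity)
  intro u v
  have cs : ∀ u : Fin N → ℂ, ∑ i, ‖u i‖ ≤ √N * √(∑ i, ‖u i‖ ^ 2) := by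
    intro u
    have := Real.sum_mul_le_sqrt_mul_sqrt Finset.univ (fun _ : Fin N => (1:ℝ)) (fun i => ‖u i‖)
    simpa using this
  calc ‖∑ i, ∑ j, u i * A i j * v j‖ ≤ ∑ i, ∑ j, ‖u i‖ * e * ‖v j‖ := by
        refine (norm_sum_le _ _).trans (Finset.sum_le_sum fun i _ => ?_)
        refine (norm_sum_le _ _).trans (Finset.sum_le_sum fun j _ => ?_)
        rw [norm_mul, norm_mul]; gcongr; exact h i j
    _ = e * ((∑ i, ‖u i‖) * ∑ j, ‖v j‖) := by
        rw [Finset.sum_mul_sum, Finset.mul_sum]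
        refine Finset.sum_congr rfl fun i _ => ?_
        rw [Finset.mul_sum]
        exact Finset.sum_congr rfl fun j _ => by ring
    _ ≤ e * ((√N * √(∑ i, ‖u i‖ ^ 2)) * (√N * √(∑ i, ‖v i‖ ^ 2))) := by
        gcongr
        · exact cs u
        · exact cs v
    _ = (√N * √N) * e * (√(∑ i, ‖u i‖ ^ 2) * √(∑ i, ‖v i‖ ^ 2)) := by ring
    _ = _ := by rw [Real.mul_self_sqrt (by positivity)]

lemma norm_transpose_le {N : ℕ} (A : Matrix (Fin N) (Fin N) ℂ) : ‖A.transpose‖ ≤ ‖A‖ := by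
  rw [← Matrix.l2_opNorm_conjTranspose A]
  apply opn_le _ _ (norm_nonneg _)
  intro x
  have h := Matrix.l2_opNorm_mulVec A.conjTranspose (WithLp.toLp 2 (fun i => (starRingEnd ℂ) (x i)))
  have e1 : ‖(WithLp.toLp 2 (fun i => (starRingEnd ℂ) (x i)) : EuclideanSpace ℂ (Fin N))‖ = ‖x‖ := by
    rw [EuclideanSpace.norm_eq, EuclideanSpace.norm_eq]; simp
  have e2 : ‖(WithLp.toLp 2 (A.transpose.mulVec x) : EuclideanSpace ℂ (Fin N))‖ =
     ‖(WithLp.toLp 2 (A.conjTranspose.mulVec (fun i => (starRingEnd ℂ) (x i))) : EuclideanSpace ℂ (Fin N))‖ := by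
    rw [EuclideanSpace.norm_eq, EuclideanSpace.norm_eq]
    congr 1
    refine Finset.sum_congr rfl fun i _ => ?_
    congr 1
    rw [← Complex.norm_conj]
    congr 1
    simp [Matrix.mulVec, dotProduct]
  rw [e2]
  rw [e1] at h
  exact h

lemma norm_one_le (N : ℕ) : ‖(1 : Matrix (Fin N) (Fin N) ℂ)‖ ≤ 1 := by
  rw [← Matrix.diagonal_one, Matrix.l2_opNorm_diagonal]
  exact (pi_norm_le_iff_of_nonneg zero_le_one).2 fun i => by simp

lemma norm_diag_le {N : ℕ} (d : Fin N → ℂ) (h : ∀ i, ‖d i‖ ≤ 1) : ‖Matrix.diagonal d‖ ≤ 1 := by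
  rw [Matrix.l2_opNorm_diagonal]
  exact (pi_norm_le_iff_of_nonneg zero_le_one).2 h

lemma norm_le_of_unit {N : ℕ} (A : Matrix (Fin N) (Fin N) ℂ) (h : A.conjTranspose * A = 1) : ‖A‖ ≤ 1 := by
  have h1 := Matrix.l2_opNorm_conjTranspose_mul_self A
  rw [h] at h1
  have := norm_one_le N
  by_contra hc
  push Not at hc
  nlinarith

lemma ec_sum_fin (N : ℕ) (l l' : ℕ) (hl : l < N) (hl' : l' < N) :
    ∑ m ∈ Finset.range N, (starRingEnd ℂ) (((Real.sqrt N)⁻¹ : ℝ) * ec ((m:ℝ) * l / N)) *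
      (((Real.sqrt N)⁻¹ : ℝ) * ec ((m:ℝ) * l' / N)) = if l = l' then 1 else 0 := by
  have hN : (0:ℝ) < N := by exact_mod_cast (by omega : 0 < N)
  have e : ∀ m ∈ Finset.range N, (starRingEnd ℂ) (((Real.sqrt N)⁻¹ : ℝ) * ec ((m:ℝ) * l / N)) *
      (((Real.sqrt N)⁻¹ : ℝ) * ec ((m:ℝ) * l' / N)) =
      ((N:ℝ)⁻¹ : ℝ) * ec ((((l':ℤ) - l : ℤ) : ℝ) / N * m) := by
    intro m _
    rw [map_mul, Complex.conj_ofReal, ← ec_neg]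
    have h1 : ec ((((l':ℤ) - l : ℤ) : ℝ) / N * m) = ec (-((m:ℝ) * l / N)) * ec ((m:ℝ) * l' / N) := by
      rw [← ec_add]; congr 1; push_cast; ring
    have h2 : (((N:ℝ)⁻¹ : ℝ) : ℂ) = ((Real.sqrt N)⁻¹ : ℝ) * ((Real.sqrt N)⁻¹ : ℝ) := by
      rw [← Complex.ofReal_mul, ← mul_inv, Real.mul_self_sqrt hN.le]
    rw [h1, h2]; ring
  rw [Finset.sum_congr rfl e, ← Finset.mul_sum]
  split_ifs with h
  · subst h
    simp [ec_zero]
    exact inv_mul_cancel₀ (by exact_mod_cast hN.ne')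
  · rw [ec_orth N _ (by omega) (by rw [abs_lt]; omega), mul_zero]

lemma dft_unit (N : ℕ) : (dftMatrix N).conjTranspose * dftMatrix N = 1 := by
  ext l l'
  rw [Matrix.mul_apply, Matrix.one_apply]
  simp only [Matrix.conjTranspose_apply, dftMatrix, Matrix.of_apply]
  have := ec_sum_fin N l l' l.2 l'.2
  rw [Finset.sum_range] at this
  simp only [Fin.ext_iff]
  exact this

lemma dft_unit' (N : ℕ) : dftMatrix N * (dftMatrix N).conjTranspose = 1 :=
  mul_eq_one_comm.1 (dft_unit N)

lemma dft_norm (N : ℕ) : ‖dftMatrix N‖ ≤ 1 := norm_le_of_unit _ (dft_unit N)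

lemma dft_symm (N : ℕ) : (dftMatrix N).transpose = dftMatrix N := by
  ext i j; simp only [Matrix.transpose_apply, dftMatrix, Matrix.of_apply]; rw [mul_comm ((j:ℕ):ℝ)]

lemma sum_block {E : Type*} [AddCommMonoid E] (M n a : ℕ) (hn : 0 < n) (ha : a < M) (f : ℕ → E) :
    ∑ i : Fin (M * n), (if (i:ℕ) / n = a then f i else 0) = ∑ m ∈ Finset.range n, f (a * n + m) := by
  rw [Fin.sum_univ_eq_sum_range (fun i => if i / n = a then f i else 0), ← Finset.sum_filter]
  symm
  refine Finset.sum_bij (fun m _ => a * n + m) ?_ ?_ ?_ ?_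
  · intro m hm
    rw [Finset.mem_range] at hm
    rw [Finset.mem_filter, Finset.mem_range]
    constructor
    · have : (a + 1) * n ≤ M * n := Nat.mul_le_mul_right _ ha
      rw [Nat.succ_mul] at this; omega
    · rw [mul_comm, Nat.mul_add_div hn, Nat.div_eq_of_lt hm, add_zero]
  · intro m _ m' _ h; omega
  · intro i hi
    rw [Finset.mem_filter, Finset.mem_range] at hi
    refine ⟨i % n, Finset.mem_range.2 (Nat.mod_lt _ hn), ?_⟩
    rw [← hi.2, mul_comm]; exact Nat.div_add_mod i n
  · intro _ _; rfl

/-- block DFT -/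
def bF (N n : ℕ) : Matrix (Fin N) (Fin N) ℂ :=
  Matrix.of fun j l : Fin N => if (j : ℕ) / n = (l : ℕ) / n then
    ((((Real.sqrt n)⁻¹ : ℝ) : ℂ) * ec ((((j:ℕ) % n : ℕ):ℝ) * (((l:ℕ) % n : ℕ):ℝ) / n)) else 0

lemma bF_unit (M n : ℕ) (hn : 0 < n) : (bF (M * n) n).conjTranspose * bF (M * n) n = 1 := by
  ext l l'
  rw [Matrix.mul_apply, Matrix.one_apply]
  simp only [Matrix.conjTranspose_apply, bF, Matrix.of_apply]
  by_cases h : (l:ℕ) / n = (l':ℕ) / n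
  · have ha : (l:ℕ) / n < M := by rw [Nat.div_lt_iff_lt_mul hn]; exact l.2
    have e : ∀ i : Fin (M * n), star (if (i : ℕ) / n = (l : ℕ) / n then
        ((((Real.sqrt n)⁻¹ : ℝ) : ℂ) * ec ((((i:ℕ) % n : ℕ):ℝ) * (((l:ℕ) % n : ℕ):ℝ) / n)) else 0) *
        (if (i : ℕ) / n = (l' : ℕ) / n then
        ((((Real.sqrt n)⁻¹ : ℝ) : ℂ) * ec ((((i:ℕ) % n : ℕ):ℝ) * (((l':ℕ) % n : ℕ):ℝ) / n)) else 0) =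
        if (i:ℕ) / n = (l:ℕ) / n then
          (starRingEnd ℂ) ((((Real.sqrt n)⁻¹ : ℝ) : ℂ) * ec ((((i:ℕ) % n : ℕ):ℝ) * (((l:ℕ) % n : ℕ):ℝ) / n)) *
          ((((Real.sqrt n)⁻¹ : ℝ) : ℂ) * ec ((((i:ℕ) % n : ℕ):ℝ) * (((l':ℕ) % n : ℕ):ℝ) / n)) else 0 := by
      intro i
      rw [← h]
      split_ifs
      · rfl
      · simp
    rw [Finset.sum_congr rfl fun i _ => e i]
    rw [sum_block M n ((l:ℕ)/n) hn ha (fun i => (starRingEnd ℂ) ((((Real.sqrt n)⁻¹ : ℝ) : ℂ) *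
        ec (((i % n : ℕ):ℝ) * (((l:ℕ) % n : ℕ):ℝ) / n)) *
          ((((Real.sqrt n)⁻¹ : ℝ) : ℂ) * ec (((i % n : ℕ):ℝ) * (((l':ℕ) % n : ℕ):ℝ) / n)))]
    have := ec_sum_fin n ((l:ℕ) % n) ((l':ℕ) % n) (Nat.mod_lt _ hn) (Nat.mod_lt _ hn)
    have e2 : (l = l') = ((l:ℕ) % n = (l':ℕ) % n) := by
      rw [Fin.ext_iff]
      apply propext
      constructor
      · intro h; rw [h]
      · intro h'
        rw [← Nat.div_add_mod (l:ℕ) n, ← Nat.div_add_mod (l':ℕ) n, h, h']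
    simp only [e2]
    rw [← this]
    refine Finset.sum_congr rfl fun m hm => ?_
    have : ((l:ℕ) / n * n + m) % n = m := by
      rw [mul_comm, Nat.mul_add_mod, Nat.mod_eq_of_lt (Finset.mem_range.1 hm)]
    rw [this]
  · have : l ≠ l' := by rintro rfl; exact h rfl
    rw [if_neg this]
    refine Finset.sum_eq_zero fun i _ => ?_
    by_cases h1 : (i:ℕ) / n = (l:ℕ) / n
    · rw [if_neg (by rw [h1]; exact h : ¬ (i:ℕ) / n = (l':ℕ) / n), mul_zero]
    · rw [if_neg h1]; simp

lemma blocks_norm (N M : ℕ) (hN : 0 < N) (hMN : M ∣ N) (χ : ℝ → ℝ) (hχ01 : ∀ x : ℝ, χ x ∈ Set.Icc (0 : ℝ) 1) :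
    ‖bakerBlocks N M χ‖ ≤ 1 := by
  set n := N / M with hn
  have hNn : N = M * n := (Nat.mul_div_cancel' hMN).symm
  have hn0 : 0 < n := by
    rcases Nat.eq_zero_or_pos n with h | h
    · rw [h] at hNn; omega
    · exact h
  let d : Fin N → ℂ := fun j => ((χ ((((j : ℕ) % n : ℕ) : ℝ) / (n : ℝ)) : ℝ) : ℂ)
  have e : bakerBlocks N M χ = Matrix.diagonal d * bF N n * Matrix.diagonal d := by
    ext i j
    rw [Matrix.mul_diagonal, Matrix.diagonal_mul]
    simp only [bakerBlocks, Matrix.of_apply, bF, d, ← hn]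
    split_ifs
    · push_cast; rfl
    · simp
  have hd : ‖Matrix.diagonal d‖ ≤ 1 := by
    apply norm_diag_le
    intro i
    simp only [d]
    rw [Complex.norm_real, Real.norm_of_nonneg (hχ01 _).1]
    exact (hχ01 _).2
  have hb : ‖bF N n‖ ≤ 1 := by
    apply norm_le_of_unit
    have := bF_unit M n hn0
    rw [← hNn] at this
    exact this
  rw [e]
  calc _ ≤ ‖Matrix.diagonal d * bF N n‖ * ‖Matrix.diagonal d‖ := norm_mul_le _ _
    _ ≤ (‖Matrix.diagonal d‖ * ‖bF N n‖) * ‖Matrix.diagonal d‖ := by gcongr; exact norm_mul_le _ _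
    _ ≤ (1 * 1) * 1 := by gcongr
    _ = 1 := by norm_num

lemma baker_norm (N M : ℕ) (hN : 0 < N) (hMN : M ∣ N) (A : Finset ℕ) (χ : ℝ → ℝ)
    (hχ01 : ∀ x : ℝ, χ x ∈ Set.Icc (0 : ℝ) 1) : ‖bakerMatrix N M A χ‖ ≤ 1 := by
  unfold bakerMatrix
  have h1 := dft_norm N
  rw [← Matrix.l2_opNorm_conjTranspose] at h1
  have h2 := blocks_norm N M hN hMN χ hχ01
  have h3 : ‖Matrix.diagonal fun j : Fin N => if (j : ℕ) / (N / M) ∈ A then (1:ℂ) else 0‖ ≤ 1 := by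
    apply norm_diag_le; intro i; split_ifs <;> simp
  refine (norm_mul_le _ _).trans ?_
  calc _ ≤ (1 * 1) * 1 := by
        gcongr
        refine (norm_mul_le _ _).trans ?_
        gcongr
    _ = (1:ℝ) := by norm_num

lemma baker_dft (N M : ℕ) (A : Finset ℕ) (χ : ℝ → ℝ) :
    dftMatrix N * bakerMatrix N M A χ = (bakerMatrix N M A χ).transpose * dftMatrix N := by
  set I := (Matrix.diagonal fun j : Fin N => if (j : ℕ) / (N / M) ∈ A then (1:ℂ) else 0) with hI
  have h1 : (bakerBlocks N M χ).transpose = bakerBlocks N M χ := by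
    ext i j
    simp only [Matrix.transpose_apply, bakerBlocks, Matrix.of_apply]
    by_cases h : (j:ℕ) / (N / M) = (i:ℕ) / (N / M)
    · rw [if_pos h, if_pos h.symm, mul_comm ((j:ℕ) % (N/M)) ((i:ℕ) % (N/M))]; ring
    · rw [if_neg h, if_neg (Ne.symm h)]
  have h2 : I * bakerBlocks N M χ = bakerBlocks N M χ * I := by
    ext i j
    rw [hI, Matrix.mul_diagonal, Matrix.diagonal_mul]
    simp only [bakerBlocks, Matrix.of_apply]
    by_cases h : (i:ℕ) / (N / M) = (j:ℕ) / (N / M)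
    · rw [h]; ring
    · rw [if_neg h]; ring
  have h3 : ((dftMatrix N).conjTranspose).transpose = (dftMatrix N).conjTranspose := by
    ext i j
    simp only [Matrix.transpose_apply, Matrix.conjTranspose_apply]
    have := congrFun (congrFun (dft_symm N) i) j
    rw [Matrix.transpose_apply] at this
    rw [this]
  have hIt : I.transpose = I := Matrix.diagonal_transpose _
  unfold bakerMatrix
  rw [← hI, Matrix.transpose_mul, Matrix.transpose_mul, h1, h3, hIt]
  rw [Matrix.mul_assoc (dftMatrix N).conjTranspose, ← h2, ← Matrix.mul_assoc (dftMatrix N), dft_unit', Matrix.one_mul,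
    Matrix.mul_assoc I, Matrix.mul_assoc, dft_unit, Matrix.mul_one]

lemma entry_eq (M n a l : ℕ) (hn : 0 < n) (hl : l < n) (A : Finset ℕ) (χ : ℝ → ℝ) (ha : a ∈ A) (haM : a < M)
    (j p : Fin (M * n)) (hp : (p:ℕ) = a * n + l) :
    bakerMatrix (M * n) M A χ j p = ((Real.sqrt ((M * n : ℕ):ℝ))⁻¹ * (Real.sqrt (n:ℝ))⁻¹ * χ ((l:ℝ)/n) : ℝ) *
      (ec (-((j:ℕ) * (a * n) / ((M * n : ℕ) : ℝ))) *
      ∑ m ∈ Finset.range n, (χ ((m:ℝ)/n):ℂ) * ec (((l:ℝ)/n - (j:ℕ)/((M*n:ℕ):ℝ)) * m)) := by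
  have hM : 0 < M := by omega
  have hdiv : M * n / M = n := Nat.mul_div_cancel_left _ hM
  have hpd : (p:ℕ) / n = a := by rw [hp, mul_comm, Nat.mul_add_div hn, Nat.div_eq_of_lt hl, add_zero]
  have hpm : (p:ℕ) % n = l := by rw [hp, mul_comm, Nat.mul_add_mod, Nat.mod_eq_of_lt hl]
  unfold bakerMatrix
  rw [Matrix.mul_diagonal, Matrix.mul_apply]
  simp only [bakerBlocks, Matrix.conjTranspose_apply, Matrix.of_apply, hdiv, hpd, hpm, if_pos ha, mul_one,
    mul_ite, mul_zero]
  rw [sum_block M n a hn haM (fun i => star (dftMatrix (M * n) (if h : i < M * n then ⟨i, h⟩ else j) j) * 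
     ((χ (((i % n : ℕ) : ℝ) / (n : ℝ)) : ℝ) * (((Real.sqrt (n : ℝ))⁻¹ : ℝ) *
          ec ((((i % n) * l : ℕ) : ℝ) / (n : ℝ))) * ((χ ((l:ℝ)/n) : ℝ) : ℂ))) |> fun h => (Finset.sum_congr rfl fun i _ => ?_).trans h]
  rotate_left
  · split_ifs with h1 h2
    · rfl
    · exact absurd i.2 h2
    · rfl
  rw [Finset.mul_sum, Finset.mul_sum]
  refine Finset.sum_congr rfl fun m hm => ?_
  rw [Finset.mem_range] at hm
  have hlt : a * n + m < M * n := by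
    have : (a + 1) * n ≤ M * n := Nat.mul_le_mul_right _ haM
    rw [Nat.succ_mul] at this; omega
  have hmm : (a * n + m) % n = m := by rw [mul_comm, Nat.mul_add_mod, Nat.mod_eq_of_lt hm]
  rw [hmm, dif_pos hlt]
  simp only [dftMatrix, Matrix.of_apply]
  have hs : ∀ z : ℂ, star z = (starRingEnd ℂ) z := fun z => rfl
  rw [hs, map_mul, Complex.conj_ofReal, ← ec_neg]
  have key : ec (-(((a * n + m : ℕ):ℝ) * (j:ℕ) / ((M * n : ℕ):ℝ))) * ec (((m * l : ℕ) : ℝ) / (n : ℝ)) = 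
     ec (-((j:ℕ) * (a * n) / ((M * n : ℕ) : ℝ))) * ec (((l:ℝ)/n - (j:ℕ)/((M*n:ℕ):ℝ)) * m) := by
    rw [← ec_add, ← ec_add]; congr 1; push_cast; ring
  push_cast at key ⊢
  linear_combination (((Real.sqrt ((M:ℝ) * n) : ℝ):ℂ)⁻¹ * ((Real.sqrt (n:ℝ) : ℝ) : ℂ)⁻¹ * χ ((l:ℝ)/n) * (χ ((m:ℝ)/n):ℂ) : ℂ) * key

lemma entry_bound (χ : ℝ → ℝ) (hχ01 : ∀ x : ℝ, χ x ∈ Set.Icc (0 : ℝ) 1) (c0 C : ℝ) (L : ℕ)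
    (hc0 : 0 < c0) (hc1 : c0 ≤ 1) (hc : ∀ x, χ x ≠ 0 → c0 ≤ x ∧ x ≤ 1 - c0) (hC : 0 ≤ C)
    (hdec : ∀ (n : ℕ) (y : ℝ), 0 < n → ‖∑ m ∈ Finset.range n, (χ ((m:ℝ)/n):ℂ) * ec (y*m)‖ * (4*nd y)^L ≤ C*n*(1/n)^L)
    (M n a l : ℕ) (hn : 0 < n) (hl : l < n) (A : Finset ℕ) (ha : a ∈ A) (haM : a < M)
    (j p : Fin (M * n)) (hp : (p:ℕ) = a * n + l) (ρ : ℝ) (hρ0 : 0 ≤ ρ) (hρ1 : ρ ≤ 1)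
    (hρ : ρ ≤ |(l:ℝ)/n - (j:ℕ)/((M*n:ℕ):ℝ)|) :
    ‖bakerMatrix (M * n) M A χ j p‖ * (4 * (c0 * ρ))^L ≤ C * n * (1/n)^L := by
  rw [entry_eq M n a l hn hl A χ ha haM j p hp]
  set y := (l:ℝ)/n - (j:ℕ)/((M*n:ℕ):ℝ) with hy
  have hn' : (1:ℝ) ≤ n := by exact_mod_cast hn
  have hMn : 0 < M * n := by have : 0 < M := by omega
                             positivity
  have hMn' : (1:ℝ) ≤ (M * n : ℕ) := by exact_mod_cast hMn
  by_cases hz : χ ((l:ℝ)/n) = 0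
  · rw [hz]; simp; positivity
  obtain ⟨h1, h2⟩ := hc _ hz
  have hj0 : 0 ≤ ((j:ℕ):ℝ)/((M*n:ℕ):ℝ) := by positivity
  have hj1 : ((j:ℕ):ℝ)/((M*n:ℕ):ℝ) ≤ 1 := by
    rw [div_le_one (by linarith)]; exact_mod_cast j.2.le
  have hcr : c0 * ρ ≤ c0 := by nlinarith
  have hcr' : c0 * ρ ≤ ρ := by nlinarith
  have hnd : c0 * ρ ≤ nd y := by
    apply le_nd_of_abs
    · linarith
    · rw [abs_le]; constructor <;> linarith
  have hd := hdec n y hn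
  have hb : ‖((((Real.sqrt ((M * n : ℕ):ℝ))⁻¹ * (Real.sqrt (n:ℝ))⁻¹ * χ ((l:ℝ)/n) : ℝ)) : ℂ)‖ ≤ 1 := by
    rw [Complex.norm_real, norm_mul, norm_mul, Real.norm_of_nonneg (by positivity), Real.norm_of_nonneg (by positivity),
      Real.norm_of_nonneg (hχ01 _).1]
    have i1 : (Real.sqrt ((M * n : ℕ):ℝ))⁻¹ ≤ 1 := inv_le_one_of_one_le₀ (Real.one_le_sqrt.2 hMn')
    have i2 : (Real.sqrt (n:ℝ))⁻¹ ≤ 1 := inv_le_one_of_one_le₀ (Real.one_le_sqrt.2 hn')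
    calc _ ≤ (1 * 1 * 1 : ℝ) := by
          gcongr
          · exact (hχ01 _).1
          · exact (hχ01 _).2
      _ = 1 := by norm_num
  rw [norm_mul, norm_mul, ec_norm, one_mul]
  refine le_trans ?_ hd
  gcongr
  exact mul_le_of_le_one_left (norm_nonneg _) hb
end

section
open scoped Matrix.Norms.L2Operator

def Pr {N : ℕ} (S : Finset (Fin N)) : Matrix (Fin N) (Fin N) ℂ := Matrix.diagonal fun j => if j ∈ S then 1 else 0

def en {N : ℕ} (v : Fin N → ℂ) : ℝ := ‖(WithLp.toLp 2 v : EuclideanSpace ℂ (Fin N))‖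

lemma en_mul {N : ℕ} (A : Matrix (Fin N) (Fin N) ℂ) (v : Fin N → ℂ) : en (A.mulVec v) ≤ ‖A‖ * en v :=
  Matrix.l2_opNorm_mulVec A (WithLp.toLp 2 v)

lemma en_add {N : ℕ} (v w : Fin N → ℂ) : en (v + w) ≤ en v + en w := by
  unfold en; rw [WithLp.toLp_add]; exact norm_add_le _ _

lemma en_smul {N : ℕ} (c : ℂ) (v : Fin N → ℂ) : en (c • v) = ‖c‖ * en v := by
  unfold en; rw [WithLp.toLp_smul]; exact norm_smul _ _

lemma en_pos {N : ℕ} (v : Fin N → ℂ) (hv : v ≠ 0) : 0 < en v := by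
  unfold en
  rw [norm_pos_iff]
  intro h
  apply hv
  have := congrArg (WithLp.ofLp) h
  simpa using this

lemma Pr_norm {N : ℕ} (S : Finset (Fin N)) : ‖Pr S‖ ≤ 1 := by
  apply norm_diag_le; intro i; split_ifs <;> simp

lemma Pr_compl {N : ℕ} (S : Finset (Fin N)) : 1 - Pr S = Pr Sᶜ := by
  unfold Pr
  rw [← Matrix.diagonal_one, Matrix.diagonal_sub]
  congr 1
  ext i
  by_cases h : i ∈ S <;> simp [h]

lemma Pr_tr {N : ℕ} (S : Finset (Fin N)) : (Pr S).transpose = Pr S := Matrix.diagonal_transpose _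

lemma Pr_ct {N : ℕ} (S : Finset (Fin N)) : (Pr S).conjTranspose = Pr S := by
  unfold Pr
  rw [Matrix.diagonal_conjTranspose]
  congr 1
  ext i
  by_cases h : i ∈ S <;> simp [h]

lemma pow_norm_le {N : ℕ} (B : Matrix (Fin N) (Fin N) ℂ) (hB : ‖B‖ ≤ 1) (n : ℕ) : ‖B ^ n‖ ≤ 1 := by
  induction n with
  | zero => rw [pow_zero]; exact norm_one_le N
  | succ n ih =>
    rw [pow_succ]
    calc _ ≤ ‖B ^ n‖ * ‖B‖ := norm_mul_le _ _
      _ ≤ 1 * 1 := by gcongr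
      _ = 1 := by norm_num

lemma prop_norm {N : ℕ} (B : Matrix (Fin N) (Fin N) ℂ) (hB : ‖B‖ ≤ 1) (Z : ℕ → Finset (Fin N)) (e : ℝ) (he : 0 ≤ e)
    (hZ0 : Z 0 = Finset.univ) (h : ∀ i, ∀ j ∈ Z i, ∀ p, p ∉ Z (i+1) → ‖B j p‖ ≤ e) (n : ℕ) :
    ‖B ^ n * (1 - Pr (Z n))‖ ≤ n * (N * e) := by
  induction n with
  | zero =>
    have : (1 : Matrix (Fin N) (Fin N) ℂ) - Pr (Z 0) = 0 := by
      rw [Pr_compl, hZ0]; unfold Pr; simp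
    rw [this]; simp
  | succ n ih =>
    have e1 : B ^ (n+1) * (1 - Pr (Z (n+1))) = B ^ n * (Pr (Z n) * B * (1 - Pr (Z (n+1)))) +
        (B ^ n * (1 - Pr (Z n))) * (B * (1 - Pr (Z (n+1)))) := by
      rw [pow_succ]; noncomm_ring
    have h2 : ‖Pr (Z n) * B * (1 - Pr (Z (n+1)))‖ ≤ N * e := by
      apply norm_of_entries _ _ he
      intro j p
      rw [Pr_compl]
      unfold Pr
      rw [Matrix.mul_diagonal, Matrix.diagonal_mul]
      by_cases hj : j ∈ Z n
      · by_cases hp : p ∈ Z (n+1)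
        · simp [hp, he]
        · simpa [hp, hj] using h n j hj p hp
      · simp [hj, he]
    have h3 : ‖B * (1 - Pr (Z (n+1)))‖ ≤ 1 := by
      rw [Pr_compl]
      calc _ ≤ ‖B‖ * ‖Pr (Z (n+1))ᶜ‖ := norm_mul_le _ _
        _ ≤ 1 * 1 := by gcongr; exact Pr_norm _
        _ = 1 := by norm_num
    rw [e1]
    calc _ ≤ ‖B ^ n * (Pr (Z n) * B * (1 - Pr (Z (n+1))))‖ + ‖(B ^ n * (1 - Pr (Z n))) * (B * (1 - Pr (Z (n+1))))‖ := norm_add_le _ _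
      _ ≤ ‖B ^ n‖ * ‖Pr (Z n) * B * (1 - Pr (Z (n+1)))‖ + ‖(B ^ n * (1 - Pr (Z n)))‖ * ‖(B * (1 - Pr (Z (n+1))))‖ := 
          add_le_add (norm_mul_le _ _) (norm_mul_le _ _)
      _ ≤ 1 * (N * e) + (n * (N * e)) * 1 := by
          gcongr
          exact pow_norm_le B hB n
      _ = _ := by push_cast; ring

lemma eig_bound {N : ℕ} (B F : Matrix (Fin N) (Fin N) ℂ) (hB : ‖B‖ ≤ 1) (hF : F.conjTranspose * F = 1)
    (hFB : F * B = B.transpose * F) (S : Finset (Fin N)) (n : ℕ) (η T : ℝ) 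
    (hη : ‖B ^ n * (1 - Pr S)‖ ≤ η) (hT : ‖Pr S * F * Pr S‖ ≤ T) (lam : ℂ) (v : Fin N → ℂ) (hv : v ≠ 0)
    (hl : B.mulVec v = lam • v) :
    ‖lam‖ ^ n * ‖lam‖ ^ n ≤ T * ‖lam‖ ^ n + η * ‖lam‖ ^ n + η := by
  have hv0 := en_pos v hv
  have hFn := norm_le_of_unit F hF
  have hpow : ∀ n, (B ^ n).mulVec v = lam ^ n • v := by
    intro n
    induction n with
    | zero => simp
    | succ n ih => rw [pow_succ, ← Matrix.mulVec_mulVec, hl, Matrix.mulVec_smul, ih, smul_smul, pow_succ, mul_comm]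
  have hFBn : ∀ n, F * B ^ n = B.transpose ^ n * F := by
    intro n
    induction n with
    | zero => simp
    | succ n ih => rw [pow_succ, ← Matrix.mul_assoc, ih, Matrix.mul_assoc, hFB, pow_succ, Matrix.mul_assoc]
  set L := ‖lam‖ ^ n with hL
  have hL0 : 0 ≤ L := by positivity
  have i1 : L * en v ≤ en ((Pr S).mulVec v) + η * en v := by
    have e : lam ^ n • v = (B ^ n).mulVec ((Pr S).mulVec v) + (B ^ n * (1 - Pr S)).mulVec v := by
      rw [← hpow, Matrix.mulVec_mulVec, ← Matrix.add_mulVec]; congr 1; noncomm_ring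
    have := en_smul (lam ^ n) v
    rw [norm_pow] at this
    rw [← this, e]
    refine (en_add _ _).trans (add_le_add ?_ ?_)
    · refine (en_mul _ _).trans ?_
      exact mul_le_of_le_one_left (norm_nonneg _) (pow_norm_le B hB n)
    · exact (en_mul _ _).trans (mul_le_mul_of_nonneg_right hη hv0.le)
  have hFv : en (F.mulVec v) ≤ en v := (en_mul _ _).trans (mul_le_of_le_one_left hv0.le hFn)
  have hη0 : 0 ≤ η := (norm_nonneg _).trans hη
  have hT0 : 0 ≤ T := (norm_nonneg _).trans hT
  have i2 : L * en ((1 - Pr S).mulVec (F.mulVec v)) ≤ η * en v := by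
    have e : lam ^ n • ((1 - Pr S).mulVec (F.mulVec v)) = ((B ^ n * (1 - Pr S)).transpose).mulVec (F.mulVec v) := by
      rw [Matrix.transpose_mul, Matrix.transpose_pow, ← Matrix.mulVec_mulVec (F.mulVec v), Matrix.mulVec_mulVec v (B.transpose ^ n),
        ← hFBn, ← Matrix.mulVec_mulVec v F (B ^ n), hpow, Matrix.mulVec_smul, Matrix.mulVec_smul, Matrix.transpose_sub, Matrix.transpose_one, Pr_tr]
    have := en_smul (lam ^ n) ((1 - Pr S).mulVec (F.mulVec v))
    rw [norm_pow] at this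
    rw [← this, e]
    refine (en_mul _ _).trans ?_
    have := (norm_transpose_le (B ^ n * (1 - Pr S))).trans hη
    have h0 : 0 ≤ en (F.mulVec v) := norm_nonneg _
    gcongr
  have i3 : en ((Pr S).mulVec v) ≤ T * en v + en ((1 - Pr S).mulVec (F.mulVec v)) := by
    have e : (Pr S).mulVec v = (Pr S * F.conjTranspose * Pr S).mulVec (F.mulVec v) + 
        (Pr S * F.conjTranspose).mulVec ((1 - Pr S).mulVec (F.mulVec v)) := by
      rw [Matrix.mulVec_mulVec, Matrix.mulVec_mulVec, Matrix.mulVec_mulVec, ← Matrix.add_mulVec]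
      congr 1
      have : Pr S * F.conjTranspose * Pr S * F + Pr S * F.conjTranspose * (1 - Pr S) * F = Pr S * (F.conjTranspose * F) := by
        noncomm_ring
      rw [this, hF, Matrix.mul_one]
    rw [e]
    refine (en_add _ _).trans (add_le_add ?_ ?_)
    · refine (en_mul _ _).trans ?_
      have : ‖Pr S * F.conjTranspose * Pr S‖ ≤ T := by
        have e2 : Pr S * F.conjTranspose * Pr S = (Pr S * F * Pr S).conjTranspose := by
          rw [Matrix.conjTranspose_mul, Matrix.conjTranspose_mul, Pr_ct, Matrix.mul_assoc]
        rw [e2, Matrix.l2_opNorm_conjTranspose]; exact hT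
      have h0 : 0 ≤ en (F.mulVec v) := norm_nonneg _
      gcongr
    · refine (en_mul _ _).trans ?_
      apply mul_le_of_le_one_left (norm_nonneg _)
      calc _ ≤ ‖Pr S‖ * ‖F.conjTranspose‖ := norm_mul_le _ _
        _ ≤ 1 * 1 := by gcongr; exact Pr_norm S; rw [Matrix.l2_opNorm_conjTranspose]; exact hFn
        _ = 1 := by norm_num
  have : L * L * en v ≤ (T * L + η * L + η) * en v := by
    nlinarith [mul_le_mul_of_nonneg_left i1 hL0, mul_le_mul_of_nonneg_left i3 hL0]
  exact le_of_mul_le_mul_right this hv0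
end

section
open scoped Matrix.Norms.L2Operator

lemma BB_restrict {N : ℕ} (hN : 0 < N) (S : Finset (Fin N)) (C : ℝ) (hC : 0 ≤ C)
    (h : BB S S (fun j l => ec (((j:ℕ):ℝ) * ((l:ℕ):ℝ) / N)) C) : ‖Pr S * dftMatrix N * Pr S‖ ≤ (√N)⁻¹ * C := by
  apply norm_of_BB _ _ (by positivity)
  intro u v
  have e : ∑ i, ∑ j, u i * (Pr S * dftMatrix N * Pr S) i j * v j = (((√N)⁻¹ : ℝ) : ℂ) * ∑ i ∈ S, ∑ j ∈ S, u i * ec (((i:ℕ):ℝ) * ((j:ℕ):ℝ) / N) * v j := by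
    rw [Finset.mul_sum, ← Finset.sum_filter_add_sum_filter_not Finset.univ (fun i => i ∈ S)]
    have z : ∑ i with i ∉ S, ∑ j, u i * (Pr S * dftMatrix N * Pr S) i j * v j = 0 := by
      refine Finset.sum_eq_zero fun i hi => Finset.sum_eq_zero fun j _ => ?_
      unfold Pr
      rw [Matrix.mul_diagonal, Matrix.diagonal_mul, if_neg (Finset.mem_filter.1 hi).2]; ring
    rw [z, add_zero]
    have hS : Finset.univ.filter (fun i => i ∈ S) = S := by ext; simp
    rw [hS]
    refine Finset.sum_congr rfl fun i hi => ?_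
    rw [Finset.mul_sum, ← Finset.sum_filter_add_sum_filter_not Finset.univ (fun i => i ∈ S)]
    have z : ∑ j with j ∉ S, u i * (Pr S * dftMatrix N * Pr S) i j * v j = 0 := by
      refine Finset.sum_eq_zero fun j hj => ?_
      unfold Pr
      rw [Matrix.mul_diagonal, Matrix.diagonal_mul, if_neg (Finset.mem_filter.1 hj).2]; ring
    rw [z, add_zero, hS]
    refine Finset.sum_congr rfl fun j hj => ?_
    unfold Pr
    rw [Matrix.mul_diagonal, Matrix.diagonal_mul, if_pos hi, if_pos hj]
    simp only [dftMatrix, Matrix.of_apply]; ring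
  rw [e, norm_mul, Complex.norm_real, Real.norm_of_nonneg (by positivity), mul_assoc]
  refine mul_le_mul_of_nonneg_left ?_ (by positivity)
  refine (h u v).trans ?_
  gcongr <;> exact Finset.subset_univ _

def ZZ (M n1 D : ℕ) (ρ : ℝ) : ℕ → Finset (Fin (M * n1))
  | 0 => Finset.univ
  | i+1 => Finset.univ.filter fun p => (p:ℕ) / n1 < D ∧ ∃ j ∈ ZZ M n1 D ρ i,
      |(((p:ℕ) % n1 : ℕ) : ℝ) / n1 - ((j:ℕ):ℝ) / ((M * n1 : ℕ):ℝ)| ≤ ρ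

lemma ZZ_cantor (M n1 D : ℕ) (ρ : ℝ) (hρ : 0 ≤ ρ) (hM : 2 ≤ M) (hn : 0 < n1) (i : ℕ) (j : Fin (M * n1)) (hj : j ∈ ZZ M n1 D ρ i) :
    ∃ c ∈ CC M D i, |((j:ℕ):ℝ) - c * (((M * n1 : ℕ):ℝ) / M ^ i)| ≤ ((M * n1 : ℕ):ℝ) / M ^ i + ρ * ((M * n1 : ℕ):ℝ) := by
  have hM' : (2:ℝ) ≤ M := by exact_mod_cast hM
  have hn' : (0:ℝ) < n1 := by exact_mod_cast hn
  induction i generalizing j with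
  | zero =>
    refine ⟨0, by simp [CC], ?_⟩
    have : ((j:ℕ):ℝ) ≤ ((M * n1 : ℕ):ℝ) := by exact_mod_cast j.2.le
    have h2 : 0 ≤ ρ * ((M * n1 : ℕ):ℝ) := by positivity
    rw [Nat.cast_zero, zero_mul, sub_zero, abs_of_nonneg (by positivity), pow_zero, div_one]
    linarith
  | succ i ih =>
    rw [ZZ, Finset.mem_filter] at hj
    obtain ⟨-, ha, j', hj', hd⟩ := hj
    obtain ⟨c, hc, hcd⟩ := ih j' hj'
    refine ⟨_, CC_top ha hc, ?_⟩
    set a := (j:ℕ) / n1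
    set l := (j:ℕ) % n1
    have hja : ((j:ℕ):ℝ) = n1 * a + l := by exact_mod_cast (Nat.div_add_mod (j:ℕ) n1).symm
    push_cast at hd hcd ⊢
    rw [hja]
    have hMi : (0:ℝ) < (M:ℝ) ^ i := by positivity
    set y : ℝ := (M:ℝ) * n1 / M ^ i with hy
    have hy' : (M:ℝ) * n1 / M ^ (i+1) = y / M := by rw [hy, pow_succ]; field_simp
    have e1 : (n1:ℝ) * a + l - (a * M ^ i + c) * (M * n1 / M ^ (i+1)) = ((M * l - j') + (j' - c * y)) / M := by
      have hyM : M ^ i * y = M * n1 := by rw [hy]; field_simp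
      rw [hy', eq_div_iff (by positivity)]
      have : ((a:ℝ) * M ^ i + c) * (y / M) * M = a * (M ^ i * y) + c * y := by field_simp
      rw [sub_mul, this, hyM]; ring
    have e2 : |(M:ℝ) * l - j'| ≤ ρ * (M * n1) := by
      have : (M:ℝ) * l - j' = (l / n1 - j' / (M * n1)) * (M * n1) := by field_simp
      rw [this, abs_mul, abs_of_pos (by positivity : (0:ℝ) < M * n1)]
      gcongr
    rw [e1, hy', abs_div, abs_of_pos (by linarith : (0:ℝ) < M), div_le_iff₀ (by linarith)]
    refine (abs_add_le _ _).trans ?_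
    have : (y / M + ρ * (M * n1)) * M = y + ρ * (M * n1) * M := by field_simp
    rw [this]
    have h3 : 0 ≤ ρ * ((M:ℝ) * n1) := by positivity
    nlinarith

lemma main_ineq (χ : ℝ → ℝ) (hχ01 : ∀ x : ℝ, χ x ∈ Set.Icc (0 : ℝ) 1) (c0 C : ℝ) (L : ℕ)
    (hc0 : 0 < c0) (hc1 : c0 ≤ 1) (hc : ∀ x, χ x ≠ 0 → c0 ≤ x ∧ x ≤ 1 - c0) (hC : 0 ≤ C)
    (hdec : ∀ (n : ℕ) (y : ℝ), 0 < n → ‖∑ m ∈ Finset.range n, (χ ((m:ℝ)/n):ℂ) * ec (y*m)‖ * (4*nd y)^L ≤ C*n*(1/n)^L)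
    (M n1 D m g : ℕ) (hM : 2 ≤ M) (hn : 0 < n1) (hD0 : 0 < D) (hD : D * D ≤ M)
    (β V x : ℝ) (hβ0 : 0 ≤ β) (hβ1 : β ≤ 1) (hV0 : 0 ≤ V)
    (hV : ∀ z, ∑ b ∈ Finset.range D, Gd D (β*b+z) ≤ V) (hx : x * M^(m+g) = (M * n1 : ℕ)) (hx1 : 1 ≤ x)
    (hxβ : x*x/(M * n1 : ℕ) = β*M/M^m) (lam : ℂ) (v : Fin (M * n1) → ℂ) (hv : v ≠ 0)
    (hl : (bakerMatrix (M * n1) M (Finset.range D) χ).mulVec v = lam • v) (T η : ℝ)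
    (hT : T = (√((M * n1 : ℕ):ℝ))⁻¹ * ((7*x)^2*(√((4*V)^m*D^(2*g))*Real.exp (2*Real.pi)*Real.exp (2*Real.pi))))
    (hη : η = (m+g:ℕ) * ((M * n1 : ℕ) * (C * n1 * (1/n1)^L / (4 * (c0 * (1 / (M:ℝ)^(m+g))))^L))) :
    ‖lam‖ ^ (m+g) * ‖lam‖ ^ (m+g) ≤ T * ‖lam‖ ^ (m+g) + η * ‖lam‖ ^ (m+g) + η := by
  have hN : 0 < M * n1 := by positivity
  have hM0 : (0:ℝ) < M := by exact_mod_cast (by omega : 0 < M)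
  have hM1 : (1:ℝ) ≤ M := by exact_mod_cast (by omega : 1 ≤ M)
  set ρ : ℝ := 1 / (M:ℝ)^(m+g) with hρ
  have hρ0 : 0 < ρ := by positivity
  have hρ1 : ρ ≤ 1 := by rw [hρ, div_le_one (by positivity)]; exact one_le_pow₀ hM1
  have hDM : D ≤ M := by nlinarith
  have hB := baker_norm (M * n1) M hN (Dvd.intro _ rfl) (Finset.range D) χ hχ01
  refine eig_bound _ (dftMatrix (M * n1)) hB (dft_unit _) (baker_dft _ _ _ _) (ZZ M n1 D ρ (m+g)) (m+g) η T ?_ ?_ lam v hv hl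
  · rw [hη]
    refine prop_norm _ hB (ZZ M n1 D ρ) _ (by positivity) rfl ?_ (m+g)
    intro i j hj p hp
    have hdiv : M * n1 / M = n1 := Nat.mul_div_cancel_left _ (by omega)
    rw [ZZ, Finset.mem_filter] at hp
    by_cases ha : (p:ℕ) / n1 < D
    · have hd : ρ < |(((p:ℕ) % n1 : ℕ) : ℝ) / n1 - ((j:ℕ):ℝ) / ((M * n1 : ℕ):ℝ)| := by
        by_contra hcon
        push Not at hcon
        exact hp ⟨Finset.mem_univ _, ha, j, hj, hcon⟩
      rw [le_div_iff₀ (by positivity)]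
      exact entry_bound χ hχ01 c0 C L hc0 hc1 hc hC hdec M n1 ((p:ℕ)/n1) ((p:ℕ)%n1) hn (Nat.mod_lt _ hn) _
        (Finset.mem_range.2 ha) (by omega) j p (Nat.div_add_mod' _ _).symm ρ hρ0.le hρ1 hd.le
    · unfold bakerMatrix
      rw [Matrix.mul_diagonal, hdiv, if_neg (by rw [Finset.mem_range]; exact ha), mul_zero, norm_zero]
      positivity
  · rw [hT]
    apply BB_restrict hN _ _ (by positivity)
    refine thick_BB (M * n1) M D m g hN hD0 hD β V x hβ0 hβ1 hV0 hV hx hx1 hxβ (ZZ M n1 D ρ (m+g)) (fun j => (j:ℕ))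
      (fun a _ b _ h => Fin.ext h) (fun j _ => j.2) ?_
    intro j hj
    obtain ⟨c, hc, h⟩ := ZZ_cantor M n1 D ρ hρ0.le hM hn (m+g) j hj
    refine ⟨c, hc, ?_⟩
    have e1 : ((M * n1 : ℕ):ℝ) / M ^ (m+g) = x := by rw [div_eq_iff (by positivity), hx]
    have e2 : ρ * ((M * n1 : ℕ):ℝ) = x := by rw [← e1, hρ]; ring
    rw [e1, e2] at h
    linarith
end

section
lemma final_num (Lam T η b : ℝ) (hb : 0 < b) (hb1 : b ≤ 1) (hbL : b ≤ Lam) (hT : T ≤ b / 2) (hη : 4 * η < b ^ 2)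
    (h : Lam * Lam ≤ T * Lam + η * Lam + η) : False := by
  have hL : 0 < Lam := by linarith
  have h1 : T * Lam ≤ Lam * Lam / 2 := by nlinarith
  have hb2 : b ^ 2 ≤ Lam := by nlinarith
  have h2 : η * Lam < Lam * Lam / 4 := by nlinarith
  have h3 : η < Lam * Lam / 4 := by nlinarith
  linarith

lemma T_le (M N x V W G D e b : ℝ) (k g m : ℕ) (hM : 1 ≤ M) (hN : M ^ k ≤ N) (hx0 : 0 ≤ x) (hx : x ≤ M ^ (g+1))
    (hV0 : 0 ≤ V) (hV : 4 * V ≤ W * G) (hW : 1 ≤ W) (hG : 1 ≤ G) (hD0 : 0 ≤ D) (hD : D * D ≤ M)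
    (he : 0 ≤ e) (hk : m + g ≤ k) (hb0 : 0 ≤ b) (hb : b ^ 2 = (G ^ 2 * W / M) ^ (m+g))
    (hlarge : 4 * (7 ^ 4 * e ^ 4) * M ^ 4 * M ^ (5 * g) ≤ G ^ (m+g)) :
    (√N)⁻¹ * ((7*x)^2*(√((4*V)^m*D^(2*g))*e*e)) ≤ b / 2 := by
  have hM0 : 0 < M := by linarith
  have hN0 : 0 < N := lt_of_lt_of_le (by positivity) hN
  refine (sq_le_sq₀ (by positivity) (by positivity)).1 ?_
  have e1 : ((√N)⁻¹ * ((7*x)^2*(√((4*V)^m*D^(2*g))*e*e))) ^ 2 = N⁻¹ * (7 ^ 4 * e ^ 4) * x ^ 4 * ((4*V)^m*D^(2*g)) := by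
    have h1 : √N ^ 2 = N := Real.sq_sqrt hN0.le
    have h2 : √((4*V)^m*D^(2*g)) ^ 2 = (4*V)^m*D^(2*g) := Real.sq_sqrt (by positivity)
    calc _ = (√N ^ 2)⁻¹ * (7 ^ 4 * e ^ 4) * x ^ 4 * (√((4*V)^m*D^(2*g)) ^ 2) := by ring
      _ = _ := by rw [h1, h2]
  rw [e1, div_pow, hb]
  have q1 : (4*V)^m ≤ (W * G) ^ (m+g) := by
    calc (4*V)^m ≤ (W*G)^m := by gcongr
      _ ≤ _ := pow_le_pow_right₀ (by nlinarith) (by omega)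
  have q2 : D^(2*g) ≤ M ^ g := by
    rw [pow_mul]; gcongr; nlinarith
  have q3 : x ^ 4 ≤ M ^ (4 * g) * M ^ 4 := by
    calc x ^ 4 ≤ (M ^ (g+1)) ^ 4 := by gcongr
      _ = _ := by ring
  have q4 : N⁻¹ ≤ (M ^ (m+g))⁻¹ := by
    apply inv_anti₀ (by positivity)
    exact (pow_le_pow_right₀ hM hk).trans hN
  calc N⁻¹ * (7 ^ 4 * e ^ 4) * x ^ 4 * ((4*V)^m*D^(2*g)) 
      ≤ (M ^ (m+g))⁻¹ * (7 ^ 4 * e ^ 4) * (M ^ (4 * g) * M ^ 4) * ((W * G) ^ (m+g) * M ^ g) := by gcongr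
    _ = (4 * (7 ^ 4 * e ^ 4) * M ^ 4 * M ^ (5 * g)) * ((M ^ (m+g))⁻¹ * (W * G) ^ (m+g) / 4) := by ring
    _ ≤ G ^ (m+g) * ((M ^ (m+g))⁻¹ * (W * G) ^ (m+g) / 4) := by gcongr
    _ = (G ^ 2 * W / M) ^ (m+g) / 2 ^ 2 := by
      rw [div_pow, mul_pow, mul_pow, div_eq_mul_inv, div_eq_mul_inv]; ring

lemma eta_le (M C c0 n1 : ℝ) (k g n K : ℕ) (hM : 1 ≤ M) (hC : 0 ≤ C) (hc0 : 0 < c0) (hn1 : M ^ k ≤ M * n1) (hn2 : M * n1 ≤ M ^ (k+1))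
    (hn : n + g = k) (hg : k ≤ K * g + K) (hlarge : 4 * (C / (4 * c0) ^ (5 * K)) * M ^ (2 * (5 * K) + 1) * k < M ^ k)
    (b : ℝ) (hb : 1 ≤ b ^ 2 * M ^ (2 * k)) :
    4 * (n * ((M * n1) * (C * n1 * (1/n1)^(5*K) / (4 * (c0 * (1 / M^n)))^(5*K)))) < b ^ 2 := by
  have hM0 : 0 < M := by linarith
  have hn0 : 0 < n1 := by
    have : 0 < M ^ k := by positivity
    by_contra hcon
    push Not at hcon
    nlinarith
  have hnk : (n:ℝ) ≤ k := by exact_mod_cast (by omega : n ≤ k)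
  have h1 : n1 ≤ M ^ k := by
    rw [pow_succ, mul_comm] at hn2
    exact le_of_mul_le_mul_right hn2 hM0
  have h2 : M ^ n / n1 ≤ M / M ^ g := by
    rw [div_le_div_iff₀ hn0 (by positivity), ← pow_add, hn]; exact hn1
  have e1 : C * n1 * (1/n1)^(5*K) / (4 * (c0 * (1 / M^n)))^(5*K) = n1 * (C / (4 * c0) ^ (5 * K)) * (M ^ n / n1) ^ (5 * K) := by
    have : 4 * (c0 * (1 / M^n)) = (4 * c0) / M ^ n := by ring
    rw [this, div_pow, div_pow, div_pow, one_pow]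
    field_simp
  rw [e1]
  have h3 : (M ^ n / n1) ^ (5 * K) ≤ M ^ (2 * (5 * K)) / M ^ (5 * k) := by
    calc (M ^ n / n1) ^ (5 * K) ≤ (M / M ^ g) ^ (5 * K) := by gcongr
      _ = M ^ (5 * K) / M ^ (g * (5 * K)) := by rw [div_pow, ← pow_mul]
      _ ≤ _ := by
        rw [div_le_div_iff₀ (by positivity) (by positivity), ← pow_add, ← pow_add]
        exact pow_le_pow_right₀ hM (by nlinarith)
  set C' := C / (4 * c0) ^ (5 * K) with hC'
  have hC0 : 0 ≤ C' := by positivity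
  have h4 : 4 * (n * ((M * n1) * (n1 * C' * (M ^ n / n1) ^ (5 * K)))) ≤ 
      4 * (k * (M ^ (k+1) * (M ^ k * C' * (M ^ (2 * (5 * K)) / M ^ (5 * k))))) := by gcongr
  have e2 : 4 * (k * (M ^ (k+1) * (M ^ k * C' * (M ^ (2 * (5 * K)) / M ^ (5 * k))))) = 
     (4 * C' * M ^ (2 * (5 * K) + 1) * k) * (1 / M ^ (3 * k)) := by
    have : M ^ (5 * k) = M ^ k * M ^ k * M ^ (3 * k) := by ring
    rw [this]
    field_simp
    ring
  have h5 : (4 * C' * M ^ (2 * (5 * K) + 1) * k) * (1 / M ^ (3 * k)) < M ^ k * (1 / M ^ (3 * k)) := by gcongr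
  have e3 : M ^ k * (1 / M ^ (3 * k)) = 1 / M ^ (2 * k) := by
    have : M ^ (3 * k) = M ^ k * M ^ (2 * k) := by ring
    rw [this]; field_simp
  have h6 : 1 / M ^ (2 * k) ≤ b ^ 2 := by rw [div_le_iff₀ (by positivity)]; exact hb
  linarith
end

section
lemma ev1 (M : ℝ) (hM : 1 < M) (ε A : ℝ) (hε : 0 < ε) : ∀ᶠ k : ℕ in Filter.atTop, A ≤ M ^ (ε * k / 4) := by
  have h1 : Filter.Tendsto (fun k : ℕ => (M ^ (ε / 4)) ^ k) Filter.atTop Filter.atTop :=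
    tendsto_pow_atTop_atTop_of_one_lt (Real.one_lt_rpow hM (by positivity))
  filter_upwards [h1.eventually_ge_atTop A] with k hk
  rw [← Real.rpow_natCast, ← Real.rpow_mul (by linarith)] at hk
  have e : ε * k / 4 = ε / 4 * k := by ring
  rw [e]; exact hk

lemma ev2 (M : ℝ) (hM : 1 < M) (A : ℝ) : ∀ᶠ k : ℕ in Filter.atTop, A * k < M ^ k := by
  have h1 := tendsto_pow_const_div_const_pow_of_one_lt 1 hM
  have h2 := h1.const_mul A
  rw [mul_zero] at h2
  filter_upwards [h2.eventually_lt_const zero_lt_one] with k hk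
  have : 0 < M ^ k := by positivity
  rw [pow_one, ← mul_div_assoc, div_lt_one this] at hk
  exact hk

lemma ev3 (ε : ℝ) (hε : 0 < ε) : ∃ M₀ : ℕ, ∀ M : ℕ, M₀ ≤ M → 2 ≤ M ∧ 64 * (1 + Real.log M) ≤ (M:ℝ) ^ ε := by
  have h1 : (fun x : ℝ => Real.log x) =o[Filter.atTop] fun x : ℝ => x ^ ε := isLittleO_log_rpow_atTop hε
  have h2 := (h1.def (show (0:ℝ) < 1/128 by norm_num))
  have h3 := (tendsto_rpow_atTop hε).eventually_ge_atTop 128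
  have h4 := (tendsto_natCast_atTop_atTop (R := ℝ)).eventually (h2.and h3)
  obtain ⟨M₀, h⟩ := Filter.eventually_atTop.1 (h4.and (Filter.eventually_ge_atTop 2))
  refine ⟨M₀, fun M hM => ?_⟩
  obtain ⟨⟨ha, hb⟩, hc⟩ := h M hM
  refine ⟨hc, ?_⟩
  have : (1:ℝ) ≤ M := by exact_mod_cast (by omega : 1 ≤ M)
  rw [Real.norm_of_nonneg (Real.log_nonneg this), Real.norm_of_nonneg (by positivity)] at ha
  linarith

lemma eig_le_one {N : ℕ} (B : Matrix (Fin N) (Fin N) ℂ) (hB : ‖Matrix.toEuclideanCLM (𝕜 := ℂ) B‖ ≤ 1) (lam : ℂ) (v : Fin N → ℂ) (hv : v ≠ 0)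
    (hl : B.mulVec v = lam • v) : ‖lam‖ ≤ 1 := by
  have h1 := en_mul B v
  rw [hl, en_smul] at h1
  have h2 := en_pos v hv
  rw [Matrix.cstar_norm_def] at h1
  have : ‖lam‖ * en v ≤ 1 * en v := h1.trans (mul_le_mul_of_nonneg_right hB h2.le)
  exact le_of_mul_le_mul_right this h2

set_option maxHeartbeats 1000000 in
lemma large_case (ε : ℝ) (hε : 0 < ε) (χ : ℝ → ℝ) (hχ01 : ∀ x : ℝ, χ x ∈ Set.Icc (0 : ℝ) 1) (c0 C : ℝ) (K : ℕ)
    (hK : 20 ≤ ε * K) (hK2 : 2 ≤ K)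
    (hc0 : 0 < c0) (hc1 : c0 ≤ 1) (hc : ∀ x, χ x ≠ 0 → c0 ≤ x ∧ x ≤ 1 - c0) (hC : 0 ≤ C)
    (hdec : ∀ (n : ℕ) (y : ℝ), 0 < n → ‖∑ m ∈ Finset.range n, (χ ((m:ℝ)/n):ℂ) * ec (y*m)‖ * (4*nd y)^(5*K) ≤ C*n*(1/n)^(5*K))
    (M : ℕ) (hM : 2 ≤ M) (hM64 : 64 * (1 + Real.log M) ≤ (M:ℝ) ^ ε) (δ : ℝ) (hδ : δ ≤ 1 / 2) (hδ0 : 0 < δ) (D : ℕ)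
    (hD : (D:ℝ) = (M:ℝ) ^ δ) (k : ℕ)
    (hk1 : 4 * (7 ^ 4 * (Real.exp (2 * Real.pi)) ^ 4) * (M:ℝ) ^ 4 ≤ (M:ℝ) ^ (ε * k / 4))
    (hk2 : 4 * (C / (4 * c0) ^ (5 * K)) * (M:ℝ) ^ (2 * (5 * K) + 1) * k < (M:ℝ) ^ k)
    (n1 : ℕ) (hn1 : 0 < n1) (α : ℝ) (hα : ((M * n1 : ℕ):ℝ) = α * (M:ℝ) ^ k) (hα1 : 1 ≤ α) (hαM : α < M)
    (b : ℤ) (q : ℕ) (hq : 0 < q) (hbq : Int.gcd b q = 1) (hqD : (q : ℝ) ≤ (M : ℝ) ^ δ)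
    (hab : |α / (M : ℝ) - (b : ℝ) / (q : ℝ)| < 1 / ((q : ℝ) * (M : ℝ) ^ δ)) (lam : ℂ) (v : Fin (M * n1) → ℂ) (hv : v ≠ 0)
    (hl : (bakerMatrix (M * n1) M (Finset.range D) χ).mulVec v = lam • v) (h1 : ‖lam‖ ≤ 1) :
    ‖lam‖ ≤ (M : ℝ) ^ (-(1 / 2 - δ + (Real.log q / Real.log M) / 2) + ε) := by
  set b0 := (M : ℝ) ^ (-(1 / 2 - δ + (Real.log q / Real.log M) / 2) + ε) with hb0
  have hM0 : (0:ℝ) < M := by exact_mod_cast (by omega : 0 < M)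
  have hM1 : (1:ℝ) < M := by exact_mod_cast (by omega : 1 < M)
  have hlogM : 0 < Real.log M := Real.log_pos hM1
  have hb0p : 0 < b0 := Real.rpow_pos_of_pos hM0 _
  by_contra hcon
  push Not at hcon
  have hb01 : b0 < 1 := by linarith
  rw [← hD] at hqD hab
  have hqD' : q ≤ D := by exact_mod_cast hqD
  have hD0 : 0 < D := by omega
  have hDR : (0:ℝ) < D := by exact_mod_cast hD0
  have hD1 : (1:ℝ) ≤ D := by exact_mod_cast hD0
  have hqR : (0:ℝ) < q := by exact_mod_cast hq
  have hDD : (D:ℝ) * D ≤ M := by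
    rw [hD, ← Real.rpow_add hM0]
    calc (M:ℝ) ^ (δ + δ) ≤ (M:ℝ) ^ (1:ℝ) := Real.rpow_le_rpow_of_exponent_le hM1.le (by linarith)
      _ = M := Real.rpow_one _
  have hDD' : D * D ≤ M := by exact_mod_cast hDD
  set G := (M:ℝ) ^ ε with hG
  have hG1 : 1 ≤ G := Real.one_le_rpow hM1.le hε.le
  set W : ℝ := (D:ℝ)^2 / q with hW
  have hW1 : 1 ≤ W := by
    rw [hW, le_div_iff₀ hqR]; nlinarith
  set V := 16 * ((D:ℝ)^2/q*(1+Real.log D)) with hV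
  have hlogD : 0 ≤ Real.log D := Real.log_nonneg hD1
  have hlogDM : Real.log D ≤ Real.log M := by
    apply Real.log_le_log hDR; nlinarith
  have hV0 : 0 ≤ V := by positivity
  have hVW : 4 * V ≤ W * G := by
    have : 4 * V = W * (64 * (1 + Real.log D)) := by rw [hV, hW]; ring
    rw [this]
    gcongr
    linarith
  have hb0sq : b0 ^ 2 = G ^ 2 * W / M := by
    have hq' : (q:ℝ) = (M:ℝ) ^ (Real.log q / Real.log M) := by
      rw [Real.rpow_def_of_pos hM0, mul_div_cancel₀ _ hlogM.ne', Real.exp_log hqR]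
    have e1 : b0 ^ 2 = (M:ℝ) ^ (2 * ε + 2 * δ - Real.log q / Real.log M - 1) := by
      rw [hb0, ← Real.rpow_natCast, ← Real.rpow_mul hM0.le]; congr 1; push_cast; ring
    rw [e1, Real.rpow_sub hM0, Real.rpow_sub hM0, Real.rpow_add hM0, ← hq', Real.rpow_one, hW, hD, hG,
      ← Real.rpow_natCast, ← Real.rpow_natCast, ← Real.rpow_mul hM0.le, ← Real.rpow_mul hM0.le]
    rw [mul_comm ε, mul_comm δ]
    push_cast
    ring
  set g := k / K with hg
  have hgk : K * g ≤ k := Nat.mul_div_le k K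
  have h2g : 2 * g ≤ k := by nlinarith
  have hgK : k ≤ K * g + K := by
    have := Nat.div_add_mod k K
    have := Nat.mod_lt k (by omega : 0 < K)
    rw [← hg] at *
    omega
  obtain ⟨m, hm⟩ : ∃ m, k = m + 2 * g := ⟨k - 2 * g, by omega⟩
  set x := α * (M:ℝ) ^ g with hx
  have hMg : 1 ≤ (M:ℝ) ^ g := one_le_pow₀ hM1.le
  have hx1 : 1 ≤ x := by rw [hx]; exact one_le_mul_of_one_le_of_one_le hα1 hMg
  have hxM : x ≤ (M:ℝ) ^ (g+1) := by rw [hx, pow_succ, mul_comm]; gcongr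
  have hxN : x * (M:ℝ) ^ (m+g) = (M * n1 : ℕ) := by
    rw [hα, hx, hm]; ring
  have hβ : x * x / (M * n1 : ℕ) = (α / M) * M / (M:ℝ) ^ m := by
    rw [hα, hx, hm]
    have : (M:ℝ) ^ (m + 2 * g) = M ^ m * (M ^ g * M ^ g) := by ring
    rw [this]; field_simp
  have hVb := fun z => V_bound D q b (α / M) z hq hqD' hbq hab
  have key := main_ineq χ hχ01 c0 C (5 * K) hc0 hc1 hc hC hdec M n1 D m g hM hn1 hD0 hDD' (α / M) V x (by positivity)
    (by rw [div_le_one hM0]; exact hαM.le) hV0 hVb hxN hx1 hβ lam v hv hl _ _ rfl rfl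
  refine final_num (‖lam‖ ^ (m+g)) _ _ (b0 ^ (m+g)) (by positivity) (pow_le_one₀ hb0p.le hb01.le) ?_ ?_ ?_ key
  · gcongr
  · have hMk : (M:ℝ) ^ k ≤ ((M * n1 : ℕ):ℝ) := by
      rw [hα]; exact le_mul_of_one_le_left (by positivity) hα1
    refine T_le M _ x V W G D _ _ k g m hM1.le hMk (by linarith) hxM hV0 hVW hW1 hG1 hDR.le hDD (by positivity) (by omega)
      (by positivity) ?_ ?_
    · rw [← hb0sq]; ring
    · have i1 : (M:ℝ) ^ (5 * g) ≤ (M:ℝ) ^ (ε * k / 4) := by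
        rw [← Real.rpow_natCast]
        apply Real.rpow_le_rpow_of_exponent_le hM1.le
        have : (K:ℝ) * g ≤ k := by exact_mod_cast hgk
        have hg0 : (0:ℝ) ≤ g := by positivity
        push_cast
        have t1 := mul_le_mul_of_nonneg_right hK hg0
        have t2 := mul_le_mul_of_nonneg_left this hε.le
        rw [mul_assoc] at t1
        linarith
      have i2 : (M:ℝ) ^ (ε * k / 4) * (M:ℝ) ^ (ε * k / 4) ≤ G ^ (m+g) := by
        rw [← Real.rpow_add hM0, hG, ← Real.rpow_natCast, ← Real.rpow_mul hM0.le]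
        apply Real.rpow_le_rpow_of_exponent_le hM1.le
        have : (k:ℝ) ≤ 2 * ((m+g : ℕ):ℝ) := by exact_mod_cast (by omega : k ≤ 2 * (m + g))
        have t2 := mul_le_mul_of_nonneg_left this hε.le
        linarith
      refine le_trans ?_ i2
      gcongr
  · have hk2' := hk2
    have ee := eta_le M C c0 n1 k g (m+g) K hM1.le hC hc0 ?_ ?_ (by omega) hgK hk2 (b0 ^ (m+g)) ?_
    · push_cast at ee ⊢
      exact ee
    · have : (M:ℝ) * n1 = α * (M:ℝ) ^ k := by rw [← hα]; push_cast; ring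
      rw [this]; exact le_mul_of_one_le_left (by positivity) hα1
    · have : (M:ℝ) * n1 = α * (M:ℝ) ^ k := by rw [← hα]; push_cast; ring
      rw [this, pow_succ, mul_comm]; gcongr
    · have j1 : 1 ≤ b0 ^ 2 * M := by
        rw [hb0sq, div_mul_cancel₀ _ hM0.ne']
        exact one_le_mul_of_one_le_of_one_le (one_le_pow₀ hG1) hW1
      calc (1:ℝ) ≤ (b0 ^ 2 * M) ^ (m+g) := one_le_pow₀ j1
        _ = (b0 ^ (m+g)) ^ 2 * (M:ℝ) ^ (m+g) := by ring
        _ ≤ _ := by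
          gcongr
          · exact hM1.le
          · omega
end

/-- Spectral gap for open quantum baker's maps. -/
theorem stmt2 (ε : ℝ) (hε : 0 < ε) (χ : ℝ → ℝ) (hχ : ContDiff ℝ (⊤ : ℕ∞) χ)
    (hχc : HasCompactSupport χ) (hχsupp : tsupport χ ⊆ Set.Ioo 0 1)
    (hχ01 : ∀ x : ℝ, χ x ∈ Set.Icc (0 : ℝ) 1) :
    ∃ M₀ : ℕ, ∀ M : ℕ, M₀ ≤ M → ∀ δ : ℝ, 0 < δ → δ ≤ 1 / 2 →
      ∀ D : ℕ, (D : ℝ) = (M : ℝ) ^ δ →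
      ∃ r : ℕ → ℝ, Filter.Tendsto r Filter.atTop (nhds 0) ∧
        ∀ N : ℕ, M ∣ N → ∀ (α : ℚ) (k : ℕ), (N : ℚ) = α * (M : ℚ) ^ k → 1 ≤ α → α < (M : ℚ) →
          ∀ (b : ℤ) (q : ℕ), 0 < q → Int.gcd b q = 1 → (q : ℝ) ≤ (M : ℝ) ^ δ →
            |(α : ℝ) / (M : ℝ) - (b : ℝ) / (q : ℝ)| < 1 / ((q : ℝ) * (M : ℝ) ^ δ) →
            ∀ lam : ℂ,
              (∃ v : Fin N → ℂ, v ≠ 0 ∧ (bakerMatrix N M (Finset.range D) χ).mulVec v = lam • v) →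
              ‖lam‖ ≤
                (M : ℝ) ^ (-(1 / 2 - δ + (Real.log q / Real.log M) / 2) + ε) + r N := by
  obtain ⟨M₀, hM₀⟩ := ev3 ε hε
  obtain ⟨c0, hc0, hc1, hc⟩ := supp_margin χ hχc hχsupp
  obtain ⟨K0, hK0⟩ := exists_nat_ge (20 / ε)
  set K := max K0 2 with hKdef
  have hK : 20 ≤ ε * K := by
    have : (K0:ℝ) ≤ K := by exact_mod_cast le_max_left _ _
    rw [mul_comm, ← div_le_iff₀ hε]; linarith
  have hK2 : 2 ≤ K := le_max_right _ _
  obtain ⟨C, hC, hdec⟩ := decay χ hχ hχc hχsupp (5 * K)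
  refine ⟨M₀, fun M hM δ hδ0 hδ D hD => ?_⟩
  obtain ⟨hM2, hM64⟩ := hM₀ M hM
  have hM0 : (0:ℝ) < M := by exact_mod_cast (by omega : 0 < M)
  have hM1 : (1:ℝ) < M := by exact_mod_cast (by omega : 1 < M)
  have hev := (ev1 M hM1 ε (4 * (7 ^ 4 * (Real.exp (2 * Real.pi)) ^ 4) * (M:ℝ) ^ 4) hε).and
    (ev2 M hM1 (4 * (C / (4 * c0) ^ (5 * K)) * (M:ℝ) ^ (2 * (5 * K) + 1)))
  obtain ⟨k0, hk0⟩ := Filter.eventually_atTop.1 hev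
  refine ⟨fun N => if N < M ^ (k0 + 1) then 1 else 0, ?_, ?_⟩
  · refine Filter.Tendsto.congr' ?_ tendsto_const_nhds
    filter_upwards [Filter.eventually_ge_atTop (M ^ (k0 + 1))] with N hN
    rw [if_neg (by omega)]
  intro N hMN α k hN hα1 hαM b q hq hbq hqD hab lam ⟨v, hv, hl⟩
  obtain ⟨n1, rfl⟩ := hMN
  have hα1' : (1:ℝ) ≤ (α:ℝ) := by exact_mod_cast hα1
  have hαM' : (α:ℝ) < M := by exact_mod_cast hαM
  have hN' : ((M * n1 : ℕ):ℝ) = (α:ℝ) * (M:ℝ) ^ k := by exact_mod_cast congrArg (fun z : ℚ => (z:ℝ)) hN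
  have hNpos : 0 < M * n1 := by
    have : (0:ℝ) < ((M * n1 : ℕ):ℝ) := by rw [hN']; positivity
    exact_mod_cast this
  have hn1 : 0 < n1 := Nat.pos_of_mul_pos_left hNpos
  have hB := baker_norm (M * n1) M hNpos (Dvd.intro _ rfl) (Finset.range D) χ hχ01
  have hlam := eig_le_one _ hB lam v hv hl
  have hb0 : 0 ≤ (M : ℝ) ^ (-(1 / 2 - δ + (Real.log q / Real.log M) / 2) + ε) := by positivity
  by_cases hsmall : M * n1 < M ^ (k0 + 1)
  · simp only [if_pos hsmall]; linarith
  · simp only [if_neg hsmall, add_zero]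
    have hkk : k0 ≤ k := by
      by_contra hcon
      apply hsmall
      have h1 : ((M * n1 : ℕ):ℝ) < ((M ^ (k0 + 1) : ℕ):ℝ) := by
        rw [hN']
        push_cast
        calc (α:ℝ) * (M:ℝ) ^ k < M * (M:ℝ) ^ k := by gcongr
          _ = (M:ℝ) ^ (k + 1) := by ring
          _ ≤ (M:ℝ) ^ (k0 + 1) := pow_le_pow_right₀ hM1.le (by omega)
      exact_mod_cast h1
    obtain ⟨hk1, hk2⟩ := hk0 k hkk
    exact large_case ε hε χ hχ01 c0 C K hK hK2 hc0 hc1 hc hC hdec M hM2 hM64 δ hδ hδ0 D hD k hk1 hk2 n1 hn1 α hN' hα1' hαM'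
      b q hq hbq hqD hab lam v hv hl hlam

end
end

section
/- Let M, k ∈ ℕ with M ≥ 2, k ≥ 1, let A ⊆ {0,…,M−1}, and let f : ℤ → ℂ be supported in A. With u_k ∈ ℂ^{M^k} the iterated cyclic convolution u_k = f * f_M * f_{M²} * ⋯ * f_{M^{k−1}} (and u_1 = f), one has ‖u_k‖² = ‖f‖^{2k}, i.e. Σ_{n=0}^{M^k−1} |u_k(n)|² = (Σ_{l∈ℤ} |f(l)|²)^k. -/
open scoped Classical

noncomputable section

/-- The 1-periodic function `G_f(x) = M^{-1/2} Σ_{l ∈ ℤ} f(l) e^{-2πi l x}`. -/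
def Gf (M : ℕ) (f : ℤ → ℂ) (x : ℝ) : ℂ :=
  ((Real.sqrt M)⁻¹ : ℝ) * ∑' l : ℤ, f l * ec ((l : ℝ) * x)

/-- Cyclic convolution on `ℂ^N`: `(f*h)(n) = Σ_{n₁+n₂ = n mod N} f(n₁) h(n₂)`. -/
def cconv {N : ℕ} (f h : Fin N → ℂ) : Fin N → ℂ := fun n => ∑ m : Fin N, f m * h (n - m)

/-- The function `f_{M^j} ∈ ℂ^{M^k}` (here `Nn = M^k`, `p = M^j`):
`f_{M^j}(n) = f(n/M^j)` if `M^j ∣ n` and `n/M^j ∈ A`, and `0` otherwise. -/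
def dilate (Nn p : ℕ) (A : Finset ℕ) (f : ℤ → ℂ) : Fin Nn → ℂ := fun n =>
  if p ∣ (n : ℕ) ∧ (n : ℕ) / p ∈ A then f (((n : ℕ) / p : ℕ) : ℤ) else 0

/-- The iterated cyclic convolution `u_k = f * f_M * f_{M²} * ⋯ * f_{M^{k-1}} ∈ ℂ^{M^k}`
(for `f` supported in `A ⊆ {0,…,M-1}`, the factor `f_{M^0}` equals `f`). -/
def uFun (M k : ℕ) (A : Finset ℕ) (f : ℤ → ℂ) : Fin (M ^ k) → ℂ :=
  (List.range k).foldr (fun j acc => cconv (dilate (M ^ k) (M ^ j) A f) acc)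
    (fun n => if (n : ℕ) = 0 then 1 else 0)

theorem cconv_norm_sq {N : ℕ} [NeZero N] (d h : Fin N → ℂ)
    (H : ∀ n m m' : Fin N, d m ≠ 0 → h (n - m) ≠ 0 → d m' ≠ 0 → h (n - m') ≠ 0 → m = m') :
    ∑ n, ‖cconv d h n‖ ^ 2 = (∑ m, ‖d m‖ ^ 2) * ∑ n, ‖h n‖ ^ 2 := by
  have h1 : ∀ n, ‖cconv d h n‖ ^ 2 = ∑ m, ‖d m‖ ^ 2 * ‖h (n - m)‖ ^ 2 := by
    intro n
    unfold cconv
    by_cases hex : ∃ m, d m ≠ 0 ∧ h (n - m) ≠ 0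
    · obtain ⟨m, hm, hm'⟩ := hex
      have key : ∀ b, b ≠ m → d b = 0 ∨ h (n - b) = 0 := by
        intro b hb
        by_contra hc
        rw [not_or] at hc
        exact hb (H n b m hc.1 hc.2 hm hm')
      rw [Finset.sum_eq_single m, Finset.sum_eq_single m]
      · rw [norm_mul, mul_pow]
      · intro b _ hb
        rcases key b hb with h | h <;> simp [h]
      · simp
      · intro b _ hb
        rcases key b hb with h | h <;> simp [h]
      · simp
    · have key : ∀ b, d b = 0 ∨ h (n - b) = 0 := by
        intro b
        by_contra hc
        rw [not_or] at hc
        exact hex ⟨b, hc⟩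
      rw [Finset.sum_eq_zero, Finset.sum_eq_zero]
      · simp
      · intro b _
        rcases key b with h | h <;> simp [h]
      · intro b _
        rcases key b with h | h <;> simp [h]
  simp_rw [h1]
  rw [Finset.sum_comm, Finset.sum_mul]
  refine Finset.sum_congr rfl fun m _ => ?_
  rw [← Finset.mul_sum]
  congr 1
  exact Fintype.sum_equiv (Equiv.subRight m) _ _ (fun _ => rfl)

theorem fin_sub_modEq {N P : ℕ} [NeZero N] (hP : P ∣ N) (n m : Fin N) :
    ((n - m : Fin N) : ℕ) + m ≡ n [MOD P] := by
  have h : (((n - m) + m : Fin N) : ℕ) = n := by rw [sub_add_cancel]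
  rw [Fin.val_add] at h
  have h2 : ((n - m : Fin N) : ℕ) + m ≡ n [MOD N] := by
    rw [← h]
    exact (Nat.mod_modEq _ _).symm
  exact h2.of_dvd hP

theorem dilate_ne {N p : ℕ} {A : Finset ℕ} {f : ℤ → ℂ} {n : Fin N}
    (h : dilate N p A f n ≠ 0) : p ∣ (n : ℕ) ∧ (n : ℕ) / p ∈ A := by
  unfold dilate at h
  by_contra hc
  exact h (if_neg hc)

theorem dilate_norm (M k j : ℕ) (hM : 2 ≤ M) (hj : j < k) (A : Finset ℕ)
    (hA : A ⊆ Finset.range M) (f : ℤ → ℂ) (hf : ∀ l : ℤ, f l ≠ 0 → ∃ a ∈ A, l = (a : ℤ)) :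
    ∑ n, ‖dilate (M ^ k) (M ^ j) A f n‖ ^ 2 = ∑' l : ℤ, ‖f l‖ ^ 2 := by
  have hp : 0 < M ^ j := by positivity
  have hN : M ^ (j + 1) ≤ M ^ k := Nat.pow_le_pow_right (by omega) hj
  have h1 : ∑' l : ℤ, ‖f l‖ ^ 2 = ∑ a ∈ A, ‖f (a : ℤ)‖ ^ 2 := by
    rw [tsum_eq_sum (s := A.map ⟨fun a : ℕ => (a : ℤ), Nat.cast_injective⟩), Finset.sum_map]
    · rfl
    · intro b hb
      by_contra hc
      have : f b ≠ 0 := fun h => hc (by simp [h])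
      obtain ⟨a, ha, rfl⟩ := hf b this
      exact hb (by simpa using ha)
  rw [h1]
  symm
  have hlt : ∀ a ∈ A, M ^ j * a < M ^ k := by
    intro a ha
    have := Finset.mem_range.1 (hA ha)
    calc M ^ j * a < M ^ j * M := by gcongr
      _ ≤ M ^ k := by rw [← pow_succ]; exact hN
  haveI : NeZero (M ^ k) := ⟨by positivity⟩
  refine Finset.sum_of_injOn (fun a => Fin.ofNat (M ^ k) (M ^ j * a)) ?_ (by simp [Set.MapsTo]) ?_ ?_
  · intro a ha b hb hab
    have := congrArg Fin.val hab
    simp only [Fin.val_ofNat] at this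
    rw [Nat.mod_eq_of_lt (hlt a ha), Nat.mod_eq_of_lt (hlt b hb)] at this
    exact Nat.eq_of_mul_eq_mul_left hp this
  · intro n _ hn
    by_contra hc
    have h0 : dilate (M ^ k) (M ^ j) A f n ≠ 0 := fun h => hc (by simp [h])
    obtain ⟨h2, h3⟩ := dilate_ne h0
    refine hn ⟨_, h3, ?_⟩
    apply Fin.ext
    simp only [Fin.val_ofNat]
    rw [Nat.mul_div_cancel' h2, Nat.mod_eq_of_lt n.2]
  · intro a ha
    have hv : ((Fin.ofNat (M ^ k) (M ^ j * a) : Fin (M ^ k)) : ℕ) = M ^ j * a := by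
      simp only [Fin.val_ofNat]
      exact Nat.mod_eq_of_lt (hlt a ha)
    simp only [dilate, hv, Nat.mul_div_cancel_left a hp]
    simp [ha]

theorem main_aux (M k : ℕ) (hM : 2 ≤ M) (A : Finset ℕ) (hA : A ⊆ Finset.range M)
    (f : ℤ → ℂ) (hf : ∀ l : ℤ, f l ≠ 0 → ∃ a ∈ A, l = (a : ℤ)) (r : ℕ) :
    ∀ (j : ℕ), j + r = k → ∀ u : Fin (M ^ k) → ℂ,
    u = (List.range' j r).foldr (fun j acc => cconv (dilate (M ^ k) (M ^ j) A f) acc)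
      (fun n => if (n : ℕ) = 0 then 1 else 0) →
    (∀ n, u n ≠ 0 → M ^ j ∣ (n : ℕ)) ∧ ∑ n, ‖u n‖ ^ 2 = (∑' l : ℤ, ‖f l‖ ^ 2) ^ r := by
  haveI : NeZero (M ^ k) := ⟨by positivity⟩
  induction r with
  | zero =>
    intro j hj u hu
    simp only [List.range'_zero, List.foldr_nil] at hu
    subst hu
    constructor
    · intro n hn
      have : (n : ℕ) = 0 := by
        by_contra hc
        exact hn (if_neg hc)
      simp [this]
    · rw [Finset.sum_eq_single 0]
      · simp
      · intro b _ hb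
        have : (b : ℕ) ≠ 0 := fun h => hb (Fin.ext (by simpa using h))
        simp [this]
      · simp
  | succ r ih =>
    intro j hj u hu
    rw [List.range'_succ, List.foldr_cons] at hu
    obtain ⟨ih1, ih2⟩ := ih (j + 1) (by omega) _ rfl
    set v := (List.range' (j + 1) r).foldr
      (fun j acc => cconv (dilate (M ^ k) (M ^ j) A f) acc)
      (fun n : Fin (M ^ k) => if (n : ℕ) = 0 then (1 : ℂ) else 0) with hv
    have hP : M ^ (j + 1) ∣ M ^ k := pow_dvd_pow _ (by omega)
    have hQ : M ^ j ∣ M ^ k := pow_dvd_pow _ (by omega)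
    subst hu
    constructor
    · intro n hn
      obtain ⟨m, -, hm⟩ := Finset.exists_ne_zero_of_sum_ne_zero hn
      have h1 := (dilate_ne (left_ne_zero_of_mul hm)).1
      have h2 := (pow_dvd_pow M (Nat.le_succ j)).trans (ih1 _ (right_ne_zero_of_mul hm))
      exact ((fin_sub_modEq hQ n m).dvd_iff dvd_rfl).1 (dvd_add h2 h1)
    · rw [cconv_norm_sq, ih2, dilate_norm M k j hM (by omega) A hA f hf, pow_succ']
      intro n m m' a b c d
      have key : ∀ m : Fin (M ^ k), dilate (M ^ k) (M ^ j) A f m ≠ 0 → v (n - m) ≠ 0 →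
          (m : ℕ) = n % M ^ (j + 1) := by
        intro m hm hvm
        obtain ⟨h1, h2⟩ := dilate_ne hm
        have h3 := Finset.mem_range.1 (hA h2)
        have h4 : (m : ℕ) < M ^ (j + 1) := by
          rw [pow_succ']
          exact (Nat.div_lt_iff_lt_mul (by positivity)).1 h3
        have h5 := fin_sub_modEq hP n m
        obtain ⟨t, ht⟩ := ih1 _ hvm
        rw [ht] at h5
        have h6 : (M ^ (j + 1) * t + m) % M ^ (j + 1) = n % M ^ (j + 1) := h5
        rw [Nat.mul_add_mod, Nat.mod_eq_of_lt h4] at h6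
        exact h6
      exact Fin.ext ((key m a b).trans (key m' c d).symm)

/-- `‖u_k‖² = ‖f‖^{2k}`. -/
theorem stmt6 (M k : ℕ) (hM : 2 ≤ M) (hk : 1 ≤ k) (A : Finset ℕ) (hA : A ⊆ Finset.range M)
    (f : ℤ → ℂ) (hf : ∀ l : ℤ, f l ≠ 0 → ∃ a ∈ A, l = (a : ℤ)) :
    ∑ n : Fin (M ^ k), ‖uFun M k A f n‖ ^ 2 =
      (∑' l : ℤ, ‖f l‖ ^ 2) ^ k := by
  refine (main_aux M k hM A hA f hf k 0 (by omega) _ ?_).2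
  rw [← List.range_eq_range']
  rfl

end
end

section
/- Let M, k ∈ ℕ with M ≥ 2, k ≥ 1, let A ⊆ {0,…,M−1} be nonempty, and let f : ℤ → ℂ be supported in A. With u_k ∈ ℂ^{M^k} the iterated cyclic convolution u_k = f * f_M * ⋯ * f_{M^{k−1}} (and u_1 = f), one has ‖𝟙_{C_k} F_{M^k} u_k‖² ≥ (Z_A(f))^k, where Z_A(f) = min over y ∈ [0, 1/M] of Σ_{a∈A} |G_f(a/M + y)|². -/
open scoped Classical

noncomputable section

/-- `Z_A(f) = min_{y ∈ [0,1/M]} Σ_{a ∈ A} |G_f(a/M + y)|²`. -/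
def ZA (M : ℕ) (A : Finset ℕ) (f : ℤ → ℂ) : ℝ :=
  sInf ((fun y => ∑ a ∈ A, ‖Gf M f ((a : ℝ) / (M : ℝ) + y)‖ ^ 2) ''
    Set.Icc 0 (1 / (M : ℝ)))

lemma ec_nat (n : ℕ) : ec (n : ℝ) = 1 := by
  unfold ec
  rw [Complex.exp_eq_one_iff]
  refine ⟨-(n : ℤ), ?_⟩
  push_cast
  ring

lemma ec_add_nat (x : ℝ) (n : ℕ) : ec (x + n) = ec x := by
  rw [ec_add, ec_nat, mul_one]

lemma ec_mod (N j n : ℕ) (hN : 0 < N) :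
    ec ((j : ℝ) * ((n % N : ℕ) : ℝ) / N) = ec ((j : ℝ) * (n : ℝ) / N) := by
  have h : (n : ℝ) = ((n % N : ℕ) : ℝ) + N * ((n / N : ℕ) : ℝ) := by
    exact_mod_cast (Nat.mod_add_div n N).symm
  have hN' : (N : ℝ) ≠ 0 := by positivity
  have : (j : ℝ) * (n : ℝ) / N
      = (j : ℝ) * ((n % N : ℕ) : ℝ) / N + ((j * (n / N) : ℕ) : ℝ) := by
    rw [h]
    push_cast
    field_simp
  rw [this, ec_add_nat]

lemma Gf_eq (M : ℕ) (A : Finset ℕ) (f : ℤ → ℂ)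
    (hf : ∀ l : ℤ, f l ≠ 0 → ∃ a ∈ A, l = (a : ℤ)) (x : ℝ) :
    Gf M f x = ((Real.sqrt M)⁻¹ : ℝ) * ∑ a ∈ A, f (a : ℤ) * ec ((a : ℝ) * x) := by
  unfold Gf
  congr 1
  rw [tsum_eq_sum (s := A.map Nat.castEmbedding)]
  · simp
  · intro b hb
    by_cases h : f b = 0
    · simp [h]
    · obtain ⟨a, ha, rfl⟩ := hf b h
      exact absurd (by simpa using ha) hb

lemma Gf_add_nat (M : ℕ) (A : Finset ℕ) (f : ℤ → ℂ)
    (hf : ∀ l : ℤ, f l ≠ 0 → ∃ a ∈ A, l = (a : ℤ)) (x : ℝ) (n : ℕ) :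
    Gf M f (x + n) = Gf M f x := by
  rw [Gf_eq M A f hf, Gf_eq M A f hf]
  congr 1
  refine Finset.sum_congr rfl fun a _ => ?_
  rw [mul_add, ← Nat.cast_mul, ec_add_nat]

/-- unnormalised transform -/
def DD (N : ℕ) (u : Fin N → ℂ) (j : ℕ) : ℂ :=
  ∑ l : Fin N, ec ((j : ℝ) * ((l : ℕ) : ℝ) / (N : ℝ)) * u l

lemma DD_cconv (N : ℕ) (hN : 0 < N) (f h : Fin N → ℂ) (j : ℕ) :
    DD N (cconv f h) j = DD N f j * DD N h j := by
  have : NeZero N := ⟨hN.ne'⟩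
  unfold DD cconv
  rw [Finset.sum_mul]
  simp only [Finset.mul_sum]
  rw [Finset.sum_comm]
  refine Finset.sum_congr rfl fun m _ => ?_
  refine Fintype.sum_equiv (Equiv.subRight m) _ _ fun n => ?_
  simp only [Equiv.subRight_apply]
  have : ec ((j : ℝ) * ((n : ℕ) : ℝ) / (N : ℝ)) =
      ec ((j : ℝ) * ((m : ℕ) : ℝ) / (N : ℝ)) * ec ((j : ℝ) * (((n - m : Fin N) : ℕ) : ℝ) / (N : ℝ)) := by
    have h1 : ((n : ℕ)) = (((n - m : Fin N) : ℕ) + (m : ℕ)) % N := by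
      conv_lhs => rw [← sub_add_cancel n m]
      rw [Fin.val_add]
    conv_lhs => rw [h1]
    rw [ec_mod _ _ _ hN, ← ec_add]
    congr 1
    push_cast
    ring
  rw [this]
  ring

lemma DD_delta (N : ℕ) (hN : 0 < N) (j : ℕ) :
    DD N (fun n => if (n : ℕ) = 0 then 1 else 0) j = 1 := by
  unfold DD
  rw [Finset.sum_eq_single (⟨0, hN⟩ : Fin N)]
  · simp [ec_zero]
  · intro b _ hb
    have : (b : ℕ) ≠ 0 := fun h => hb (Fin.ext h)
    simp [this]
  · simp

lemma DD_dilate (N p : ℕ) (hp : 0 < p) (A : Finset ℕ) (f : ℤ → ℂ)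
    (hA : ∀ a ∈ A, a * p < N) (j : ℕ) :
    DD N (dilate N p A f) j = ∑ a ∈ A, f (a : ℤ) * ec ((a : ℝ) * ((j : ℝ) * p / N)) := by
  unfold DD dilate
  rw [Fin.sum_univ_eq_sum_range (fun n : ℕ => ec ((j : ℝ) * (n : ℝ) / (N : ℝ)) *
    (if p ∣ n ∧ n / p ∈ A then f ((n / p : ℕ) : ℤ) else 0)) N]
  simp only [mul_ite, mul_zero]
  rw [← Finset.sum_filter]
  symm
  refine Finset.sum_bij (fun a _ => a * p) ?_ ?_ ?_ ?_
  · intro a ha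
    simp only [Finset.mem_filter, Finset.mem_range]
    exact ⟨hA a ha, dvd_mul_left _ _, by rwa [Nat.mul_div_cancel _ hp]⟩
  · intro a _ b _ h
    exact Nat.eq_of_mul_eq_mul_right hp h
  · intro b hb
    simp only [Finset.mem_filter, Finset.mem_range] at hb
    exact ⟨b / p, hb.2.2, Nat.div_mul_cancel hb.2.1⟩
  · intro a _
    rw [Nat.mul_div_cancel _ hp, mul_comm]
    congr 2
    push_cast
    ring

lemma DD_foldr (N : ℕ) (hN : 0 < N) (F : ℕ → Fin N → ℂ) (j : ℕ) (L : List ℕ) :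
    DD N (L.foldr (fun s acc => cconv (F s) acc)
      (fun n => if (n : ℕ) = 0 then 1 else 0)) j = (L.map fun s => DD N (F s) j).prod := by
  induction L with
  | nil => simpa using DD_delta N hN j
  | cons a L ih =>
    rw [List.foldr_cons, DD_cconv N hN, ih, List.map_cons, List.prod_cons]

lemma transform_eq (M k : ℕ) (hM : 2 ≤ M) (A : Finset ℕ) (hA : A ⊆ Finset.range M)
    (f : ℤ → ℂ) (hf : ∀ l : ℤ, f l ≠ 0 → ∃ a ∈ A, l = (a : ℤ)) (j : Fin (M ^ k)) :
    (dftMatrix (M ^ k)).mulVec (uFun M k A f) j =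
      ∏ s ∈ Finset.range k, Gf M f (((j : ℕ) : ℝ) / (M : ℝ) ^ (s + 1)) := by
  have hM0 : 0 < M := by omega
  have h1 : (dftMatrix (M ^ k)).mulVec (uFun M k A f) j =
      ((Real.sqrt ((M ^ k : ℕ) : ℝ))⁻¹ : ℝ) * DD (M ^ k) (uFun M k A f) j := by
    unfold DD dftMatrix
    simp only [Matrix.mulVec, dotProduct, Matrix.of_apply]
    rw [Finset.mul_sum]
    refine Finset.sum_congr rfl fun l _ => ?_
    rw [mul_assoc]
  rw [h1]
  unfold uFun
  rw [DD_foldr _ (by positivity) (fun s => dilate (M ^ k) (M ^ s) A f),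
    ← List.prod_toFinset _ List.nodup_range, List.toFinset_range]
  rw [← Finset.prod_range_reflect (fun s => Gf M f (((j : ℕ) : ℝ) / (M : ℝ) ^ (s + 1)))]
  have h2 : (((Real.sqrt ((M ^ k : ℕ) : ℝ))⁻¹ : ℝ) : ℂ) =
      ∏ s ∈ Finset.range k, (((Real.sqrt M)⁻¹ : ℝ) : ℂ) := by
    rw [Finset.prod_const, Finset.card_range, ← Complex.ofReal_pow, inv_pow]
    congr 2
    rw [Real.sqrt_eq_iff_mul_self_eq (by positivity) (by positivity), ← mul_pow,
      Real.mul_self_sqrt (by positivity)]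
    push_cast
    rfl
  rw [h2, ← Finset.prod_mul_distrib]
  refine Finset.prod_congr rfl fun s hs => ?_
  have hs := Finset.mem_range.1 hs
  rw [Gf_eq M A f hf, DD_dilate _ _ (by positivity)]
  · have : ((j : ℕ) : ℝ) * ((M ^ s : ℕ) : ℝ) / ((M ^ k : ℕ) : ℝ) =
        ((j : ℕ) : ℝ) / (M : ℝ) ^ (k - 1 - s + 1) := by
      have hk : k = (k - 1 - s + 1) + s := by omega
      have hM' : (M : ℝ) ≠ 0 := by positivity
      have : ((M ^ k : ℕ) : ℝ) = (M : ℝ) ^ (k - 1 - s + 1) * (M : ℝ) ^ s := by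
        rw [← pow_add, ← hk]
        push_cast
        rfl
      rw [this]
      push_cast
      rw [mul_div_mul_right _ _ (by positivity)]
    rw [this]
  · intro a ha
    have ha := Finset.mem_range.1 (hA ha)
    calc a * M ^ s < M * M ^ s := Nat.mul_lt_mul_of_pos_right ha (by positivity)
      _ = M ^ (s + 1) := by ring
      _ ≤ M ^ k := Nat.pow_le_pow_right hM0 (by omega)

lemma cantorC_succ (M k : ℕ) (A : Finset ℕ) :
    cantorC M (k + 1) A = (cantorC M k A ×ˢ A).image fun p => p.1 + p.2 * M ^ k := by
  ext n
  simp only [cantorC, Finset.mem_image, Fintype.mem_piFinset, Finset.mem_product, Prod.exists]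
  constructor
  · rintro ⟨a, ha, rfl⟩
    refine ⟨_, a (Fin.last k), ⟨⟨fun i => a i.castSucc, fun i => ha _, rfl⟩, ha _⟩, ?_⟩
    rw [Fin.sum_univ_castSucc]
    simp
  · rintro ⟨_, b, ⟨⟨a, ha, rfl⟩, hb⟩, rfl⟩
    refine ⟨Fin.snoc (α := fun _ => ℕ) a b, ?_, ?_⟩
    · intro i
      refine Fin.lastCases ?_ (fun i => ?_) i
      · simpa using hb
      · simpa using ha i
    · rw [Fin.sum_univ_castSucc]
      simp

lemma cantorC_lt (M k : ℕ) (A : Finset ℕ) (hA : A ⊆ Finset.range M) :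
    ∀ n ∈ cantorC M k A, n < M ^ k := by
  induction k with
  | zero => simp [cantorC]
  | succ k ih =>
    intro n hn
    rw [cantorC_succ] at hn
    simp only [Finset.mem_image, Finset.mem_product, Prod.exists] at hn
    obtain ⟨m, a, ⟨hm, ha⟩, rfl⟩ := hn
    have h1 := ih m hm
    have h2 : a + 1 ≤ M := Finset.mem_range.1 (hA ha)
    calc m + a * M ^ k < M ^ k + a * M ^ k := by omega
      _ = (a + 1) * M ^ k := by ring
      _ ≤ M * M ^ k := Nat.mul_le_mul_right _ h2
      _ = M ^ (k + 1) := by ring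

lemma ZA_nonneg (M : ℕ) (A : Finset ℕ) (f : ℤ → ℂ) : 0 ≤ ZA M A f := by
  refine Real.sInf_nonneg ?_
  rintro _ ⟨y, _, rfl⟩
  positivity

lemma ZA_le (M : ℕ) (A : Finset ℕ) (f : ℤ → ℂ) (y : ℝ) (hy : y ∈ Set.Icc 0 (1 / (M : ℝ))) :
    ZA M A f ≤ ∑ a ∈ A, ‖Gf M f ((a : ℝ) / (M : ℝ) + y)‖ ^ 2 := by
  refine csInf_le ⟨0, ?_⟩ ⟨y, hy, rfl⟩
  rintro _ ⟨y, _, rfl⟩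
  positivity

lemma main_sum (M : ℕ) (hM : 2 ≤ M) (A : Finset ℕ) (hA : A ⊆ Finset.range M)
    (f : ℤ → ℂ) (hf : ∀ l : ℤ, f l ≠ 0 → ∃ a ∈ A, l = (a : ℤ)) (k : ℕ) :
    ZA M A f ^ k ≤ ∑ n ∈ cantorC M k A,
      ∏ s ∈ Finset.range k, ‖Gf M f ((n : ℝ) / (M : ℝ) ^ (s + 1))‖ ^ 2 := by
  have hM' : (0 : ℝ) < M := by
    have : 0 < M := by omega
    exact_mod_cast this
  induction k with
  | zero => simp [cantorC]
  | succ k ih =>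
    rw [cantorC_succ, Finset.sum_image, Finset.sum_product]
    · rw [pow_succ]
      refine (mul_le_mul_of_nonneg_right ih (ZA_nonneg M A f)).trans ?_
      rw [Finset.sum_mul]
      refine Finset.sum_le_sum fun n hn => ?_
      have hlt : (n : ℝ) ≤ (M : ℝ) ^ k := by exact_mod_cast (cantorC_lt M k A hA n hn).le
      have hy : (n : ℝ) / (M : ℝ) ^ (k + 1) ∈ Set.Icc 0 (1 / (M : ℝ)) := by
        refine ⟨by positivity, ?_⟩
        rw [div_le_div_iff₀ (by positivity) (by positivity), pow_succ, one_mul]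
        exact mul_le_mul_of_nonneg_right hlt hM'.le
      refine (mul_le_mul_of_nonneg_left (ZA_le M A f _ hy) (by positivity)).trans ?_
      rw [Finset.mul_sum]
      refine (Finset.sum_congr rfl fun a _ => ?_).le
      rw [Finset.prod_range_succ]
      congr 1
      · refine Finset.prod_congr rfl fun s hs => ?_
        have hs := Finset.mem_range.1 hs
        have : ((n + a * M ^ k : ℕ) : ℝ) / (M : ℝ) ^ (s + 1) =
            (n : ℝ) / (M : ℝ) ^ (s + 1) + ((a * M ^ (k - (s + 1)) : ℕ) : ℝ) := by
          have hk : (M : ℝ) ^ k = (M : ℝ) ^ (k - (s + 1)) * (M : ℝ) ^ (s + 1) := by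
            rw [← pow_add]
            congr 1
            omega
          push_cast
          rw [hk]
          field_simp
        rw [this, Gf_add_nat M A f hf]
      · congr 3
        push_cast
        field_simp
        ring
    · rintro ⟨n, a⟩ h ⟨m, b⟩ h' e
      simp only [Finset.coe_product, Set.mem_prod, Finset.mem_coe] at h h'
      have h1 := cantorC_lt M k A hA n h.1
      have h2 := cantorC_lt M k A hA m h'.1
      have e : n + a * M ^ k = m + b * M ^ k := e
      have hnm : n = m := by
        have := congrArg (· % M ^ k) e
        simpa [Nat.mod_eq_of_lt h1, Nat.mod_eq_of_lt h2] using this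
      subst hnm
      have : a * M ^ k = b * M ^ k := by omega
      have := Nat.eq_of_mul_eq_mul_right (by positivity) this
      rw [this]

/-- `‖𝟙_{C_k} F_{M^k} u_k‖² ≥ (Z_A(f))^k`. -/
theorem stmt7 (M k : ℕ) (hM : 2 ≤ M) (hk : 1 ≤ k) (A : Finset ℕ) (hA : A ⊆ Finset.range M)
    (hA0 : A.Nonempty) (f : ℤ → ℂ) (hf : ∀ l : ℤ, f l ≠ 0 → ∃ a ∈ A, l = (a : ℤ)) :
    ZA M A f ^ k ≤
      ∑ j : Fin (M ^ k), (if (j : ℕ) ∈ cantorC M k A then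
        ‖(dftMatrix (M ^ k)).mulVec (uFun M k A f) j‖ ^ 2 else 0) := by
  have h := main_sum M hM A hA f hf k
  refine h.trans (le_of_eq ?_)
  have h2 : ∀ j : Fin (M ^ k), (if (j : ℕ) ∈ cantorC M k A then
        ‖(dftMatrix (M ^ k)).mulVec (uFun M k A f) j‖ ^ 2 else 0) =
      (fun n : ℕ => if n ∈ cantorC M k A then
        ∏ s ∈ Finset.range k, ‖Gf M f ((n : ℝ) / (M : ℝ) ^ (s + 1))‖ ^ 2 else 0) j := by
    intro j
    rw [transform_eq M k hM A hA f hf, norm_prod, ← Finset.prod_pow]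
  rw [Finset.sum_congr rfl fun j _ => h2 j]
  rw [Fin.sum_univ_eq_sum_range (fun n : ℕ => if n ∈ cantorC M k A then
        ∏ s ∈ Finset.range k, ‖Gf M f ((n : ℝ) / (M : ℝ) ^ (s + 1))‖ ^ 2 else 0)]
  rw [Finset.sum_ite_mem, Finset.inter_eq_right.2]
  intro n hn
  exact Finset.mem_range.2 (cantorC_lt M k A hA n hn)

end
end

section
/- Fix 1/2 < δ < 1. There exists M₀ ∈ ℕ such that for every integer M ≥ M₀, with A = { l ∈ {0,…,M−1} : |l − M/2| ≤ M^δ/2 } and g the discrete Gaussian, one has for every y ∈ [0, 1/M]: Σ_{l ∈ {0,…,M−1} \ A} |G_{g·𝟙_A}(l/M + y)|² ≤ (60/√M)·e^{−(π/4)·M^{2δ−1}}. -/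
open scoped Classical

noncomputable section

/-- The alphabet `A = { l ∈ {0,…,M-1} : |l - M/2| ≤ M^δ/2 }`. -/
def alphabetA (M : ℕ) (δ : ℝ) : Finset ℕ :=
  (Finset.range M).filter fun l => |(l : ℝ) - (M : ℝ) / 2| ≤ (M : ℝ) ^ δ / 2

/-- The discrete Gaussian `g(l) = M^{-1/2} e^{-π(l-M/2)²/M} e^{iπl}`. -/
def gaussD (M : ℕ) : ℤ → ℂ := fun l =>
  (((Real.sqrt M)⁻¹ * Real.exp (-(Real.pi * ((l : ℝ) - (M : ℝ) / 2) ^ 2 / (M : ℝ))) : ℝ) : ℂ) *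
    Complex.exp ((Real.pi * (l : ℝ) : ℝ) * Complex.I)

/-- The restriction `f·𝟙_A` of `f : ℤ → ℂ` to an alphabet `A ⊆ ℕ`, extended by zero. -/
def restrictA (A : Finset ℕ) (f : ℤ → ℂ) : ℤ → ℂ := fun l =>
  if ∃ a ∈ A, l = (a : ℤ) then f l else 0

def Wt (n : ℤ) : ℝ := 1 / (1 + (n : ℝ) ^ 2)

lemma Wt_pos (n : ℤ) : 0 < Wt n := by unfold Wt; positivity

lemma Wt_summable : Summable Wt := by
  have h1 : Summable fun n : ℤ => 1 / (n : ℝ) ^ 2 := Real.summable_one_div_int_pow.mpr (by norm_num)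
  have h2 : Summable fun n : ℤ => if n = 0 then (1 : ℝ) else 0 := (hasSum_ite_eq 0 1).summable
  refine Summable.of_nonneg_of_le (fun n => (Wt_pos n).le) (fun n => ?_) (h1.add h2)
  unfold Wt
  by_cases h : n = 0
  · subst h; norm_num
  · have : (0 : ℝ) < (n : ℝ) ^ 2 := by positivity
    simp only [h, if_false, add_zero]
    gcongr
    linarith

lemma exp_le_Wt (c R : ℝ) (hR : 1 ≤ R) (hc : 1 ≤ R * c) (n : ℤ) :
    Real.exp (-(c * (n : ℝ) ^ 2)) ≤ R * Wt n := by
  have hc0 : 0 < c := by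
    by_contra h
    push Not at h
    nlinarith
  have h1 := Real.add_one_le_exp (c * (n : ℝ) ^ 2)
  have hn := sq_nonneg (n : ℝ)
  rw [Real.exp_neg, Wt, mul_one_div, inv_eq_one_div, div_le_div_iff₀ (Real.exp_pos _) (by positivity)]
  nlinarith

lemma norm_term (M : ℕ) (x : ℝ) (l : ℤ) :
    ‖gaussD M l * ec ((l : ℝ) * x)‖ =
      (Real.sqrt M)⁻¹ * Real.exp (-(Real.pi * ((l : ℝ) - (M : ℝ) / 2) ^ 2 / (M : ℝ))) := by
  have h1 : ‖ec ((l : ℝ) * x)‖ = 1 := by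
    unfold ec
    have := Complex.norm_exp_ofReal_mul_I (-(2 * Real.pi * ((l : ℝ) * x)))
    push_cast at this ⊢
    exact this
  rw [norm_mul, h1, gaussD, norm_mul, Complex.norm_exp_ofReal_mul_I, Complex.norm_real,
    Real.norm_of_nonneg (by positivity)]
  ring

lemma norm_term_le (M : ℕ) (hM : 1 ≤ M) (x E : ℝ) (hE0 : 0 ≤ E) (hEM : E ≤ M) (l : ℤ)
    (hu : M * E / 4 ≤ ((l : ℝ) - (M : ℝ) / 2) ^ 2) :
    ‖gaussD M l * ec ((l : ℝ) * x)‖ ≤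
      Real.exp Real.pi * Real.exp (-(Real.pi / 4) * E) * M ^ 2 * Wt l := by
  have hM' : (1 : ℝ) ≤ M := by exact_mod_cast hM
  have hM0 : (0 : ℝ) < M := by linarith
  rw [norm_term]
  have hs : (Real.sqrt M)⁻¹ ≤ 1 := inv_le_one_of_one_le₀ (by
    rw [Real.le_sqrt' one_pos]; linarith)
  have hpi := Real.pi_gt_three
  have key : E / 4 - 1 / 2 + (l : ℝ) ^ 2 / (2 * M ^ 2) ≤ ((l : ℝ) - (M : ℝ) / 2) ^ 2 / M := by
    set u := (l : ℝ) - (M : ℝ) / 2 with hudef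
    have hl : (l : ℝ) = u + M / 2 := by rw [hudef]; ring
    have e1 : E / 4 - 1 / 2 + (l : ℝ) ^ 2 / (2 * M ^ 2)
        = ((E / 4 - 1 / 2) * M ^ 2 + (l : ℝ) ^ 2 / 2) / M ^ 2 := by field_simp
    have e2 : u ^ 2 / M = (u ^ 2 * M) / M ^ 2 := by field_simp
    rw [e1, e2]
    apply div_le_div_of_nonneg_right _ (by positivity)
    rw [hl]
    have h1 : (M - 1) * (M * E / 4) ≤ (M - 1) * u ^ 2 :=
      mul_le_mul_of_nonneg_left hu (by linarith)
    have h2 : M * E ≤ M * M := mul_le_mul_of_nonneg_left hEM hM0.le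
    nlinarith [sq_nonneg (u - M / 2)]
  have h2 : Real.exp (-(Real.pi * ((l : ℝ) - (M : ℝ) / 2) ^ 2 / (M : ℝ))) ≤
      Real.exp Real.pi * Real.exp (-(Real.pi / 4) * E) *
        Real.exp (-(Real.pi / (2 * M ^ 2) * (l : ℝ) ^ 2)) := by
    rw [← Real.exp_add, ← Real.exp_add]
    apply Real.exp_le_exp.mpr
    have := mul_le_mul_of_nonneg_left key Real.pi_pos.le
    have e3 : Real.pi / (2 * M ^ 2) * (l : ℝ) ^ 2 = Real.pi * ((l : ℝ) ^ 2 / (2 * M ^ 2)) := by ring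
    have e4 : Real.pi * ((l : ℝ) - (M : ℝ) / 2) ^ 2 / (M : ℝ)
      = Real.pi * (((l : ℝ) - (M : ℝ) / 2) ^ 2 / (M : ℝ)) := by ring
    rw [e3, e4]
    nlinarith
  have h3 := exp_le_Wt (Real.pi / (2 * M ^ 2)) (M ^ 2) (by nlinarith)
    (by
      have : (M : ℝ) ^ 2 * (Real.pi / (2 * M ^ 2)) = Real.pi / 2 := by field_simp
      rw [this]; linarith) l
  calc _ ≤ 1 * Real.exp (-(Real.pi * ((l : ℝ) - (M : ℝ) / 2) ^ 2 / (M : ℝ))) := by gcongr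
    _ ≤ _ := by
      rw [one_mul, mul_assoc (Real.exp Real.pi * Real.exp (-(Real.pi / 4) * E))]
      exact h2.trans (by gcongr)

lemma term_eq (M : ℕ) (hM : 1 ≤ M) (x : ℝ) (l : ℤ) :
    gaussD M l * ec ((l : ℝ) * x) =
      (((Real.sqrt M)⁻¹ * Real.exp (-(Real.pi * M / 4)) : ℝ) : ℂ) *
      Complex.exp (-Real.pi * ((1 / M : ℝ) : ℂ) * (l : ℂ) ^ 2
        + 2 * Real.pi * (1 / 2 + Complex.I * (1 / 2 - x)) * l) := by
  have hM0 : (M : ℂ) ≠ 0 := by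
    have : M ≠ 0 := by omega
    exact_mod_cast this
  unfold gaussD ec
  push_cast
  rw [mul_assoc, mul_assoc, mul_assoc, ← Complex.exp_add, ← Complex.exp_add, mul_assoc (_)⁻¹,
    ← Complex.exp_add]
  congr 2
  field_simp
  ring

lemma poisson_le (M : ℕ) (hM : 1 ≤ M) (x E : ℝ) (hx0 : 0 ≤ x) (hx1 : x ≤ 1)
    (hE : E / 4 - 1 ≤ M * (x - 1 / 2) ^ 2) :
    ‖∑' l : ℤ, gaussD M l * ec ((l : ℝ) * x)‖ ≤
      2 * Real.exp (2 * Real.pi) * Real.exp (-(Real.pi / 4) * E) * ∑' n, Wt n := by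
  have hM' : (1 : ℝ) ≤ M := by exact_mod_cast hM
  have hM0 : (0 : ℝ) < M := by linarith
  have hpi := Real.pi_gt_three
  simp_rw [term_eq M hM x]
  rw [tsum_mul_left, Complex.tsum_exp_neg_quadratic (a := ((1 / M : ℝ) : ℂ))
    (by rw [Complex.ofReal_re]; positivity)]
  rw [norm_mul, norm_mul, Complex.norm_real, Real.norm_of_nonneg (by positivity), norm_div, norm_one,
    Complex.norm_cpow_eq_rpow_re_of_pos (by positivity)]
  have hre : ((1 / 2 : ℂ)).re = 1 / 2 := by norm_num
  rw [hre, ← Real.sqrt_eq_rpow]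
  have hsq : (1 : ℝ) / Real.sqrt (1 / M) = Real.sqrt M := by
    rw [Real.sqrt_div zero_le_one, Real.sqrt_one, one_div_one_div]
  rw [hsq]
  have hsM : 0 < Real.sqrt M := Real.sqrt_pos.mpr hM0
  have bound : ∀ n : ℤ, ‖Complex.exp (-Real.pi / ((1 / M : ℝ) : ℂ) *
      ((n : ℂ) + Complex.I * (1 / 2 + Complex.I * (1 / 2 - x))) ^ 2)‖ ≤
      Real.exp (Real.pi * M / 4) * (2 * Real.exp (2 * Real.pi) * Real.exp (-(Real.pi / 4) * E))
        * Wt n := by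
    intro n
    have he : (-Real.pi / ((1 / M : ℝ) : ℂ) *
      ((n : ℂ) + Complex.I * (1 / 2 + Complex.I * (1 / 2 - x))) ^ 2) =
      ((-Real.pi * M * ((n + (x - 1 / 2)) ^ 2 - 1 / 4) : ℝ) : ℂ)
        + ((-Real.pi * M * (n + (x - 1 / 2)) : ℝ) : ℂ) * Complex.I := by
      have hI : (n : ℂ) + Complex.I * (1 / 2 + Complex.I * (1 / 2 - x))
        = (n + (x - 1 / 2)) + Complex.I / 2 := by
        linear_combination (1 / 2 - (x : ℂ)) * Complex.I_sq
      rw [hI]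
      push_cast
      rw [one_div, div_inv_eq_mul]
      linear_combination (-Real.pi * M / 4 : ℂ) * Complex.I_sq
    rw [he, Complex.exp_add, norm_mul, Complex.norm_exp_ofReal_mul_I, mul_one, ← Complex.ofReal_exp,
      Complex.norm_real, Real.norm_of_nonneg (Real.exp_pos _).le]
    set t := x - 1 / 2 with ht
    have ht1 : t ≤ 1 / 2 := by linarith
    have ht2 : -(1 / 2) ≤ t := by linarith
    have htt : t ^ 2 ≤ 1 / 4 := by nlinarith
    have hcase : n = 0 ∨ (1 : ℝ) ≤ n ∨ (n : ℝ) ≤ -1 := by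
      rcases lt_trichotomy n 0 with h | h | h
      · right; right; exact_mod_cast (by omega : n ≤ -1)
      · left; exact h
      · right; left; exact_mod_cast h
    have a1 : t ^ 2 ≤ (n + t) ^ 2 := by
      rcases hcase with h | h | h
      · simp [h]
      · nlinarith
      · nlinarith
    have a2 : (n : ℝ) ^ 2 / 4 ≤ (n + t) ^ 2 := by
      rcases hcase with h | h | h
      · simp [h]; positivity
      · have : (0 : ℝ) ≤ n / 2 + t := by linarith
        nlinarith
      · have : (n : ℝ) / 2 + t ≤ 0 := by linarith
        nlinarith
    have a3 : E / 4 - 2 + (n : ℝ) ^ 2 / 4 ≤ M * (n + t) ^ 2 := by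
      have := mul_le_mul_of_nonneg_left a1 (by linarith : (0 : ℝ) ≤ M - 1)
      nlinarith
    have h3 := exp_le_Wt (Real.pi / 4) 2 (by norm_num) (by linarith) n
    calc Real.exp (-Real.pi * M * ((n + t) ^ 2 - 1 / 4))
        ≤ Real.exp (Real.pi * M / 4) * (Real.exp (2 * Real.pi) * Real.exp (-(Real.pi / 4) * E))
          * Real.exp (-(Real.pi / 4 * (n : ℝ) ^ 2)) := by
          rw [← Real.exp_add, ← Real.exp_add, ← Real.exp_add]
          apply Real.exp_le_exp.mpr
          have := mul_le_mul_of_nonneg_left a3 Real.pi_pos.le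
          nlinarith
      _ ≤ Real.exp (Real.pi * M / 4) * (Real.exp (2 * Real.pi) * Real.exp (-(Real.pi / 4) * E))
          * (2 * Wt n) := by gcongr
      _ = _ := by ring
  have hb := tsum_of_norm_bounded (Wt_summable.hasSum.mul_left _) bound
  calc _ ≤ (Real.sqrt M)⁻¹ * Real.exp (-(Real.pi * M / 4)) * (Real.sqrt M *
        (Real.exp (Real.pi * M / 4) * (2 * Real.exp (2 * Real.pi) * Real.exp (-(Real.pi / 4) * E))
        * ∑' n, Wt n)) := by gcongr
    _ = ((Real.sqrt M)⁻¹ * Real.sqrt M) * (Real.exp (-(Real.pi * M / 4)) * Real.exp (Real.pi * M / 4))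
        * (2 * Real.exp (2 * Real.pi) * Real.exp (-(Real.pi / 4) * E) * ∑' n, Wt n) := by ring
    _ = _ := by
      rw [inv_mul_cancel₀ hsM.ne', ← Real.exp_add, neg_add_cancel, Real.exp_zero]; ring

lemma Gf_le (M : ℕ) (hM : 1 ≤ M) (δ x : ℝ) (hδ1 : 1 / 2 < δ) (hδ2 : δ < 1) (hx0 : 0 ≤ x) (hx1 : x ≤ 1)
    (hE : (M : ℝ) ^ (2 * δ - 1) / 4 - 1 ≤ M * (x - 1 / 2) ^ 2) :
    ‖Gf M (restrictA (alphabetA M δ) (gaussD M)) x‖ ≤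
      3 * Real.exp (2 * Real.pi) * (∑' n, Wt n) * M ^ 2 *
        Real.exp (-(Real.pi / 4) * (M : ℝ) ^ (2 * δ - 1)) := by
  have hM' : (1 : ℝ) ≤ M := by exact_mod_cast hM
  have hM0 : (0 : ℝ) < M := by linarith
  have hpi := Real.pi_gt_three
  set E := (M : ℝ) ^ (2 * δ - 1) with hEdef
  have hE0 : 0 ≤ E := by positivity
  have hEM : E ≤ M := by
    calc E ≤ (M : ℝ) ^ (1 : ℝ) := Real.rpow_le_rpow_of_exponent_le hM' (by linarith)
      _ = M := Real.rpow_one _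
  have hME : M * E = ((M : ℝ) ^ δ) ^ 2 := by
    rw [hEdef, Real.rpow_sub_one hM0.ne', mul_div_cancel₀ _ hM0.ne', ← Real.rpow_natCast,
      ← Real.rpow_mul hM0.le]
    congr 1; push_cast; ring
  have hMd : (M : ℝ) ^ δ ≤ M := by
    calc (M : ℝ) ^ δ ≤ (M : ℝ) ^ (1 : ℝ) := Real.rpow_le_rpow_of_exponent_le hM' (by linarith)
      _ = M := Real.rpow_one _
  have hMd0 : 0 ≤ (M : ℝ) ^ δ := by positivity
  set S := ∑' n, Wt n with hS
  have hS0 : 0 ≤ S := tsum_nonneg fun n => (Wt_pos n).le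
  set F : ℤ → ℂ := fun l => gaussD M l * ec ((l : ℝ) * x) with hF
  set P : ℤ → Prop := fun l => ∃ a ∈ alphabetA M δ, l = (a : ℤ) with hP
  have hFs : Summable F := by
    refine Summable.of_norm_bounded (Wt_summable.mul_left
      (Real.exp Real.pi * Real.exp (-(Real.pi / 4) * 0) * M ^ 2)) (fun l => ?_)
    exact norm_term_le M hM x 0 le_rfl hM0.le l (by simp; positivity)
  set T : ℤ → ℂ := fun l => if P l then 0 else F l with hT
  have hTb : ∀ l, ‖T l‖ ≤ Real.exp Real.pi * Real.exp (-(Real.pi / 4) * E) * M ^ 2 * Wt l := by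
    intro l
    by_cases h : P l
    · have := Wt_pos l
      simp only [hT, h, if_true, norm_zero]; positivity
    · simp only [hT, h, if_false]
      refine norm_term_le M hM x E hE0 hEM l ?_
      have hu : (M : ℝ) ^ δ / 2 ≤ |(l : ℝ) - M / 2| := by
        by_contra hc
        push Not at hc
        apply h
        have h1 := abs_lt.mp hc
        have hl0 : (0 : ℝ) < l := by linarith
        have hl1 : (l : ℝ) < M := by linarith
        have hl0' : 0 < l := by exact_mod_cast hl0
        have hl1' : l < M := by exact_mod_cast hl1
        obtain ⟨a, rfl⟩ := Int.eq_ofNat_of_zero_le hl0'.le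
        refine ⟨a, ?_, rfl⟩
        rw [alphabetA, Finset.mem_filter, Finset.mem_range]
        refine ⟨by exact_mod_cast hl1', ?_⟩
        push_cast at hc
        exact hc.le
      rw [hME, ← sq_abs ((l : ℝ) - M / 2)]
      nlinarith
  have hTs : Summable T := Summable.of_norm_bounded (Wt_summable.mul_left _) hTb
  have hsplit : ∑' l : ℤ, restrictA (alphabetA M δ) (gaussD M) l * ec ((l : ℝ) * x)
      = ∑' l, F l - ∑' l, T l := by
    rw [← hFs.tsum_sub hTs]
    congr 1
    funext l
    by_cases h : P l
    · have h' : ∃ a ∈ alphabetA M δ, l = (a : ℤ) := h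
      simp only [restrictA, hT, h, if_true, sub_zero, hF]
      rw [if_pos h']
    · have h' : ¬ ∃ a ∈ alphabetA M δ, l = (a : ℤ) := h
      simp only [restrictA, hT, h, if_false, sub_self]
      rw [if_neg h', zero_mul]
  have b1 := poisson_le M hM x E hx0 hx1 hE
  have b2 := tsum_of_norm_bounded (Wt_summable.hasSum.mul_left _) hTb
  have hs : (Real.sqrt M)⁻¹ ≤ 1 := inv_le_one_of_one_le₀ (by
    rw [Real.le_sqrt' one_pos]; linarith)
  have hee : Real.exp Real.pi ≤ Real.exp (2 * Real.pi) := Real.exp_le_exp.mpr (by linarith)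
  have hM2 : (1 : ℝ) ≤ (M : ℝ) ^ 2 := by nlinarith
  unfold Gf
  rw [hsplit, norm_mul, Complex.norm_real, Real.norm_of_nonneg (by positivity)]
  calc _ ≤ 1 * ‖∑' l, F l - ∑' l, T l‖ := by gcongr
    _ ≤ ‖∑' l, F l‖ + ‖∑' l, T l‖ := by rw [one_mul]; exact norm_sub_le _ _
    _ ≤ 2 * Real.exp (2 * Real.pi) * Real.exp (-(Real.pi / 4) * E) * S * 1 +
        Real.exp Real.pi * Real.exp (-(Real.pi / 4) * E) * M ^ 2 * S := by
        rw [mul_one]; exact add_le_add b1 b2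
    _ ≤ 2 * Real.exp (2 * Real.pi) * Real.exp (-(Real.pi / 4) * E) * S * M ^ 2 +
        Real.exp (2 * Real.pi) * Real.exp (-(Real.pi / 4) * E) * M ^ 2 * S := by gcongr
    _ = _ := by ring

/-- Mass of `G_{g·𝟙_A}` outside the alphabet is exponentially small. -/
theorem stmt8 (δ : ℝ) (hδ1 : 1 / 2 < δ) (hδ2 : δ < 1) :
    ∃ M₀ : ℕ, ∀ M : ℕ, M₀ ≤ M → ∀ y : ℝ, 0 ≤ y → y ≤ 1 / (M : ℝ) →
      ∑ l ∈ Finset.range M \ alphabetA M δ,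
          ‖Gf M (restrictA (alphabetA M δ) (gaussD M)) ((l : ℝ) / (M : ℝ) + y)‖ ^ 2 ≤
        60 / Real.sqrt M * Real.exp (-(Real.pi / 4) * (M : ℝ) ^ (2 * δ - 1)) := by
  set C := 3 * Real.exp (2 * Real.pi) * (∑' n, Wt n) with hC
  have hC0 : 0 ≤ C := by
    have : 0 ≤ ∑' n, Wt n := tsum_nonneg fun n => (Wt_pos n).le
    positivity
  have hp : 0 < 2 * δ - 1 := by linarith
  have hlim : Filter.Tendsto (fun M : ℕ => C ^ 2 * ((M : ℝ) ^ 6 *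
      Real.exp (-(Real.pi / 4) * (M : ℝ) ^ (2 * δ - 1)))) Filter.atTop (nhds 0) := by
    have h1 := tendsto_rpow_mul_exp_neg_mul_atTop_nhds_zero (6 / (2 * δ - 1)) (Real.pi / 4)
      (by positivity)
    have h2 := (h1.comp (tendsto_rpow_atTop hp)).comp tendsto_natCast_atTop_atTop
    have h3 := h2.const_mul (C ^ 2)
    rw [mul_zero] at h3
    refine h3.congr fun M => ?_
    simp only [Function.comp]
    rw [← Real.rpow_mul (Nat.cast_nonneg M), mul_div_cancel₀ _ hp.ne']
    norm_cast
  have hev := (hlim.eventually (gt_mem_nhds (by norm_num : (0 : ℝ) < 60))).and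
    (((tendsto_rpow_atTop (by linarith : 0 < δ)).comp tendsto_natCast_atTop_atTop).eventually
      (Filter.eventually_ge_atTop (2 : ℝ)))
  obtain ⟨M₀, hM₀⟩ := Filter.eventually_atTop.mp hev
  refine ⟨max M₀ 1, fun M hM y hy0 hy1 => ?_⟩
  have hM1 : 1 ≤ M := le_trans (le_max_right _ _) hM
  obtain ⟨hbig, hMd⟩ := hM₀ M (le_trans (le_max_left _ _) hM)
  simp only [Function.comp] at hMd
  have hM' : (1 : ℝ) ≤ M := by exact_mod_cast hM1
  have hMpos : (0 : ℝ) < M := by linarith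
  set E := (M : ℝ) ^ (2 * δ - 1) with hEdef
  have hME : M * E = ((M : ℝ) ^ δ) ^ 2 := by
    rw [hEdef, Real.rpow_sub_one hMpos.ne', mul_div_cancel₀ _ hMpos.ne', ← Real.rpow_natCast,
      ← Real.rpow_mul hMpos.le]
    congr 1; push_cast; ring
  have hMdM : (M : ℝ) ^ δ ≤ M := by
    calc (M : ℝ) ^ δ ≤ (M : ℝ) ^ (1 : ℝ) := Real.rpow_le_rpow_of_exponent_le hM' (by linarith)
      _ = M := Real.rpow_one _
  have hMy : M * y ≤ 1 := by
    rw [le_div_iff₀ hMpos] at hy1; linarith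
  have hMy0 : 0 ≤ M * y := by positivity
  have hterm : ∀ l ∈ Finset.range M \ alphabetA M δ,
      ‖Gf M (restrictA (alphabetA M δ) (gaussD M)) ((l : ℝ) / (M : ℝ) + y)‖ ^ 2 ≤
        (C * M ^ 2 * Real.exp (-(Real.pi / 4) * E)) ^ 2 := by
    intro l hl
    rw [Finset.mem_sdiff, alphabetA, Finset.mem_filter] at hl
    obtain ⟨hl1, hl2⟩ := hl
    have hlfar : (M : ℝ) ^ δ / 2 < |(l : ℝ) - M / 2| := by
      by_contra h
      exact hl2 ⟨hl1, not_lt.mp h⟩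
    have hlM : (l : ℝ) + 1 ≤ M := by
      have := Finset.mem_range.mp hl1
      exact_mod_cast this
    set x := (l : ℝ) / (M : ℝ) + y with hx
    have hMx : M * x = l + M * y := by rw [hx]; field_simp
    have hx0 : 0 ≤ x := by positivity
    have hx1 : x ≤ 1 := by
      by_contra h
      push Not at h
      nlinarith
    have hfar : (M : ℝ) ^ δ / 2 - 1 ≤ |M * (x - 1 / 2)| := by
      have e : M * (x - 1 / 2) = (l - M / 2) + M * y := by rw [mul_sub, hMx]; ring
      rw [e]
      rcases lt_abs.mp hlfar with h | h
      · exact le_trans (by linarith) (le_abs_self _)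
      · exact le_trans (by linarith) (neg_le_abs _)
    refine pow_le_pow_left₀ (norm_nonneg _) ?_ 2
    refine Gf_le M hM1 δ x hδ1 hδ2 hx0 hx1 ?_
    have hsq : ((M : ℝ) ^ δ / 2 - 1) ^ 2 ≤ (M * (x - 1 / 2)) ^ 2 := by
      rw [← sq_abs (M * (x - 1 / 2))]
      exact pow_le_pow_left₀ (by linarith) hfar 2
    have : M * (E / 4 - 1) ≤ M * (M * (x - 1 / 2) ^ 2) := by nlinarith
    exact le_of_mul_le_mul_left this hMpos
  have hcard : ((Finset.range M \ alphabetA M δ).card : ℝ) ≤ M := by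
    have := Finset.card_le_card (Finset.sdiff_subset : Finset.range M \ alphabetA M δ ⊆ Finset.range M)
    rw [Finset.card_range] at this
    exact_mod_cast this
  have hsum := Finset.sum_le_card_nsmul _ _ _ hterm
  rw [nsmul_eq_mul] at hsum
  set X := Real.exp (-(Real.pi / 4) * E) with hX
  have hX0 : 0 < X := Real.exp_pos _
  have hsM : 0 < Real.sqrt M := Real.sqrt_pos.mpr hMpos
  have hsM2 : Real.sqrt M ≤ M := by
    rw [Real.sqrt_le_left hMpos.le]; nlinarith
  calc _ ≤ _ := hsum
    _ ≤ M * (C * M ^ 2 * X) ^ 2 := by gcongr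
    _ ≤ 60 / M * X := by
      rw [div_mul_eq_mul_div, le_div_iff₀ hMpos]
      calc M * (C * M ^ 2 * X) ^ 2 * M = (C ^ 2 * (M ^ 6 * X)) * X := by ring
        _ ≤ 60 * X := by gcongr
    _ ≤ _ := by gcongr

end
end
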